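/- For every searchable family of graphs over an alphabet Σ and every k ≥ 1, the family of graph languages accepted by deterministic k-head graph-walking automata with nested pebbles equals the family definable in first-order logic with k-ary deterministic transitive closure: DPTWA^k = FO+DTC^k. -/

import Mathlib

namespace NestedPebblesGraphs

/-- A nonempty finite weakly connected directed graph with node and edge labels
from `Sig`, such that no node has two outgoing edges with the same label, nor two
incoming edges with the same label. -/
structure LGraph (Sig : Type) : Type 1 where
  V : Type
  finV : Fintype V
  neV : Nonempty V
  nlab : V → Sig
  edge : Sig → V → V → Prop
  out_unique : ∀ a u v v', edge a u v → edge a u v' → v = v'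
  in_unique : ∀ a u u' v, edge a u v → edge a u' v → u = u'
  conn : ∀ u v : V,
    Relation.ReflTransGen (fun x y => (∃ a, edge a x y) ∨ (∃ a, edge a y x)) u v

variable {Sig : Type}

/-!  ### First-order logic with k-ary transitive closure, on graphs  -/

/-- First-order formulas on graphs over `Sig`, with a `k`-ary transitive closure
operator.  `lab a x` means node `x` has label `a`; `edg a x y` means there is an
`a`-labelled edge from `x` to `y`; `tc xs ys φ us vs` is the transitive closure
`φ*` of `φ` with respect to the tuples of variables `xs`, `ys` (which it binds),
applied to the tuples of variables `us`, `vs`. -/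
inductive GForm (Sig : Type) (k : ℕ) : Type
  | lab (a : Sig) (x : ℕ)
  | edg (a : Sig) (x y : ℕ)
  | eq (x y : ℕ)
  | not (φ : GForm Sig k)
  | and (φ ψ : GForm Sig k)
  | or (φ ψ : GForm Sig k)
  | ex (x : ℕ) (φ : GForm Sig k)
  | all (x : ℕ) (φ : GForm Sig k)
  | tc (xs ys : Fin k → ℕ) (φ : GForm Sig k) (us vs : Fin k → ℕ)

/-- Update a valuation on a tuple of variables simultaneously. -/
noncomputable def updVec {α : Type} {k : ℕ} (ν : ℕ → α) (xs : Fin k → ℕ) (a : Fin k → α) :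
    ℕ → α :=
  fun n => if h : ∃ i, xs i = n then a h.choose else ν n

/-- Satisfaction of a formula in a graph `g` under a valuation of the variables. -/
def GSat {k : ℕ} (g : LGraph Sig) : GForm Sig k → (ℕ → g.V) → Prop
  | .lab a x, ν => g.nlab (ν x) = a
  | .edg a x y, ν => g.edge a (ν x) (ν y)
  | .eq x y, ν => ν x = ν y
  | .not φ, ν => ¬ GSat g φ ν
  | .and φ ψ, ν => GSat g φ ν ∧ GSat g ψ ν
  | .or φ ψ, ν => GSat g φ ν ∨ GSat g ψ ν
  | .ex x φ, ν => ∃ u : g.V, GSat g φ (Function.update ν x u)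
  | .all x φ, ν => ∀ u : g.V, GSat g φ (Function.update ν x u)
  | .tc xs ys φ us vs, ν =>
      Relation.ReflTransGen
        (fun a b : Fin k → g.V => GSat g φ (updVec (updVec ν xs a) ys b))
        (fun i => ν (us i)) (fun i => ν (vs i))

/-- The free variables of a formula. -/
def gfree {k : ℕ} : GForm Sig k → Set ℕ
  | .lab _ x => {x}
  | .edg _ x y => {x, y}
  | .eq x y => {x, y}
  | .not φ => gfree φ
  | .and φ ψ => gfree φ ∪ gfree ψ
  | .or φ ψ => gfree φ ∪ gfree ψ
  | .ex x φ => gfree φ \ {x}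
  | .all x φ => gfree φ \ {x}
  | .tc xs ys φ us vs =>
      (gfree φ \ (Set.range xs ∪ Set.range ys)) ∪ Set.range us ∪ Set.range vs

/-- Two `k`-tuples of variables consist of `2k` pairwise distinct variables. -/
def Distinct2 {k : ℕ} (xs ys : Fin k → ℕ) : Prop :=
  Function.Injective xs ∧ Function.Injective ys ∧ ∀ i j, xs i ≠ ys j

/-- `φ` is functional in the tuples of variables `xs`, `ys`. -/
def GFunctionalIn {k : ℕ} (φ : GForm Sig k) (xs ys : Fin k → ℕ) : Prop :=
  ∀ (g : LGraph Sig) (ν : ℕ → g.V) (a b b' : Fin k → g.V),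
    GSat g φ (updVec (updVec ν xs a) ys b) →
    GSat g φ (updVec (updVec ν xs a) ys b') → b = b'

/-- Well-formedness: in each transitive closure the `2k` bound variables are
pairwise distinct and occur free in the body. -/
def GWF {k : ℕ} : GForm Sig k → Prop
  | .not φ => GWF φ
  | .and φ ψ => GWF φ ∧ GWF ψ
  | .or φ ψ => GWF φ ∧ GWF ψ
  | .ex _ φ => GWF φ
  | .all _ φ => GWF φ
  | .tc xs ys φ _ _ =>
      Distinct2 xs ys ∧ (Set.range xs ∪ Set.range ys) ⊆ gfree φ ∧ GWF φ
  | _ => True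

/-- All transitive closures occurring in the formula are deterministic. -/
def GDetTC {k : ℕ} : GForm Sig k → Prop
  | .not φ => GDetTC φ
  | .and φ ψ => GDetTC φ ∧ GDetTC ψ
  | .or φ ψ => GDetTC φ ∧ GDetTC ψ
  | .ex _ φ => GDetTC φ
  | .all _ φ => GDetTC φ
  | .tc xs ys φ _ _ => GFunctionalIn φ xs ys ∧ GDetTC φ
  | _ => True

/-- All occurrences of transitive closure are positive. -/
def GPosTC {k : ℕ} : Bool → GForm Sig k → Prop
  | b, .not φ => GPosTC (!b) φ
  | b, .and φ ψ => GPosTC b φ ∧ GPosTC b ψ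
  | b, .or φ ψ => GPosTC b φ ∧ GPosTC b ψ
  | b, .ex _ φ => GPosTC b φ
  | b, .all _ φ => GPosTC b φ
  | b, .tc _ _ φ _ _ => b = true ∧ GPosTC b φ
  | _, _ => True

/-- The formula contains no transitive closure operator (pure first-order). -/
def GTCFree {k : ℕ} : GForm Sig k → Prop
  | .not φ => GTCFree φ
  | .and φ ψ => GTCFree φ ∧ GTCFree ψ
  | .or φ ψ => GTCFree φ ∧ GTCFree ψ
  | .ex _ φ => GTCFree φ
  | .all _ φ => GTCFree φ
  | .tc _ _ _ _ _ => False
  | _ => True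

/-- `FO+DTC^k` graph languages within the family `F`: those defined by closed
formulas with deterministic `k`-ary transitive closure. -/
def FODTCg (Sig : Type) (F : Set (LGraph Sig)) (k : ℕ) : Set (Set (LGraph Sig)) :=
  {L | ∃ φ : GForm Sig k, GWF φ ∧ GDetTC φ ∧ gfree φ = ∅ ∧
        L = {g | g ∈ F ∧ ∀ ν : ℕ → g.V, GSat g φ ν}}

/-- `FO+posTC^k` graph languages within the family `F`. -/
def FOposTCg (Sig : Type) (F : Set (LGraph Sig)) (k : ℕ) : Set (Set (LGraph Sig)) :=
  {L | ∃ φ : GForm Sig k, GWF φ ∧ GPosTC true φ ∧ gfree φ = ∅ ∧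
        L = {g | g ∈ F ∧ ∀ ν : ℕ → g.V, GSat g φ ν}}

/-!  ### k-head graph-walking automata with nested pebbles  -/

/-- Tests of a `k`-head graph-walking automaton with pebble set `X`. -/
inductive GTest (Sig : Type) (k : ℕ) (X : Type) : Type
  | lab (i : Fin k) (a : Sig)
  | inedge (i : Fin k) (a : Sig)
  | outedge (i : Fin k) (a : Sig)
  | peb (i : Fin k) (x : X)

/-- Instructions: move head `i` along an incoming or outgoing `a`-labelled edge,
drop a pebble at head `i`, retrieve the most recently dropped pebble (from a
distance), jump head `i` to the node holding pebble `x`, or perform a positive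
(`b = true`) or negated (`b = false`) test. -/
inductive GInstr (Sig : Type) (k : ℕ) (X : Type) : Type
  | inmove (i : Fin k) (a : Sig)
  | outmove (i : Fin k) (a : Sig)
  | dropPeb (i : Fin k) (x : X)
  | retrieve (x : X)
  | jump (i : Fin k) (x : X)
  | test (b : Bool) (τ : GTest Sig k X)

/-- A `k`-head graph-walking automaton with nested pebbles. -/
structure GWA (Sig : Type) (k : ℕ) : Type 1 where
  Q : Type
  finQ : Fintype Q
  X : Type
  finX : Fintype X
  q0 : Q
  acc : Set Q
  instr : Set (Q × GInstr Sig k X × Q)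
  instrFin : instr.Finite

/-- Configurations: a state, the positions of the `k` heads, and the stack of
dropped pebbles with their positions (most recent first). -/
abbrev GConf {k : ℕ} (A : GWA Sig k) (g : LGraph Sig) : Type :=
  A.Q × (Fin k → g.V) × List (A.X × g.V)

/-- Semantics of tests. -/
def gTestHolds {k : ℕ} (g : LGraph Sig) {X : Type} (τ : GTest Sig k X)
    (hs : Fin k → g.V) (π : List (X × g.V)) : Prop :=
  match τ with
  | .lab i a => g.nlab (hs i) = a
  | .inedge i a => ∃ u, g.edge a u (hs i)
  | .outedge i a => ∃ v, g.edge a (hs i) v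
  | .peb i x => (x, hs i) ∈ π

/-- Semantics of a single instruction. -/
def gInstrStep {k : ℕ} (g : LGraph Sig) {X : Type} (ins : GInstr Sig k X)
    (hs : Fin k → g.V) (π : List (X × g.V))
    (hs' : Fin k → g.V) (π' : List (X × g.V)) : Prop :=
  match ins with
  | .inmove i a => π' = π ∧ g.edge a (hs' i) (hs i) ∧ ∀ h, h ≠ i → hs' h = hs h
  | .outmove i a => π' = π ∧ g.edge a (hs i) (hs' i) ∧ ∀ h, h ≠ i → hs' h = hs h
  | .dropPeb i x => hs' = hs ∧ π' = (x, hs i) :: π ∧ ∀ w, (x, w) ∉ π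
  | .retrieve x => hs' = hs ∧ ∃ w, π = (x, w) :: π'
  | .jump i x => π' = π ∧ (x, hs' i) ∈ π ∧ ∀ h, h ≠ i → hs' h = hs h
  | .test b τ => hs' = hs ∧ π' = π ∧ (gTestHolds g τ hs π ↔ b = true)

/-- The step relation of automaton `A` on graph `g`. -/
def GStep {k : ℕ} (A : GWA Sig k) (g : LGraph Sig) : GConf A g → GConf A g → Prop :=
  fun c c' => ∃ ins : GInstr Sig k A.X,
    (c.1, ins, c'.1) ∈ A.instr ∧ gInstrStep g ins c.2.1 c.2.2 c'.2.1 c'.2.2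

/-- `χ'` is the negation of the test `χ`. -/
def gNegOf {k : ℕ} {X : Type} (χ χ' : GInstr Sig k X) : Prop :=
  ∃ b τ, χ = GInstr.test b τ ∧ χ' = GInstr.test (!b) τ

/-- Determinism: any two distinct instructions with the same source state consist
of a test and its negation. -/
def GDeterministic {k : ℕ} (A : GWA Sig k) : Prop :=
  ∀ p χ₁ q₁ χ₂ q₂, (p, χ₁, q₁) ∈ A.instr → (p, χ₂, q₂) ∈ A.instr →
    (χ₁, q₁) ≠ (χ₂, q₂) → gNegOf χ₁ χ₂ ∨ gNegOf χ₂ χ₁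

/-- A configuration is halting if no step is possible from it. -/
def GHaltingConf {k : ℕ} (A : GWA Sig k) (g : LGraph Sig) (c : GConf A g) : Prop :=
  ∀ c', ¬ GStep A g c c'

/-- There is an accepting computation started with all heads on node `u`:
it starts in the initial state with no pebbles, and halts in an accepting state
with no pebbles on the graph. -/
def AccFrom {k : ℕ} (A : GWA Sig k) (g : LGraph Sig) (u : g.V) : Prop :=
  ∃ (q : A.Q) (hs : Fin k → g.V), q ∈ A.acc ∧
    Relation.ReflTransGen (GStep A g) (A.q0, fun _ => u, []) (q, hs, []) ∧
    GHaltingConf A g (q, hs, [])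

/-- `A` accepts `g`: for every choice of initial node there is an accepting
computation. -/
def GAccepts {k : ℕ} (A : GWA Sig k) (g : LGraph Sig) : Prop :=
  ∀ u : g.V, AccFrom A g u

/-- The restriction on automata: acceptance is independent of the initial node. -/
def NodeIndependent {k : ℕ} (A : GWA Sig k) : Prop :=
  ∀ (g : LGraph Sig) (u₁ u₂ : g.V), AccFrom A g u₁ → AccFrom A g u₂

/-- The automaton uses no jump instructions (the basic model). -/
def NoJump {k : ℕ} (A : GWA Sig k) : Prop :=
  ∀ p χ q, (p, χ, q) ∈ A.instr → ∀ i x, χ ≠ GInstr.jump i x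

/-- `DPTWA^k` within the family `F`: graph languages accepted by deterministic
`k`-head graph-walking automata with nested pebbles (no jump instructions). -/
def DPTWAg (Sig : Type) (F : Set (LGraph Sig)) (k : ℕ) : Set (Set (LGraph Sig)) :=
  {L | ∃ A : GWA Sig k, GDeterministic A ∧ NoJump A ∧ NodeIndependent A ∧
        L = {g | g ∈ F ∧ GAccepts A g}}

/-- `DPTWA^k` within the family `F`, for the model extended with jump
instructions. -/
def DPTWAgJ (Sig : Type) (F : Set (LGraph Sig)) (k : ℕ) : Set (Set (LGraph Sig)) :=
  {L | ∃ A : GWA Sig k, GDeterministic A ∧ NodeIndependent A ∧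
        L = {g | g ∈ F ∧ GAccepts A g}}

/-- `NPTWA^k` within the family `F`: graph languages accepted by nondeterministic
`k`-head graph-walking automata with nested pebbles (no jump instructions). -/
def NPTWAg (Sig : Type) (F : Set (LGraph Sig)) (k : ℕ) : Set (Set (LGraph Sig)) :=
  {L | ∃ A : GWA Sig k, NoJump A ∧ NodeIndependent A ∧
        L = {g | g ∈ F ∧ GAccepts A g}}

/-- Started with all heads on node `u` of `g`, the (deterministic) automaton `A`
performs a walk that halts and during which every node of `g` is visited by some
head at least once. -/
def SearchesFrom {k : ℕ} (A : GWA Sig k) (g : LGraph Sig) (u : g.V) : Prop :=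
  ∃ (n : ℕ) (cs : Fin (n + 1) → GConf A g),
    cs 0 = (A.q0, fun _ => u, []) ∧
    (∀ i : Fin n, GStep A g (cs i.castSucc) (cs i.succ)) ∧
    GHaltingConf A g (cs (Fin.last n)) ∧
    ∀ v : g.V, ∃ (i : Fin (n + 1)) (h : Fin k), (cs i).2.1 h = v

/-- A family of graphs is `k`-searchable if some fixed deterministic `k`-head
graph-walking automaton with nested pebbles (a guide) traverses every graph of the
family from every initial node, visiting all nodes and halting. -/
def kSearchable (Sig : Type) (F : Set (LGraph Sig)) (k : ℕ) : Prop :=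
  ∃ A : GWA Sig k, GDeterministic A ∧ NoJump A ∧
    ∀ g ∈ F, ∀ u : g.V, SearchesFrom A g u

/-- A family of graphs is searchable if it is `1`-searchable, i.e., some fixed
single-head deterministic graph-walking automaton with nested pebbles traverses
every graph of the family. -/
def Searchable (Sig : Type) (F : Set (LGraph Sig)) : Prop :=
  kSearchable Sig F 1

/-- Replacing the node labels of a graph. -/
def relabel (g : LGraph Sig) (f : g.V → Sig) : LGraph Sig :=
  { g with nlab := f }

/-- Membership in the family does not depend on the node labels. -/
def NodeLabelInsensitive (F : Set (LGraph Sig)) : Prop :=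
  ∀ g ∈ F, ∀ f : g.V → Sig, relabel g f ∈ F

end NestedPebblesGraphs

namespace NestedPebblesGraphs
open Relation

section FormulaSide
variable {Sig : Type} {k : ℕ}

/-- Iterated existential quantification. -/
def exL (l : List ℕ) (φ : GForm Sig k) : GForm Sig k := l.foldr GForm.ex φ

lemma sat_exL (g : LGraph Sig) (l : List ℕ) (φ : GForm Sig k) (ν : ℕ → g.V) :
    GSat g (exL l φ) ν ↔ ∃ ν' : ℕ → g.V, (∀ n, n ∉ l → ν' n = ν n) ∧ GSat g φ ν' := by
  induction l generalizing ν with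
  | nil =>
    constructor
    · intro h; exact ⟨ν, fun _ _ => rfl, h⟩
    · rintro ⟨ν', h1, h2⟩
      have : ν' = ν := funext fun n => h1 n (by simp)
      subst this; exact h2
  | cons x l ih =>
    change (∃ u, GSat g (exL l φ) (Function.update ν x u)) ↔ _
    constructor
    · rintro ⟨u, h⟩
      obtain ⟨ν', h1, h2⟩ := (ih _).1 h
      refine ⟨ν', fun n hn => ?_, h2⟩
      simp only [List.mem_cons, not_or] at hn
      rw [h1 n hn.2, Function.update_of_ne hn.1]
    · rintro ⟨ν', h1, h2⟩
      refine ⟨ν' x, (ih _).2 ⟨ν', fun n hn => ?_, h2⟩⟩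
      by_cases hx : n = x
      · subst hx; simp
      · rw [Function.update_of_ne hx]; exact h1 n (by simp [hx, hn])

lemma gfree_exL (l : List ℕ) (φ : GForm Sig k) :
    gfree (exL l φ) = gfree φ \ {n | n ∈ l} := by
  induction l with
  | nil => simp [exL]
  | cons x l ih =>
    change gfree (exL l φ) \ {x} = _
    rw [ih]; ext n; simp only [Set.mem_sdiff, Set.mem_ofPred_eq, Set.mem_singleton_iff, List.mem_cons]
    tauto

lemma wf_exL (l : List ℕ) (φ : GForm Sig k) : GWF (exL l φ) ↔ GWF φ := by
  induction l with
  | nil => rfl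
  | cons x l ih => exact ih

lemma det_exL (l : List ℕ) (φ : GForm Sig k) : GDetTC (exL l φ) ↔ GDetTC φ := by
  induction l with
  | nil => rfl
  | cons x l ih => exact ih

/-- `φ` defines `P`, reading the argument `i` from the variable `e i`. -/
structure IsDef {I : Type} (e : I → ℕ) (P : ∀ g : LGraph Sig, (I → g.V) → Prop)
    (φ : GForm Sig k) : Prop where
  wf : GWF φ
  det : GDetTC φ
  free : gfree φ ⊆ Set.range e
  sat : ∀ (g : LGraph Sig) (ν : ℕ → g.V), GSat g φ ν ↔ P g (ν ∘ e)

/-- Definability by an `FO+DTC` formula, for any choice of the free variables. -/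
def FDef (k : ℕ) {I : Type} (P : ∀ g : LGraph Sig, (I → g.V) → Prop) : Prop :=
  ∀ e : I → ℕ, Function.Injective e → ∃ φ : GForm Sig k, IsDef e P φ

lemma exists_fresh (J : Type) [Finite J] (s : Set ℕ) (hs : s.Finite) :
    ∃ e : J → ℕ, Function.Injective e ∧ ∀ j, e j ∉ s := by
  obtain ⟨N, hN⟩ := hs.bddAbove
  obtain ⟨n, ⟨f⟩⟩ := Finite.exists_equiv_fin J
  refine ⟨fun j => N + 1 + (f j : ℕ), fun a b h => ?_, fun j hj => ?_⟩
  · apply f.injective; apply Fin.ext; simpa using h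
  · have : N + 1 + (f j : ℕ) ≤ N := hN hj
    omega

lemma FDef.congr {I : Type} {P P' : ∀ g : LGraph Sig, (I → g.V) → Prop} (h : FDef k P)
    (hP : ∀ g v, P g v ↔ P' g v) : FDef k P' := by
  have : P = P' := by funext g v; exact propext (hP g v)
  exact this ▸ h

lemma FDef.not {I : Type} {P : ∀ g : LGraph Sig, (I → g.V) → Prop} (h : FDef k P) :
    FDef k (fun g v => ¬ P g v) := by
  intro e he
  obtain ⟨φ, h1⟩ := h e he
  exact ⟨.not φ, h1.wf, h1.det, h1.free, fun g ν => not_congr (h1.sat g ν)⟩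

lemma FDef.and {I : Type} {P P' : ∀ g : LGraph Sig, (I → g.V) → Prop} (h : FDef k P)
    (h' : FDef k P') : FDef k (fun g v => P g v ∧ P' g v) := by
  intro e he
  obtain ⟨φ, h1⟩ := h e he
  obtain ⟨φ', h1'⟩ := h' e he
  exact ⟨.and φ φ', ⟨h1.wf, h1'.wf⟩, ⟨h1.det, h1'.det⟩, Set.union_subset h1.free h1'.free,
    fun g ν => and_congr (h1.sat g ν) (h1'.sat g ν)⟩

lemma FDef.or {I : Type} {P P' : ∀ g : LGraph Sig, (I → g.V) → Prop} (h : FDef k P)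
    (h' : FDef k P') : FDef k (fun g v => P g v ∨ P' g v) := by
  intro e he
  obtain ⟨φ, h1⟩ := h e he
  obtain ⟨φ', h1'⟩ := h' e he
  exact ⟨.or φ φ', ⟨h1.wf, h1'.wf⟩, ⟨h1.det, h1'.det⟩, Set.union_subset h1.free h1'.free,
    fun g ν => or_congr (h1.sat g ν) (h1'.sat g ν)⟩

lemma FDef.const {I : Type} (p : Prop) :
    FDef k (fun (g : LGraph Sig) (_ : I → g.V) => p) := by
  have ht : FDef k (fun (g : LGraph Sig) (_ : I → g.V) => True) := by
    intro e he
    refine ⟨.all 0 (.eq 0 0), trivial, trivial, ?_, ?_⟩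
    · intro n hn; simp [gfree] at hn
    · intro g ν; simp [GSat]
  by_cases hp : p
  · simpa [hp] using ht
  · simpa [hp] using ht.not

lemma FDef.lab {I : Type} (a : Sig) (i : I) :
    FDef k (fun (g : LGraph Sig) (v : I → g.V) => g.nlab (v i) = a) := by
  intro e he
  refine ⟨.lab a (e i), trivial, trivial, ?_, ?_⟩
  · intro n hn; simp only [gfree, Set.mem_singleton_iff] at hn; exact ⟨i, hn.symm⟩
  · intro g ν; simp [GSat]

lemma FDef.edg {I : Type} (a : Sig) (i j : I) :
    FDef k (fun (g : LGraph Sig) (v : I → g.V) => g.edge a (v i) (v j)) := by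
  intro e he
  refine ⟨.edg a (e i) (e j), trivial, trivial, ?_, ?_⟩
  · rintro n (hn | hn)
    · exact ⟨i, hn.symm⟩
    · exact ⟨j, hn.symm⟩
  · intro g ν; simp [GSat]

lemma FDef.eq {I : Type} (i j : I) :
    FDef k (fun (g : LGraph Sig) (v : I → g.V) => v i = v j) := by
  intro e he
  refine ⟨.eq (e i) (e j), trivial, trivial, ?_, ?_⟩
  · rintro n (hn | hn)
    · exact ⟨i, hn.symm⟩
    · exact ⟨j, hn.symm⟩
  · intro g ν; simp [GSat]

lemma FDef.exists_fin {I K : Type} [Finite K] {P : K → ∀ g : LGraph Sig, (I → g.V) → Prop}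
    (h : ∀ q, FDef k (P q)) : FDef k (fun g v => ∃ q, P q g v) := by
  classical
  have := Fintype.ofFinite K
  have key : ∀ s : Finset K, FDef k (fun g v => ∃ q ∈ s, P q g v) := by
    intro s
    induction s using Finset.induction_on with
    | empty => exact (FDef.const False).congr (by simp)
    | insert a s _ ih => exact ((h a).or ih).congr (by simp)
  exact (key Finset.univ).congr (by simp)

lemma FDef.forall_fin {I K : Type} [Finite K] {P : K → ∀ g : LGraph Sig, (I → g.V) → Prop}
    (h : ∀ q, FDef k (P q)) : FDef k (fun g v => ∀ q, P q g v) :=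
  (FDef.exists_fin (fun q => (h q).not)).not.congr (by simp)

lemma FDef.ex {I J : Type} [Finite I] [Finite J] {P : ∀ g : LGraph Sig, (I ⊕ J → g.V) → Prop}
    (h : FDef k P) : FDef k (fun g v => ∃ w : J → g.V, P g (Sum.elim v w)) := by
  classical
  intro e he
  obtain ⟨e', he', hd⟩ := exists_fresh J (Set.range e) (Set.finite_range e)
  have hinj : Function.Injective (Sum.elim e e') :=
    he.sumElim he' (fun i j hij => hd j ⟨i, hij⟩)
  obtain ⟨φ, h1⟩ := h _ hinj
  have := Fintype.ofFinite J
  let l : List ℕ := (Finset.univ.image e').toList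
  have hl : ∀ n, n ∈ l ↔ ∃ j, e' j = n := by intro n; simp [l]
  refine ⟨exL l φ, (wf_exL _ _).2 h1.wf, (det_exL _ _).2 h1.det, ?_, ?_⟩
  · rw [gfree_exL]
    rintro n ⟨hn, hn'⟩
    obtain ⟨i | j, hi⟩ := h1.free hn
    · exact ⟨i, hi⟩
    · exact absurd ((hl n).2 ⟨j, hi⟩) hn'
  · intro g ν
    rw [sat_exL]
    constructor
    · rintro ⟨ν', h2, h3⟩
      refine ⟨ν' ∘ e', ?_⟩
      have := (h1.sat g ν').1 h3
      convert this using 1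
      funext x
      rcases x with i | j
      · exact (h2 _ (fun hm => by
          obtain ⟨j, hj⟩ := (hl _).1 hm
          exact hd j ⟨i, hj.symm⟩)).symm
      · rfl
    · rintro ⟨w, hw⟩
      refine ⟨Function.extend e' w ν, ?_, ?_⟩
      · intro n hn
        rw [hl] at hn
        exact Function.extend_apply' _ _ _ hn
      · rw [h1.sat]
        convert hw using 1
        funext x
        rcases x with i | j
        · have : ¬ ∃ j, e' j = e i := fun ⟨j, hj⟩ => hd j ⟨i, hj.symm⟩
          exact Function.extend_apply' _ _ _ this
        · exact he'.extend_apply _ _ _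

lemma FDef.rename_inj {I J : Type} {P : ∀ g : LGraph Sig, (I → g.V) → Prop}
    (h : FDef k P) (f : I → J) (hf : Function.Injective f) :
    FDef k (fun g (v : J → g.V) => P g (v ∘ f)) := by
  intro e he
  obtain ⟨φ, h1⟩ := h (e ∘ f) (he.comp hf)
  refine ⟨φ, h1.wf, h1.det, fun n hn => ?_, fun g ν => h1.sat g ν⟩
  obtain ⟨i, hi⟩ := h1.free hn
  exact ⟨f i, hi⟩

lemma FDef.rename {I J : Type} [Finite I] [Finite J] {P : ∀ g : LGraph Sig, (I → g.V) → Prop}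
    (h : FDef k P) (f : I → J) : FDef k (fun g (v : J → g.V) => P g (v ∘ f)) := by
  have h1 : FDef k (fun g (v : J ⊕ I → g.V) =>
      (∀ i, v (Sum.inr i) = v (Sum.inl (f i))) ∧ P g (v ∘ Sum.inr)) :=
    (FDef.forall_fin fun i => FDef.eq _ _).and (h.rename_inj Sum.inr Sum.inr_injective)
  refine h1.ex.congr fun g v => ?_
  constructor
  · rintro ⟨w, h2, h3⟩
    have : w = v ∘ f := funext h2
    subst this; exact h3
  · intro h2
    exact ⟨v ∘ f, fun i => rfl, h2⟩

lemma updVec_apply {α : Type} {m : ℕ} (ν : ℕ → α) (xs : Fin m → ℕ) (hx : Function.Injective xs)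
    (a : Fin m → α) (i : Fin m) : updVec ν xs a (xs i) = a i := by
  have h : ∃ j, xs j = xs i := ⟨i, rfl⟩
  simp only [updVec, h, dite_true]
  rw [hx h.choose_spec]

lemma updVec_of_not {α : Type} {m : ℕ} (ν : ℕ → α) (xs : Fin m → ℕ) (a : Fin m → α) (n : ℕ)
    (h : ∀ i, xs i ≠ n) : updVec ν xs a n = ν n := by
  have h : ¬ ∃ j, xs j = n := by simpa using h
  simp only [updVec, h, dite_false]

/-- Definability of a relation between two `k`-tuples with parameters in `I`. -/
def D3 (k : ℕ) {I : Type}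
    (P : ∀ g : LGraph Sig, (Fin k → g.V) → (Fin k → g.V) → (I → g.V) → Prop) : Prop :=
  FDef k (fun g (w : Fin k ⊕ Fin k ⊕ I → g.V) =>
    P g (w ∘ Sum.inl) (w ∘ Sum.inr ∘ Sum.inl) (w ∘ Sum.inr ∘ Sum.inr))

/-- Conjunction of `x = x` for the listed variables. -/
def padL (l : List ℕ) (φ : GForm Sig k) : GForm Sig k :=
  l.foldr (fun x ψ => GForm.and (GForm.eq x x) ψ) φ

lemma sat_padL (g : LGraph Sig) (l : List ℕ) (φ : GForm Sig k) (ν : ℕ → g.V) :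
    GSat g (padL l φ) ν ↔ GSat g φ ν := by
  induction l with
  | nil => rfl
  | cons x l ih => exact (and_iff_right rfl).trans ih

lemma wf_padL (l : List ℕ) (φ : GForm Sig k) : GWF (padL l φ) ↔ GWF φ := by
  induction l with
  | nil => rfl
  | cons x l ih => exact (and_iff_right trivial).trans ih

lemma det_padL (l : List ℕ) (φ : GForm Sig k) : GDetTC (padL l φ) ↔ GDetTC φ := by
  induction l with
  | nil => rfl
  | cons x l ih => exact (and_iff_right trivial).trans ih

lemma gfree_padL (l : List ℕ) (φ : GForm Sig k) :
    gfree (padL l φ) = gfree φ ∪ {n | n ∈ l} := by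
  induction l with
  | nil => simp [padL]
  | cons x l ih =>
    change ({x, x} : Set ℕ) ∪ gfree (padL l φ) = _
    rw [ih]; ext n; simp only [Set.mem_union, Set.mem_insert_iff, Set.mem_singleton_iff,
      Set.mem_ofPred_eq, List.mem_cons]
    tauto

lemma D3.tc {I : Type} [Finite I]
    {P : ∀ g : LGraph Sig, (Fin k → g.V) → (Fin k → g.V) → (I → g.V) → Prop}
    (h : D3 k P) (hfun : ∀ g v a b b', P g a b v → P g a b' v → b = b') :
    D3 k (fun g a b v => ReflTransGen (fun a b => P g a b v) a b) := by
  classical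
  intro e he
  obtain ⟨f, hf, hfd⟩ := exists_fresh (Fin k ⊕ Fin k) (Set.range e) (Set.finite_range e)
  let xs : Fin k → ℕ := f ∘ Sum.inl
  let ys : Fin k → ℕ := f ∘ Sum.inr
  have hxs : Function.Injective xs := hf.comp Sum.inl_injective
  have hys : Function.Injective ys := hf.comp Sum.inr_injective
  have hxy : ∀ i j, xs i ≠ ys j := fun i j hij => by simpa using hf hij
  let e' : Fin k ⊕ Fin k ⊕ I → ℕ := Sum.elim xs (Sum.elim ys (e ∘ Sum.inr ∘ Sum.inr))
  have he' : Function.Injective e' := by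
    refine hxs.sumElim (hys.sumElim (he.comp (Sum.inr_injective.comp Sum.inr_injective)) ?_) ?_
    · intro i j hij; exact hfd _ ⟨_, hij.symm⟩
    · rintro i (j | j) hij
      · exact hxy i j hij
      · exact hfd _ ⟨_, hij.symm⟩
  obtain ⟨φ, h1⟩ := h e' he'
  let l : List ℕ := (List.ofFn xs) ++ (List.ofFn ys)
  have hl : ∀ n, n ∈ l ↔ n ∈ Set.range xs ∪ Set.range ys := by
    intro n; simp [l]
  have hval : ∀ (g : LGraph Sig) (ν : ℕ → g.V) (a b : Fin k → g.V),
      GSat g (padL l φ) (updVec (updVec ν xs a) ys b) ↔ P g a b (ν ∘ e ∘ Sum.inr ∘ Sum.inr) := by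
    intro g ν a b
    rw [sat_padL, h1.sat]
    have ea : (updVec (updVec ν xs a) ys b ∘ e') ∘ Sum.inl = a := by
      funext i
      change updVec (updVec ν xs a) ys b (xs i) = a i
      rw [updVec_of_not _ _ _ _ (fun j => (hxy i j).symm), updVec_apply _ _ hxs]
    have eb : (updVec (updVec ν xs a) ys b ∘ e') ∘ Sum.inr ∘ Sum.inl = b := by
      funext i
      change updVec (updVec ν xs a) ys b (ys i) = b i
      rw [updVec_apply _ _ hys]
    have ec : (updVec (updVec ν xs a) ys b ∘ e') ∘ Sum.inr ∘ Sum.inr =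
        ν ∘ e ∘ Sum.inr ∘ Sum.inr := by
      funext i
      change updVec (updVec ν xs a) ys b (e (Sum.inr (Sum.inr i))) = _
      rw [updVec_of_not, updVec_of_not]
      · rfl
      · intro j hj; exact hfd _ ⟨_, hj.symm⟩
      · intro j hj; exact hfd _ ⟨_, hj.symm⟩
    rw [ea, eb, ec]
  refine ⟨.tc xs ys (padL l φ) (e ∘ Sum.inl) (e ∘ Sum.inr ∘ Sum.inl),
    ⟨⟨hxs, hys, hxy⟩, ?_, (wf_padL _ _).2 h1.wf⟩, ⟨?_, (det_padL _ _).2 h1.det⟩, ?_, ?_⟩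
  · rw [gfree_padL]; intro n hn; exact Or.inr ((hl n).2 hn)
  · intro g ν a b b' hb hb'
    exact hfun g _ a b b' ((hval g ν a b).1 hb) ((hval g ν a b').1 hb')
  · rintro n ((⟨hn, hn'⟩ | ⟨i, hi⟩) | ⟨i, hi⟩)
    · rw [gfree_padL] at hn
      rcases hn with hn | hn
      · obtain ⟨i | i | i, hi⟩ := h1.free hn
        · exact absurd (Or.inl ⟨i, hi⟩) hn'
        · exact absurd (Or.inr ⟨i, hi⟩) hn'
        · exact ⟨_, hi⟩
      · exact absurd ((hl n).1 hn) hn'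
    · exact ⟨_, hi⟩
    · exact ⟨_, hi⟩
  · intro g ν
    change ReflTransGen _ _ _ ↔ ReflTransGen _ _ _
    have : (fun a b => GSat g (padL l φ) (updVec (updVec ν xs a) ys b)) =
        (fun a b => P g a b (ν ∘ e ∘ Sum.inr ∘ Sum.inr)) := by
      funext a b; exact propext (hval g ν a b)
    rw [this]; rfl

end FormulaSide
end NestedPebblesGraphs

namespace NestedPebblesGraphs
open Relation

section Kleene

/-- Nonempty paths all of whose intermediate states are in `S`. -/
inductive Thru {Q α : Type} (R : Q × α → Q × α → Prop) (S : Set Q) : Q × α → Q × α → Prop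
  | single {x y} : R x y → Thru R S x y
  | cons {x y z} : R x y → y.1 ∈ S → Thru R S y z → Thru R S x z

variable {Q α : Type} {R : Q × α → Q × α → Prop}

lemma Thru.functional (hR : ∀ x y y', R x y → R x y' → y = y') {S : Set Q} {x y y' : Q × α}
    (h : Thru R S x y) (h' : Thru R S x y') (hy : y.1 ∉ S) (hy' : y'.1 ∉ S) : y = y' := by
  induction h with
  | single h1 =>
    cases h' with
    | single h2 => exact hR _ _ _ h1 h2
    | cons h2 h3 h4 => rw [hR _ _ _ h1 h2] at hy; exact absurd h3 hy
  | cons h1 h2 h3 ih =>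
    cases h' with
    | single h4 => rw [hR _ _ _ h4 h1] at hy'; exact absurd h2 hy'
    | cons h4 h5 h6 => rw [hR _ _ _ h4 h1] at h6; exact ih h6 hy

lemma Thru.mono {S S' : Set Q} (hS : S ⊆ S') {x y : Q × α} (h : Thru R S x y) :
    Thru R S' x y := by
  induction h with
  | single h1 => exact .single h1
  | cons h1 h2 h3 ih => exact .cons h1 (hS h2) ih

lemma Thru.trans {S : Set Q} {x y z : Q × α} (h : Thru R S x y) (hy : y.1 ∈ S)
    (h' : Thru R S y z) : Thru R S x z := by
  induction h with
  | single h1 => exact .cons h1 hy h'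
  | cons h1 h2 h3 ih => exact .cons h1 h2 (ih hy h')

lemma thru_insert {S : Set Q} {m : Q} {x z : Q × α} :
    Thru R (insert m S) x z ↔ Thru R S x z ∨ ∃ c d, Thru R S x (m, c) ∧
      ReflTransGen (fun c d => Thru R S (m, c) (m, d)) c d ∧ Thru R S (m, d) z := by
  constructor
  · intro h
    induction h with
    | single h1 => exact Or.inl (.single h1)
    | @cons x y z h1 h2 h3 ih =>
      rcases h2 with h2 | h2
      · obtain ⟨y1, y2⟩ := y
        obtain rfl : y1 = m := h2
        rcases ih with ih | ⟨c, d, h4, h5, h6⟩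
        · exact Or.inr ⟨y2, y2, .single h1, .refl, ih⟩
        · exact Or.inr ⟨y2, d, .single h1, .head h4 h5, h6⟩
      · rcases ih with ih | ⟨c, d, h4, h5, h6⟩
        · exact Or.inl (.cons h1 h2 ih)
        · exact Or.inr ⟨c, d, .cons h1 h2 h4, h5, h6⟩
  · have hsub : S ⊆ insert m S := Set.subset_insert _ _
    rintro (h | ⟨c, d, h1, h2, h3⟩)
    · exact h.mono hsub
    · have h4 : Thru R (insert m S) (m, c) z := by
        clear h1
        induction h2 using ReflTransGen.head_induction_on with
        | refl => exact h3.mono hsub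
        | head h5 _ ih =>
          exact (h5.mono hsub).trans (Set.mem_insert _ _) ih
      exact (h1.mono hsub).trans (Set.mem_insert _ _) h4

lemma thru_univ {x z : Q × α} : ReflTransGen R x z ↔ x = z ∨ Thru R Set.univ x z := by
  constructor
  · intro h
    induction h using ReflTransGen.head_induction_on with
    | refl => exact Or.inl rfl
    | head h1 _ ih =>
      rcases ih with rfl | ih
      · exact Or.inr (.single h1)
      · exact Or.inr (.cons h1 trivial ih)
  · rintro (rfl | h)
    · exact .refl
    · induction h with
      | single h1 => exact .single h1
      | cons h1 _ _ ih => exact .head h1 ih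

variable {Sig : Type} {k : ℕ}

lemma D3.kleene {I K : Type} [Finite I] [Finite K]
    {R : K → K → ∀ g : LGraph Sig, (Fin k → g.V) → (Fin k → g.V) → (I → g.V) → Prop}
    (h : ∀ q q', D3 k (R q q'))
    (hfun : ∀ g v q a q1 q2 b1 b2, R q q1 g a b1 v → R q q2 g a b2 v → (q1, b1) = (q2, b2))
    (q q' : K) :
    D3 k (fun g a b v => ReflTransGen
      (fun x y : K × (Fin k → g.V) => R x.1 y.1 g x.2 y.2 v) (q, a) (q', b)) := by
  classical
  have := Fintype.ofFinite K
  have hdet : ∀ (g : LGraph Sig) (v : I → g.V) (x y y' : K × (Fin k → g.V)),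
      R x.1 y.1 g x.2 y.2 v → R x.1 y'.1 g x.2 y'.2 v → y = y' := by
    rintro g v ⟨x, a⟩ ⟨y, b⟩ ⟨y', b'⟩ h1 h2
    exact hfun g v x a y y' b b' h1 h2
  have key : ∀ s : Finset K, ∀ q q', D3 k (fun g a b v =>
      Thru (fun x y : K × (Fin k → g.V) => R x.1 y.1 g x.2 y.2 v) (s : Set K) (q, a) (q', b)) := by
    intro s
    induction s using Finset.induction_on with
    | empty =>
      intro q q'
      refine (h q q').congr fun g w => ?_
      constructor
      · intro h1; exact .single h1
      · rintro (h1 | ⟨_, h2, _⟩)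
        · exact h1
        · simp at h2
    | insert m s hm ih =>
      intro q q'
      have htc := D3.tc (ih m m) (fun g v a b b' h1 h2 => by
        have := Thru.functional (hdet g v) h1 h2 (by simpa using hm) (by simpa using hm)
        exact congrArg Prod.snd this)
      have e1 := (FDef.rename (ih q m)
        (J := (Fin k ⊕ Fin k ⊕ I) ⊕ (Fin k ⊕ Fin k))
        (Sum.elim (Sum.inl ∘ Sum.inl) (Sum.elim (Sum.inr ∘ Sum.inl)
          (Sum.inl ∘ Sum.inr ∘ Sum.inr)))).and
        ((FDef.rename htc
        (J := (Fin k ⊕ Fin k ⊕ I) ⊕ (Fin k ⊕ Fin k))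
        (Sum.elim (Sum.inr ∘ Sum.inl) (Sum.elim (Sum.inr ∘ Sum.inr)
          (Sum.inl ∘ Sum.inr ∘ Sum.inr)))).and
        (FDef.rename (ih m q')
        (J := (Fin k ⊕ Fin k ⊕ I) ⊕ (Fin k ⊕ Fin k))
        (Sum.elim (Sum.inr ∘ Sum.inr) (Sum.elim (Sum.inl ∘ Sum.inr ∘ Sum.inl)
          (Sum.inl ∘ Sum.inr ∘ Sum.inr)))))
      refine (FDef.or (ih q q') e1.ex).congr fun g w => ?_
      beta_reduce
      rw [Finset.coe_insert, thru_insert]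
      refine or_congr Iff.rfl ?_
      constructor
      · rintro ⟨cd, h1, h2, h3⟩
        exact ⟨cd ∘ Sum.inl, cd ∘ Sum.inr, h1, h2, h3⟩
      · rintro ⟨c, d, h1, h2, h3⟩
        exact ⟨Sum.elim c d, h1, h2, h3⟩
  have e2 : FDef k (fun (g : LGraph Sig) (w : Fin k ⊕ Fin k ⊕ I → g.V) =>
      ∀ i : Fin k, w (Sum.inl i) = w (Sum.inr (Sum.inl i))) :=
    FDef.forall_fin fun i => FDef.eq _ _
  refine (FDef.or ((FDef.const (q = q')).and e2) (key Finset.univ q q')).congr fun g w => ?_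
  beta_reduce
  rw [thru_univ, Finset.coe_univ]
  refine or_congr ?_ Iff.rfl
  rw [Prod.mk.injEq]
  exact and_congr Iff.rfl ⟨fun h => funext h, fun h i => congrFun h i⟩

end Kleene

section AutToForm
variable {Sig : Type} {k : ℕ}

/-- The pebble stack with names `l` and positions `p`. -/
def stk {X V : Type} (l : List X) (p : X → V) : List (X × V) := l.map fun x => (x, p x)

/-- Moves and tests. -/
def Simple {X : Type} : GInstr Sig k X → Prop
  | .inmove _ _ => True
  | .outmove _ _ => True
  | .test _ _ => True
  | _ => False

/-- A step of `A` by a move or a test. -/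
def MBase (A : GWA Sig k) (l : List A.X) (q q' : A.Q) (g : LGraph Sig)
    (a b : Fin k → g.V) (p : A.X → g.V) : Prop :=
  ∃ t : A.instr, t.1.1 = q ∧ t.1.2.2 = q' ∧ Simple t.1.2.1 ∧
    gInstrStep g t.1.2.1 a (stk l p) b (stk l p)

open Classical in
/-- Macro steps of `A` at pebble level `l`, with nesting depth at most `n`. -/
def MStep (A : GWA Sig k) : ℕ → (l : List A.X) → (q q' : A.Q) → (g : LGraph Sig) →
    (a b : Fin k → g.V) → (p : A.X → g.V) → Prop
  | 0, l, q, q', g, a, b, p => MBase A l q q' g a b p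
  | n + 1, l, q, q', g, a, b, p => MBase A l q q' g a b p ∨
      ∃ (i : Fin k) (x : A.X) (q1 q2 : A.Q),
        ((q, GInstr.dropPeb i x, q1) ∈ A.instr ∧ x ∉ l ∧ (q2, GInstr.retrieve x, q') ∈ A.instr) ∧
        ReflTransGen (fun c d : A.Q × (Fin k → g.V) =>
          MStep A n (x :: l) c.1 d.1 g c.2 d.2 (Function.update p x (a i))) (q1, a) (q2, b)

lemma mem_stk {X V : Type} (l : List X) (p : X → V) (x : X) (v : V) :
    (x, v) ∈ stk l p ↔ x ∈ l ∧ p x = v := by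
  simp only [stk, List.mem_map, Prod.mk.injEq]
  constructor
  · rintro ⟨y, h1, rfl, h2⟩; exact ⟨h1, h2⟩
  · rintro ⟨h1, h2⟩; exact ⟨x, h1, rfl, h2⟩

lemma def_instr {X : Type} [Finite X] (l : List X) (ins : GInstr Sig k X) (hs : Simple ins) :
    D3 k (fun g a b p => gInstrStep g ins a (stk l p) b (stk l p)) := by
  have hrest : ∀ i : Fin k, FDef k (fun (g : LGraph Sig) (w : Fin k ⊕ Fin k ⊕ X → g.V) =>
      ∀ h : Fin k, h ≠ i → w (Sum.inr (Sum.inl h)) = w (Sum.inl h)) := fun i =>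
    FDef.forall_fin fun h => ((FDef.const (h = i)).or (FDef.eq (Sum.inr (Sum.inl h)) (Sum.inl h))).congr fun g w => by
      by_cases hh : h = i <;> simp [hh]
  have heq : FDef k (fun (g : LGraph Sig) (w : Fin k ⊕ Fin k ⊕ X → g.V) =>
      (w ∘ Sum.inr ∘ Sum.inl) = (w ∘ Sum.inl)) :=
    (FDef.forall_fin (K := Fin k) fun h => FDef.eq (Sum.inr (Sum.inl h)) (Sum.inl h)).congr
      fun g w => ⟨fun h => funext h, fun h i => congrFun h i⟩
  cases ins with
  | inmove i a =>
    refine ((FDef.edg a (Sum.inr (Sum.inl i)) (Sum.inl i)).and (hrest i)).congr fun g w => ?_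
    simp only [gInstrStep, true_and]; rfl
  | outmove i a =>
    refine ((FDef.edg a (Sum.inl i) (Sum.inr (Sum.inl i))).and (hrest i)).congr fun g w => ?_
    simp only [gInstrStep, true_and]; rfl
  | dropPeb i x => exact hs.elim
  | retrieve x => exact hs.elim
  | jump i x => exact hs.elim
  | test b τ =>
    have ht : FDef k (fun (g : LGraph Sig) (w : Fin k ⊕ Fin k ⊕ X → g.V) =>
        gTestHolds g τ (w ∘ Sum.inl) (stk l (w ∘ Sum.inr ∘ Sum.inr))) := by
      cases τ with
      | lab i a => exact FDef.lab a (Sum.inl i)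
      | inedge i a =>
        refine (FDef.ex (J := Unit) (FDef.edg a (Sum.inr ()) (Sum.inl (Sum.inl i)))).congr ?_
        intro g w
        exact ⟨fun ⟨u, hu⟩ => ⟨u (), hu⟩, fun ⟨u, hu⟩ => ⟨fun _ => u, hu⟩⟩
      | outedge i a =>
        refine (FDef.ex (J := Unit) (FDef.edg a (Sum.inl (Sum.inl i)) (Sum.inr ()))).congr ?_
        intro g w
        exact ⟨fun ⟨u, hu⟩ => ⟨u (), hu⟩, fun ⟨u, hu⟩ => ⟨fun _ => u, hu⟩⟩
      | peb i x =>
        refine ((FDef.const (x ∈ l)).and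
          (FDef.eq (Sum.inr (Sum.inr x)) (Sum.inl i))).congr fun g w => ?_
        simp only [gTestHolds, mem_stk]; rfl
    cases b with
    | true =>
      refine (heq.and ht).congr fun g w => ?_
      simp [gInstrStep]
    | false =>
      refine (heq.and ht.not).congr fun g w => ?_
      simp [gInstrStep]

lemma def_MBase (A : GWA Sig k) (l : List A.X) (q q' : A.Q) : D3 k (MBase A l q q') := by
  have := A.instrFin.to_subtype
  have := A.finX
  refine FDef.exists_fin fun t => ?_
  by_cases hs : Simple t.1.2.1
  · exact ((FDef.const _).and ((FDef.const _).and ((FDef.const _).and (def_instr l _ hs))))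
  · exact (FDef.const False).congr fun g w => by simp [hs]

lemma instr_det {X : Type} (g : LGraph Sig) (ins : GInstr Sig k X) (hs : Simple ins)
    {a b b' : Fin k → g.V} {π π' π'' : List (X × g.V)} (h : gInstrStep g ins a π b π')
    (h' : gInstrStep g ins a π b' π'') : b = b' := by
  cases ins with
  | inmove i c =>
    obtain ⟨_, h2, h3⟩ := h
    obtain ⟨_, h2', h3'⟩ := h'
    funext j
    by_cases hj : j = i
    · subst hj; exact g.in_unique _ _ _ _ h2 h2'
    · rw [h3 j hj, h3' j hj]
  | outmove i c =>
    obtain ⟨_, h2, h3⟩ := h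
    obtain ⟨_, h2', h3'⟩ := h'
    funext j
    by_cases hj : j = i
    · subst hj; exact g.out_unique _ _ _ _ h2 h2'
    · rw [h3 j hj, h3' j hj]
  | dropPeb i x => exact hs.elim
  | retrieve x => exact hs.elim
  | jump i x => exact hs.elim
  | test b τ => exact h.1.trans h'.1.symm

lemma gdet_unique {A : GWA Sig k} (hA : GDeterministic A) {p q q' : A.Q}
    {χ χ' : GInstr Sig k A.X} (h : (p, χ, q) ∈ A.instr) (h' : (p, χ', q') ∈ A.instr)
    (hne : ∀ b τ, χ ≠ GInstr.test b τ) : χ = χ' ∧ q = q' := by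
  by_contra hc
  have : (χ, q) ≠ (χ', q') := by
    intro h1; rw [Prod.mk.injEq] at h1; exact hc h1
  rcases hA p χ q χ' q' h h' this with ⟨b, τ, h1, h2⟩ | ⟨b, τ, h1, h2⟩
  · exact hne _ _ h1
  · exact hne _ _ h2

lemma MBase_det {A : GWA Sig k} (hA : GDeterministic A) {l : List A.X} {q q1 q2 : A.Q}
    {g : LGraph Sig} {a b1 b2 : Fin k → g.V} {p : A.X → g.V}
    (h1 : MBase A l q q1 g a b1 p) (h2 : MBase A l q q2 g a b2 p) : (q1, b1) = (q2, b2) := by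
  obtain ⟨⟨⟨r0, χ, q1'⟩, hm⟩, rfl, rfl, hs, hst⟩ := h1
  obtain ⟨⟨⟨r, χ', q2⟩, hm'⟩, hr, rfl, hs', hst'⟩ := h2
  simp only at hr hs hs' hst hst' hm hm'
  subst hr
  dsimp only
  by_cases hc : (χ, q1') = (χ', q2)
  · rw [Prod.mk.injEq] at hc
    obtain ⟨rfl, rfl⟩ := hc
    rw [instr_det g χ hs hst hst']
  · exfalso
    have key : ∀ χ χ' : GInstr Sig k A.X, gNegOf χ χ' → gInstrStep g χ a (stk l p) b1 (stk l p) →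
        ∀ b2, gInstrStep g χ' a (stk l p) b2 (stk l p) → False := by
      rintro χ χ' ⟨b, τ, rfl, rfl⟩ h1 b2 h2
      have h3 := h1.2.2
      have h4 := h2.2.2
      rw [h3] at h4
      cases b <;> simp at h4
    rcases hA _ _ _ _ _ hm hm' hc with hn | hn
    · exact key _ _ hn hst _ hst'
    · obtain ⟨b, τ, rfl, rfl⟩ := hn
      have h3 := hst.2.2
      have h4 := hst'.2.2
      rw [h3] at h4
      cases b <;> simp at h4

lemma halt_unique {α : Type} {R : α → α → Prop} (hR : ∀ x y y', R x y → R x y' → y = y')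
    {x y y' : α} (h : ReflTransGen R x y) (h' : ReflTransGen R x y')
    (hy : ∀ z, ¬ R y z) (hy' : ∀ z, ¬ R y' z) : y = y' := by
  induction h using ReflTransGen.head_induction_on with
  | refl =>
    rcases h'.cases_head with h1 | ⟨c, h1, _⟩
    · exact h1
    · exact absurd h1 (hy _)
  | head h1 h2 ih =>
    rcases h'.cases_head with rfl | ⟨c, h3, h4⟩
    · exact absurd h1 (hy' _)
    · exact ih (hR _ _ _ h3 h1 ▸ h4)

lemma MBase_instr {A : GWA Sig k} {l : List A.X} {q q' : A.Q} {g : LGraph Sig}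
    {a b : Fin k → g.V} {p : A.X → g.V} (h : MBase A l q q' g a b p) :
    ∃ χ, (q, χ, q') ∈ A.instr ∧ Simple χ := by
  obtain ⟨⟨⟨_, χ, _⟩, hm⟩, rfl, rfl, hs, hst⟩ := h
  exact ⟨χ, hm, hs⟩

lemma MStep_instr {A : GWA Sig k} {n : ℕ} {l : List A.X} {q q' : A.Q} {g : LGraph Sig}
    {a b : Fin k → g.V} {p : A.X → g.V} (h : MStep A n l q q' g a b p) :
    ∃ χ q'', (q, χ, q'') ∈ A.instr ∧ ∀ x, χ ≠ GInstr.retrieve x := by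
  have hb : MBase A l q q' g a b p → ∃ χ q'', (q, χ, q'') ∈ A.instr ∧
      ∀ x, χ ≠ GInstr.retrieve x := by
    intro h
    obtain ⟨χ, h1, h2⟩ := MBase_instr h
    exact ⟨χ, _, h1, fun x hx => by subst hx; exact h2⟩
  cases n with
  | zero => exact hb h
  | succ n =>
    rcases h with h | ⟨i, x, q1, q2, ⟨h1, _⟩, _⟩
    · exact hb h
    · exact ⟨_, _, h1, by simp⟩

lemma MStep_no_retrieve {A : GWA Sig k} (hA : GDeterministic A) {n : ℕ} {l : List A.X}
    {q q' q'' : A.Q} {g : LGraph Sig} {a b : Fin k → g.V} {p : A.X → g.V} {x : A.X}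
    (h : (q, GInstr.retrieve x, q') ∈ A.instr) : ¬ MStep A n l q q'' g a b p := by
  intro hM
  obtain ⟨χ, r, h1, h2⟩ := MStep_instr hM
  exact h2 x (gdet_unique hA h h1 (by simp)).1.symm

lemma MStep_det {A : GWA Sig k} (hA : GDeterministic A) {n : ℕ} {l : List A.X} {q q1 q2 : A.Q}
    {g : LGraph Sig} {a b1 b2 : Fin k → g.V} {p : A.X → g.V}
    (h1 : MStep A n l q q1 g a b1 p) (h2 : MStep A n l q q2 g a b2 p) :
    (q1, b1) = (q2, b2) := by
  induction n generalizing l q q1 q2 a b1 b2 p with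
  | zero => exact MBase_det hA h1 h2
  | succ n ih =>
    rcases h1 with h1 | ⟨i, x, r1, r2, ⟨h3, h4, h5⟩, h6⟩
    · rcases h2 with h2 | ⟨i, x, r1, r2, ⟨h3, h4, h5⟩, h6⟩
      · exact MBase_det hA h1 h2
      · obtain ⟨χ, h7, h8⟩ := MBase_instr h1
        obtain ⟨rfl, _⟩ := gdet_unique hA h3 h7 (by simp)
        exact h8.elim
    · rcases h2 with h2 | ⟨i', x', r1', r2', ⟨h3', h4', h5'⟩, h6'⟩
      · obtain ⟨χ, h7, h8⟩ := MBase_instr h2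
        obtain ⟨rfl, _⟩ := gdet_unique hA h3 h7 (by simp)
        exact h8.elim
      · obtain ⟨h7, rfl⟩ := gdet_unique hA h3 h3' (by simp)
        simp only [GInstr.dropPeb.injEq] at h7
        obtain ⟨rfl, rfl⟩ := h7
        have h8 := halt_unique (fun x y y' hx hy => by
          obtain ⟨y1, y2⟩ := y
          obtain ⟨y1', y2'⟩ := y'
          exact ih hx hy) h6 h6' (fun z => MStep_no_retrieve hA h5)
          (fun z => MStep_no_retrieve hA h5')
        rw [Prod.mk.injEq] at h8
        obtain ⟨rfl, rfl⟩ := h8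
        rw [(gdet_unique hA h5 h5' (by simp)).2]

lemma def_MStep {A : GWA Sig k} (hA : GDeterministic A) (n : ℕ) (l : List A.X) (q q' : A.Q) :
    D3 k (MStep A n l q q') := by
  have := A.finX
  have := A.finQ
  induction n generalizing l q q' with
  | zero => exact def_MBase A l q q'
  | succ n ih =>
    refine (def_MBase A l q q').or ?_
    refine FDef.exists_fin fun i => FDef.exists_fin fun x => FDef.exists_fin fun q1 =>
      FDef.exists_fin fun q2 => (FDef.const _).and ?_
    have h1 := D3.kleene (ih (x :: l)) (fun g v q a q1 q2 b1 b2 h1 h2 => MStep_det hA h1 h2) q1 q2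
    classical
    refine (FDef.rename h1 (J := Fin k ⊕ Fin k ⊕ A.X) (Sum.elim Sum.inl (Sum.elim
      (Sum.inr ∘ Sum.inl) (Function.update (Sum.inr ∘ Sum.inr) x (Sum.inl i))))).congr ?_
    intro g w
    have : (w ∘ (Sum.elim Sum.inl (Sum.elim
      (Sum.inr ∘ Sum.inl) (Function.update (Sum.inr ∘ Sum.inr) x (Sum.inl i))))) ∘ Sum.inr ∘ Sum.inr
      = Function.update (w ∘ Sum.inr ∘ Sum.inr) x (w (Sum.inl i)) := by
      funext y
      by_cases hy : y = x
      · subst hy; simp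
      · simp [hy]
    rw [this]
    convert Iff.rfl using 3 <;> rfl

lemma MBase_step {A : GWA Sig k} {l : List A.X} {q q' : A.Q} {g : LGraph Sig}
    {a b : Fin k → g.V} {p : A.X → g.V} (h : MBase A l q q' g a b p) :
    GStep A g (q, a, stk l p) (q', b, stk l p) := by
  obtain ⟨⟨⟨_, χ, _⟩, hm⟩, rfl, rfl, hs, hst⟩ := h
  exact ⟨χ, hm, hst⟩

open Classical in
lemma stk_update {X V : Type} (l : List X) (p : X → V) (x : X) (v : V) (h : x ∉ l) :
    stk l (Function.update p x v) = stk l p := by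
  refine List.map_congr_left fun y hy => ?_
  rw [Function.update_of_ne]
  rintro rfl; exact h hy

lemma rtg_lift {α β : Type} {r : α → α → Prop} {p : β → β → Prop} (f : α → β)
    (h : ∀ a b, r a b → ReflTransGen p (f a) (f b)) {a b : α} (hab : ReflTransGen r a b) :
    ReflTransGen p (f a) (f b) := by
  induction hab with
  | refl => exact .refl
  | tail _ h2 ih => exact ih.trans (h _ _ h2)

lemma MStep_sound {A : GWA Sig k} {n : ℕ} {l : List A.X} {q q' : A.Q} {g : LGraph Sig}
    {a b : Fin k → g.V} {p : A.X → g.V} (h : MStep A n l q q' g a b p) :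
    ReflTransGen (GStep A g) (q, a, stk l p) (q', b, stk l p) := by
  classical
  induction n generalizing l q q' a b p with
  | zero => exact .single (MBase_step h)
  | succ n ih =>
    rcases h with h | ⟨i, x, r1, r2, ⟨h3, h4, h5⟩, h6⟩
    · exact .single (MBase_step h)
    · have hs : stk (x :: l) (Function.update p x (a i)) = (x, a i) :: stk l p := by
        change (x, Function.update p x (a i) x) :: stk l _ = _
        rw [stk_update _ _ _ _ h4, Function.update_self]
      have h7 : ReflTransGen (GStep A g) (r1, a, (x, a i) :: stk l p)
          (r2, b, (x, a i) :: stk l p) := by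
        rw [← hs]
        convert rtg_lift (p := GStep A g) (fun c : A.Q × (Fin k → g.V) =>
          (c.1, c.2, stk (x :: l) (Function.update p x (a i)))) (fun c d hcd => ih hcd) h6
      have s1 : GStep A g (q, a, stk l p) (r1, a, (x, a i) :: stk l p) :=
        ⟨_, h3, rfl, rfl, fun w hw => h4 ((mem_stk _ _ _ _).1 hw).1⟩
      have s2 : GStep A g (r2, b, (x, a i) :: stk l p) (q', b, stk l p) := ⟨_, h5, rfl, _, rfl⟩
      exact .head s1 (h7.trans (.single s2))

/-- Runs of a given length. -/
inductive NRun {α : Type} (R : α → α → Prop) : ℕ → α → α → Prop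
  | zero {x} : NRun R 0 x x
  | succ {n x y z} : R x y → NRun R n y z → NRun R (n + 1) x z

lemma nrun_of_rtg {α : Type} {R : α → α → Prop} {x y : α} (h : ReflTransGen R x y) :
    ∃ n, NRun R n x y := by
  induction h using ReflTransGen.head_induction_on with
  | refl => exact ⟨0, .zero⟩
  | head h1 _ ih => obtain ⟨n, hn⟩ := ih; exact ⟨n + 1, .succ h1 hn⟩

lemma MStep_base {A : GWA Sig k} {n : ℕ} {l : List A.X} {q q' : A.Q} {g : LGraph Sig}
    {a b : Fin k → g.V} {p : A.X → g.V} (h : MBase A l q q' g a b p) :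
    MStep A n l q q' g a b p := by
  cases n with
  | zero => exact h
  | succ n => exact Or.inl h

lemma MStep_complete {A : GWA Sig k} (hJ : NoJump A) {g : LGraph Sig} {qf : A.Q}
    {hf : Fin k → g.V} (N : ℕ) : ∀ {n : ℕ} {l : List A.X} {q : A.Q} {a : Fin k → g.V}
    {p : A.X → g.V}, l.Nodup → (∀ l' : List A.X, l'.Nodup → l'.length ≤ n + l.length) →
    NRun (GStep A g) N (q, a, stk l p) (qf, hf, []) →
    (l = [] ∧ ReflTransGen (fun c d : A.Q × (Fin k → g.V) =>
      MStep A n l c.1 d.1 g c.2 d.2 p) (q, a) (qf, hf)) ∨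
    ∃ x l' q2 b q' N', l = x :: l' ∧ N' < N ∧ ReflTransGen (fun c d : A.Q × (Fin k → g.V) =>
      MStep A n l c.1 d.1 g c.2 d.2 p) (q, a) (q2, b) ∧ (q2, GInstr.retrieve x, q') ∈ A.instr ∧
      NRun (GStep A g) N' (q', b, stk l' p) (qf, hf, []) := by
  classical
  induction N using Nat.strong_induction_on with
  | _ N IH =>
  intro n l q a p hl hn hrun
  generalize hx : (q, a, stk l p) = x at hrun
  generalize hz : (qf, hf, ([] : List (A.X × g.V))) = z at hrun
  cases hrun with
  | zero =>
    rw [← hz] at hx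
    simp only [Prod.mk.injEq] at hx
    obtain ⟨rfl, rfl, h3⟩ := hx
    left
    refine ⟨?_, .refl⟩
    simpa [stk] using h3
  | @succ N _ y _ hst hrun =>
    subst hx; subst hz
    have simple : ∀ q1 a1, MBase A l q q1 g a a1 p → y = (q1, a1, stk l p) →
      ((l = [] ∧ ReflTransGen (fun c d : A.Q × (Fin k → g.V) =>
      MStep A n l c.1 d.1 g c.2 d.2 p) (q, a) (qf, hf)) ∨
      ∃ x l' q2 b q' N', l = x :: l' ∧ N' < N + 1 ∧ ReflTransGen (fun c d : A.Q × (Fin k → g.V) =>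
      MStep A n l c.1 d.1 g c.2 d.2 p) (q, a) (q2, b) ∧ (q2, GInstr.retrieve x, q') ∈ A.instr ∧
      NRun (GStep A g) N' (q', b, stk l' p) (qf, hf, [])) := by
      rintro q1 a1 hM rfl
      rcases IH N (by omega) hl hn hrun with ⟨h1, h2⟩ | ⟨x, l', q2, b, q', N', h1, h2, h3, h4, h5⟩
      · exact Or.inl ⟨h1, .head (MStep_base hM) h2⟩
      · exact Or.inr ⟨x, l', q2, b, q', N', h1, by omega, .head (MStep_base hM) h3, h4, h5⟩
    obtain ⟨ins, hmem, hins⟩ := hst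
    obtain ⟨q1, a1, π1⟩ := y
    simp only at hmem hins
    cases ins with
    | inmove i c =>
      obtain rfl := hins.1
      exact simple q1 a1 ⟨⟨_, hmem⟩, rfl, rfl, trivial, hins⟩ rfl
    | outmove i c =>
      obtain rfl := hins.1
      exact simple q1 a1 ⟨⟨_, hmem⟩, rfl, rfl, trivial, hins⟩ rfl
    | test b τ =>
      obtain rfl := hins.2.1
      exact simple q1 a1 ⟨⟨_, hmem⟩, rfl, rfl, trivial, hins⟩ rfl
    | jump i x => exact absurd rfl (hJ _ _ _ hmem i x)
    | retrieve x =>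
      right
      obtain ⟨rfl, w, hw⟩ := hins
      cases l with
      | nil => simp [stk] at hw
      | cons x' l' =>
        simp only [stk, List.map_cons, List.cons.injEq, Prod.mk.injEq] at hw
        obtain ⟨⟨rfl, _⟩, rfl⟩ := hw
        exact ⟨x', l', q, a1, q1, N, rfl, by omega, .refl, hmem, hrun⟩
    | dropPeb i x =>
      obtain ⟨rfl, rfl, hfresh⟩ := hins
      have hxl : x ∉ l := fun hx => hfresh (p x) ((mem_stk _ _ _ _).2 ⟨hx, rfl⟩)
      have hnd : (x :: l).Nodup := List.nodup_cons.2 ⟨hxl, hl⟩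
      have hs : (x, a1 i) :: stk l p = stk (x :: l) (Function.update p x (a1 i)) := by
        change _ = (x, Function.update p x (a1 i) x) :: stk l _
        rw [stk_update _ _ _ _ hxl, Function.update_self]
      rw [hs] at hrun
      have hlen := hn _ hnd
      simp only [List.length_cons] at hlen
      obtain ⟨m, rfl⟩ : ∃ m, n = m + 1 := ⟨n - 1, by omega⟩
      rcases IH N (by omega) (n := m) hnd (fun l' hl' => by
          have := hn l' hl'; simp only [List.length_cons]; omega) hrun with
        ⟨h1, _⟩ | ⟨x', l', q2, b, q', N', h1, h2, h3, h4, h5⟩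
      · simp at h1
      · rw [List.cons.injEq] at h1
        obtain ⟨rfl, rfl⟩ := h1
        rw [stk_update _ _ _ _ hxl] at h5
        have hM : MStep A (m + 1) l q q' g a1 b p :=
          Or.inr ⟨i, x, q1, q2, ⟨hmem, hxl, h4⟩, by convert h3⟩
        rcases IH N' (by omega) hl hn h5 with ⟨h6, h7⟩ | ⟨x', l', r2, b', r', N'', h6, h7, h8, h9, h10⟩
        · exact Or.inl ⟨h6, .head hM h7⟩
        · exact Or.inr ⟨x', l', r2, b', r', N'', h6, by omega, .head hM h8, h9, h10⟩

lemma acc_def {A : GWA Sig k} (hA : GDeterministic A) (hJ : NoJump A) :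
    FDef k (fun (g : LGraph Sig) (w : Unit → g.V) => AccFrom A g (w ())) := by
  classical
  have := A.finX
  have := A.finQ
  have := A.instrFin.to_subtype
  -- halting is definable
  have hhalt : ∀ q, FDef k (fun (g : LGraph Sig) (w : Fin k ⊕ Fin k ⊕ A.X → g.V) =>
      GHaltingConf A g (q, w ∘ Sum.inr ∘ Sum.inl, [])) := by
    intro q
    have h1 : FDef k (fun (g : LGraph Sig) (w : Fin k ⊕ Fin k ⊕ A.X → g.V) =>
        ∃ t : A.instr, t.1.1 = q ∧ ((∃ i x, t.1.2.1 = GInstr.dropPeb i x) ∨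
          (Simple t.1.2.1 ∧ ∃ b, gInstrStep g t.1.2.1 (w ∘ Sum.inr ∘ Sum.inl) [] b []))) := by
      refine FDef.exists_fin fun t => (FDef.const _).and ((FDef.const _).or ?_)
      by_cases hs : Simple t.1.2.1
      · have h2 := FDef.rename (def_instr (X := A.X) [] _ hs)
          (J := (Fin k ⊕ Fin k ⊕ A.X) ⊕ Fin k)
          (Sum.elim (Sum.inl ∘ Sum.inr ∘ Sum.inl) (Sum.elim Sum.inr (Sum.inl ∘ Sum.inr ∘ Sum.inr)))
        exact (FDef.const _).and h2.ex
      · exact (FDef.const False).congr fun g w => by simp [hs]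
    refine h1.not.congr fun g w => ?_
    constructor
    · rintro h ⟨q', b, π'⟩ ⟨ins, hm, hst⟩
      refine h ⟨⟨_, hm⟩, rfl, ?_⟩
      simp only at hst
      cases ins with
      | inmove i c => obtain rfl := hst.1; exact Or.inr ⟨trivial, b, hst⟩
      | outmove i c => obtain rfl := hst.1; exact Or.inr ⟨trivial, b, hst⟩
      | test i c => obtain rfl := hst.2.1; exact Or.inr ⟨trivial, b, hst⟩
      | dropPeb i x => exact Or.inl ⟨i, x, rfl⟩
      | retrieve x => obtain ⟨_, w, hw⟩ := hst; simp at hw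
      | jump i x => exact absurd rfl (hJ _ _ _ hm i x)
    · rintro h ⟨⟨⟨q1, ins, q'⟩, hm⟩, hq, ht⟩
      simp only at hq ht
      subst hq
      rcases ht with ⟨i, x, rfl⟩ | ⟨hs, b, hb⟩
      · exact h (q', _, [(x, w (Sum.inr (Sum.inl i)))]) ⟨_, hm, rfl, rfl, by simp⟩
      · exact h (q', b, []) ⟨_, hm, hb⟩
  set n := Nat.card A.X with hn
  have hlen : ∀ l' : List A.X, l'.Nodup → l'.length ≤ n + ([] : List A.X).length := by
    intro l' hl'
    have := Fintype.ofFinite A.X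
    rw [hn, Nat.card_eq_fintype_card]
    simpa using hl'.length_le_card
  have h2 : ∀ q, FDef k (fun (g : LGraph Sig) (w : Fin k ⊕ Fin k ⊕ A.X → g.V) =>
      q ∈ A.acc ∧ ReflTransGen (fun c d : A.Q × (Fin k → g.V) =>
        MStep A n [] c.1 d.1 g c.2 d.2 (w ∘ Sum.inr ∘ Sum.inr))
          (A.q0, w ∘ Sum.inl) (q, w ∘ Sum.inr ∘ Sum.inl) ∧
        GHaltingConf A g (q, w ∘ Sum.inr ∘ Sum.inl, [])) := fun q =>
    (FDef.const _).and ((D3.kleene (def_MStep hA n [])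
      (fun g v q a q1 q2 b1 b2 h1 h2 => MStep_det hA h1 h2) A.q0 q).and (hhalt q))
  have h3 := FDef.exists_fin fun q => (FDef.rename (h2 q) (J := Unit ⊕ Fin k)
    (Sum.elim (fun _ => Sum.inl ()) (Sum.elim Sum.inr (fun _ => Sum.inl ())))).ex
  refine h3.congr fun g w => ?_
  constructor
  · rintro ⟨q, hs, h4, h5, h6⟩
    refine ⟨q, hs, h4, ?_, h6⟩
    exact rtg_lift (p := GStep A g) (fun c : A.Q × (Fin k → g.V) => (c.1, c.2, []))
      (fun c d hcd => MStep_sound hcd) h5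
  · rintro ⟨q, hs, h4, h5, h6⟩
    refine ⟨q, hs, h4, ?_, h6⟩
    obtain ⟨N, hN⟩ := nrun_of_rtg h5
    rcases MStep_complete hJ N (n := n) (l := []) (p := fun _ => w ()) List.nodup_nil hlen hN with
      ⟨_, h7⟩ | ⟨x, l', _, _, _, _, h7, _⟩
    · exact h7
    · simp at h7

lemma DPTWA_sub (F : Set (LGraph Sig)) : DPTWAg Sig F k ⊆ FODTCg Sig F k := by
  rintro L ⟨A, hA, hJ, -, rfl⟩
  obtain ⟨φ, h1⟩ := acc_def hA hJ (fun _ => 0) (fun _ _ _ => rfl)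
  refine ⟨.all 0 φ, h1.wf, h1.det, ?_, ?_⟩
  · ext n
    simp only [gfree, Set.mem_sdiff, Set.mem_singleton_iff, Set.mem_empty_iff_false, iff_false,
      not_and, not_not]
    intro hn
    obtain ⟨i, hi⟩ := h1.free hn
    exact hi.symm
  · ext g
    refine and_congr Iff.rfl ?_
    have h2 : ∀ (ν : ℕ → g.V) u, GSat g φ (Function.update ν 0 u) ↔ AccFrom A g u := by
      intro ν u
      rw [h1.sat]
      simp
    constructor
    · intro h ν u
      exact (h2 ν u).2 (h u)
    · intro h u
      exact (h2 (fun _ => u) u).1 (h (fun _ => u) u)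

end AutToForm
end NestedPebblesGraphs

namespace NestedPebblesGraphs
open Relation

section Machine
variable {Sig : Type} {k : ℕ} {X : Type}

/-- Head positions and pebble stack. -/
abbrev Store (k : ℕ) (X : Type) (g : LGraph Sig) : Type := (Fin k → g.V) × List (X × g.V)

/-- Elementary operations of programs. -/
inductive Op (Sig : Type) (k : ℕ) (X : Type) : Type
  | inm (i : Fin k) (a : Sig)
  | outm (i : Fin k) (a : Sig)
  | drop (i : Fin k) (x : X)
  | retr (x : X)

def Op.instr {Y : Type} (f : X → Y) : Op Sig k X → GInstr Sig k Y
  | .inm i a => .inmove i a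
  | .outm i a => .outmove i a
  | .drop i x => .dropPeb i (f x)
  | .retr x => .retrieve (f x)

def GTest.ren {Y : Type} (f : X → Y) : GTest Sig k X → GTest Sig k Y
  | .lab i a => .lab i a
  | .inedge i a => .inedge i a
  | .outedge i a => .outedge i a
  | .peb i x => .peb i (f x)

inductive Act (Sig : Type) (k : ℕ) (X Q α : Type) : Type
  | ret (a : α)
  | goto (q : Q)
  | op (o : Op Sig k X) (q : Q)
  | br (τ : GTest Sig k X) (q1 q2 : Q)

def Act.mp {Q Q' α β : Type} (f : Q → Q') (h : α → Act Sig k X Q' β) :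
    Act Sig k X Q α → Act Sig k X Q' β
  | .ret a => h a
  | .goto q => .goto (f q)
  | .op o q => .op o (f q)
  | .br τ q1 q2 => .br τ (f q1) (f q2)

/-- Programs: deterministic flow charts returning a value of type `α`. -/
structure Prog (Sig : Type) (k : ℕ) (X : Type) (α : Type) : Type 1 where
  Q : Type
  fin : Finite Q
  q0 : Q
  δ : Q → Act Sig k X Q α

/-- The effect of an operation. -/
def OpStep (g : LGraph Sig) (o : Op Sig k X) (s s' : Store k X g) : Prop :=
  gInstrStep g (o.instr id) s.1 s.2 s'.1 s'.2

inductive Halts {α : Type} (P : Prog Sig k X α) (g : LGraph Sig) :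
    P.Q → Store k X g → α → Store k X g → Prop
  | ret {q a s} : P.δ q = .ret a → Halts P g q s a s
  | goto {q q' a s s'} : P.δ q = .goto q' → Halts P g q' s a s' → Halts P g q s a s'
  | op {q q' o a s s1 s'} : P.δ q = .op o q' → OpStep g o s s1 → Halts P g q' s1 a s' →
      Halts P g q s a s'
  | brt {q q1 q2 τ a s s'} : P.δ q = .br τ q1 q2 → gTestHolds g τ s.1 s.2 →
      Halts P g q1 s a s' → Halts P g q s a s'
  | brf {q q1 q2 τ a s s'} : P.δ q = .br τ q1 q2 → ¬ gTestHolds g τ s.1 s.2 →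
      Halts P g q2 s a s' → Halts P g q s a s'

/-- `P` started in store `s` halts with result `a` and store `s'`. -/
def Run {α : Type} (P : Prog Sig k X α) {g : LGraph Sig} (s : Store k X g) (a : α)
    (s' : Store k X g) : Prop := Halts P g P.q0 s a s'

lemma opStep_det {g : LGraph Sig} {o : Op Sig k X} {s s1 s2 : Store k X g}
    (h1 : OpStep g o s s1) (h2 : OpStep g o s s2) : s1 = s2 := by
  obtain ⟨a1, π1⟩ := s1
  obtain ⟨a2, π2⟩ := s2
  cases o with
  | inm i c =>
    have := instr_det g (.inmove i c) trivial h1 h2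
    have e1 := h1.1
    have e2 := h2.1
    simp_all
  | outm i c =>
    have := instr_det g (.outmove i c) trivial h1 h2
    have e1 := h1.1
    have e2 := h2.1
    simp_all
  | drop i x =>
    obtain ⟨e1, e2, _⟩ := h1
    obtain ⟨e3, e4, _⟩ := h2
    simp_all
  | retr x =>
    obtain ⟨e1, w, e2⟩ := h1
    obtain ⟨e3, w', e4⟩ := h2
    simp_all

lemma halts_det {α : Type} {P : Prog Sig k X α} {g : LGraph Sig} {q : P.Q} {s s1 s2 : Store k X g}
    {a b : α} (h1 : Halts P g q s a s1) (h2 : Halts P g q s b s2) : a = b ∧ s1 = s2 := by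
  induction h1 with
  | ret h =>
    cases h2 <;> simp_all
  | goto h _ ih =>
    cases h2 <;> simp_all
  | op h ho _ ih =>
    cases h2 with
    | op h' ho' h2' =>
      rw [h] at h'
      simp only [Act.op.injEq] at h'
      obtain ⟨rfl, rfl⟩ := h'
      obtain rfl := opStep_det ho ho'
      exact ih h2'
    | _ => simp_all
  | brt h ht _ ih =>
    cases h2 <;> simp_all
  | brf h ht _ ih =>
    cases h2 <;> simp_all

lemma Run.det {α : Type} {P : Prog Sig k X α} {g : LGraph Sig} {s s1 s2 : Store k X g}
    {a b : α} (h1 : Run P s a s1) (h2 : Run P s b s2) : a = b ∧ s1 = s2 := halts_det h1 h2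

lemma Run.iff {α : Type} {P : Prog Sig k X α} {g : LGraph Sig} {s s1 s2 : Store k X g}
    {a b : α} (h1 : Run P s a s1) : Run P s b s2 ↔ b = a ∧ s2 = s1 := by
  constructor
  · intro h2
    obtain ⟨rfl, rfl⟩ := h1.det h2
    exact ⟨rfl, rfl⟩
  · rintro ⟨rfl, rfl⟩; exact h1

namespace Prog
variable {α β : Type}

def pure (a : α) : Prog Sig k X α := ⟨Unit, inferInstance, (), fun _ => .ret a⟩

def abort : Prog Sig k X α := ⟨Unit, inferInstance, (), fun _ => .goto ()⟩

def op (o : Op Sig k X) : Prog Sig k X Unit :=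
  ⟨Bool, inferInstance, true, fun q => if q then .op o false else .ret ()⟩

def test (τ : GTest Sig k X) : Prog Sig k X Bool :=
  ⟨Option Bool, inferInstance, none, fun q => match q with
    | none => .br τ (some true) (some false)
    | some b => .ret b⟩

def bind [Finite α] (P : Prog Sig k X α) (f : α → Prog Sig k X β) : Prog Sig k X β where
  Q := P.Q ⊕ Σ a, (f a).Q
  fin := by
    have := P.fin
    have := fun a => (f a).fin
    infer_instance
  q0 := .inl P.q0
  δ := fun q => match q with
    | .inl q => (P.δ q).mp Sum.inl (fun a => .goto (.inr ⟨a, (f a).q0⟩))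
    | .inr ⟨a, q⟩ => ((f a).δ q).mp (fun q => Sum.inr ⟨a, q⟩) .ret

def iter {S : Type} [Finite S] (body : S → Prog Sig k X (S ⊕ α)) (s : S) : Prog Sig k X α where
  Q := Σ s, (body s).Q
  fin := by
    have := fun a => (body a).fin
    infer_instance
  q0 := ⟨s, (body s).q0⟩
  δ := fun q => ((body q.1).δ q.2).mp (fun q' => ⟨q.1, q'⟩) (fun r => match r with
    | .inl s' => .goto ⟨s', (body s').q0⟩
    | .inr a => .ret a)

end Prog

variable {α β : Type} {g : LGraph Sig}

lemma run_pure {a b : α} {s s' : Store k X g} : Run (Prog.pure a) s b s' ↔ b = a ∧ s' = s := by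
  have : Run (Prog.pure a) s a s := .ret rfl
  exact this.iff

lemma run_abort {b : α} {s s' : Store k X g} : ¬ Run (Prog.abort) s b s' := by
  intro h
  unfold Run at h
  generalize Prog.q0 _ = q at h
  induction h with
  | ret h => cases h
  | goto h _ ih => exact ih
  | op h => cases h
  | brt h => cases h
  | brf h => cases h

lemma run_op {o : Op Sig k X} {b : Unit} {s s' : Store k X g} :
    Run (Prog.op o) s b s' ↔ OpStep g o s s' := by
  constructor
  · intro h
    cases h with
    | ret h => cases h
    | goto h => cases h
    | brt h => cases h
    | brf h => cases h
    | op h ho h' =>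
      cases h
      rename_i s1
      have h2 : Halts (Prog.op o) g false s1 () s1 := .ret rfl
      rw [(halts_det h' h2).2]
      exact ho
  · intro h
    exact .op rfl h (.ret rfl)

lemma run_test {τ : GTest Sig k X} {b : Bool} {s s' : Store k X g} :
    Run (Prog.test τ) s b s' ↔ (b = true ↔ gTestHolds g τ s.1 s.2) ∧ s' = s := by
  by_cases h : gTestHolds g τ s.1 s.2
  · have : Run (Prog.test τ) s true s := .brt rfl h (.ret rfl)
    rw [this.iff]; simp [h]
  · have : Run (Prog.test τ) s false s := .brf rfl h (.ret rfl)
    rw [this.iff]; simp [h]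

lemma halts_bind_inr [Finite α] {P : Prog Sig k X α} {f : α → Prog Sig k X β} {a : α}
    {q : (f a).Q} {s s' : Store k X g} {b : β} (h : Halts (f a) g q s b s') :
    Halts (P.bind f) g (Sum.inr ⟨a, q⟩) s b s' := by
  induction h with
  | ret h => exact .ret (by simp only [Prog.bind, h]; rfl)
  | goto h _ ih => exact .goto (by simp only [Prog.bind, h]; rfl) ih
  | op h ho _ ih => exact .op (by simp only [Prog.bind, h]; rfl) ho ih
  | brt h ho _ ih => exact .brt (by simp only [Prog.bind, h]; rfl) ho ih
  | brf h ho _ ih => exact .brf (by simp only [Prog.bind, h]; rfl) ho ih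

lemma halts_bind_inl [Finite α] {P : Prog Sig k X α} {f : α → Prog Sig k X β} {a : α}
    {q : P.Q} {s s1 s' : Store k X g} {b : β} (h : Halts P g q s a s1)
    (h2 : Run (f a) s1 b s') : Halts (P.bind f) g (Sum.inl q) s b s' := by
  induction h with
  | ret h => exact .goto (by simp only [Prog.bind, h]; rfl) (halts_bind_inr h2)
  | goto h _ ih => exact .goto (by simp only [Prog.bind, h]; rfl) (ih h2)
  | op h ho _ ih => exact .op (by simp only [Prog.bind, h]; rfl) ho (ih h2)
  | brt h ho _ ih => exact .brt (by simp only [Prog.bind, h]; rfl) ho (ih h2)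
  | brf h ho _ ih => exact .brf (by simp only [Prog.bind, h]; rfl) ho (ih h2)

lemma halts_bind_of [Finite α] {P : Prog Sig k X α} {f : α → Prog Sig k X β}
    {q : (P.bind f).Q} {s s' : Store k X g} {b : β} (h : Halts (P.bind f) g q s b s') :
    (∀ q', q = Sum.inl q' → ∃ a s1, Halts P g q' s a s1 ∧ Run (f a) s1 b s') ∧
    (∀ a q', q = Sum.inr ⟨a, q'⟩ → Halts (f a) g q' s b s') := by
  induction h with
  | @ret q a s h =>
    constructor
    · rintro q' rfl
      simp only [Prog.bind] at h
      generalize hx : P.δ q' = x at h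
      cases x <;> cases h
    · rintro a q' rfl
      simp only [Prog.bind] at h
      generalize hx : (f a).δ q' = x at h
      cases x <;> cases h
      exact .ret hx
  | @goto q q1 a s s' h _ ih =>
    constructor
    · rintro q' rfl
      simp only [Prog.bind] at h
      generalize hx : P.δ q' = x at h
      cases x <;> cases h
      · exact ⟨_, _, .ret hx, ih.2 _ _ rfl⟩
      · obtain ⟨a, s1, h1, h2⟩ := ih.1 _ rfl
        exact ⟨a, s1, .goto hx h1, h2⟩
    · rintro a q' rfl
      simp only [Prog.bind] at h
      generalize hx : (f a).δ q' = x at h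
      cases x <;> cases h
      exact .goto hx (ih.2 _ _ rfl)
  | op h ho _ ih =>
    constructor
    · rintro q' rfl
      simp only [Prog.bind] at h
      generalize hx : P.δ q' = x at h
      cases x <;> cases h
      · obtain ⟨a, s1, h1, h2⟩ := ih.1 _ rfl
        exact ⟨a, s1, .op hx ho h1, h2⟩
    · rintro a q' rfl
      simp only [Prog.bind] at h
      generalize hx : (f a).δ q' = x at h
      cases x <;> cases h
      exact .op hx ho (ih.2 _ _ rfl)
  | brt h ho _ ih =>
    constructor
    · rintro q' rfl
      simp only [Prog.bind] at h
      generalize hx : P.δ q' = x at h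
      cases x <;> cases h
      · obtain ⟨a, s1, h1, h2⟩ := ih.1 _ rfl
        exact ⟨a, s1, .brt hx ho h1, h2⟩
    · rintro a q' rfl
      simp only [Prog.bind] at h
      generalize hx : (f a).δ q' = x at h
      cases x <;> cases h
      exact .brt hx ho (ih.2 _ _ rfl)
  | brf h ho _ ih =>
    constructor
    · rintro q' rfl
      simp only [Prog.bind] at h
      generalize hx : P.δ q' = x at h
      cases x <;> cases h
      · obtain ⟨a, s1, h1, h2⟩ := ih.1 _ rfl
        exact ⟨a, s1, .brf hx ho h1, h2⟩
    · rintro a q' rfl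
      simp only [Prog.bind] at h
      generalize hx : (f a).δ q' = x at h
      cases x <;> cases h
      exact .brf hx ho (ih.2 _ _ rfl)

lemma run_bind [Finite α] {P : Prog Sig k X α} {f : α → Prog Sig k X β}
    {s s' : Store k X g} {b : β} :
    Run (P.bind f) s b s' ↔ ∃ a s1, Run P s a s1 ∧ Run (f a) s1 b s' :=
  ⟨fun h => (halts_bind_of h).1 _ rfl, fun ⟨_, _, h1, h2⟩ => halts_bind_inl h1 h2⟩

lemma Run.bind [Finite α] {P : Prog Sig k X α} {f : α → Prog Sig k X β}
    {s s1 s' : Store k X g} {a : α} {b : β} (h1 : Run P s a s1) (h2 : Run (f a) s1 b s') :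
    Run (P.bind f) s b s' := run_bind.2 ⟨_, _, h1, h2⟩

lemma Run.bind_iff [Finite α] {P : Prog Sig k X α} {f : α → Prog Sig k X β}
    {s s1 s' : Store k X g} {a : α} {b : β} (h1 : Run P s a s1) :
    Run (P.bind f) s b s' ↔ Run (f a) s1 b s' := by
  rw [run_bind]
  constructor
  · rintro ⟨a', s1', h2, h3⟩
    obtain ⟨rfl, rfl⟩ := h1.det h2
    exact h3
  · intro h; exact ⟨_, _, h1, h⟩

/-- Runs of an iteration. -/
inductive IterRun {S : Type} (body : S → Prog Sig k X (S ⊕ α)) (g : LGraph Sig) :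
    S → Store k X g → α → Store k X g → Prop
  | done {x s a s'} : Run (body x) s (Sum.inr a) s' → IterRun body g x s a s'
  | more {x y s s1 a s'} : Run (body x) s (Sum.inl y) s1 → IterRun body g y s1 a s' →
      IterRun body g x s a s'

lemma halts_iter_done {S : Type} [Finite S] {body : S → Prog Sig k X (S ⊕ α)} {x x0 : S}
    {q : (body x).Q} {s s' : Store k X g} {r : S ⊕ α} (h : Halts (body x) g q s r s') :
    (∀ a, r = Sum.inr a → Halts (Prog.iter body x0) g ⟨x, q⟩ s a s') ∧
    (∀ y a s2, r = Sum.inl y → Halts (Prog.iter body x0) g ⟨y, (body y).q0⟩ s' a s2 →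
      Halts (Prog.iter body x0) g ⟨x, q⟩ s a s2) := by
  induction h with
  | ret h =>
    constructor
    · rintro a rfl
      exact .ret (by simp only [Prog.iter, h]; rfl)
    · rintro y a s2 rfl h2
      exact .goto (by simp only [Prog.iter, h]; rfl) h2
  | goto h _ ih =>
    exact ⟨fun a ha => .goto (by simp only [Prog.iter, h]; rfl) (ih.1 a ha),
      fun y a s2 hy h2 => .goto (by simp only [Prog.iter, h]; rfl) (ih.2 y a s2 hy h2)⟩
  | op h ho _ ih =>
    exact ⟨fun a ha => .op (by simp only [Prog.iter, h]; rfl) ho (ih.1 a ha),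
      fun y a s2 hy h2 => .op (by simp only [Prog.iter, h]; rfl) ho (ih.2 y a s2 hy h2)⟩
  | brt h ho _ ih =>
    exact ⟨fun a ha => .brt (by simp only [Prog.iter, h]; rfl) ho (ih.1 a ha),
      fun y a s2 hy h2 => .brt (by simp only [Prog.iter, h]; rfl) ho (ih.2 y a s2 hy h2)⟩
  | brf h ho _ ih =>
    exact ⟨fun a ha => .brf (by simp only [Prog.iter, h]; rfl) ho (ih.1 a ha),
      fun y a s2 hy h2 => .brf (by simp only [Prog.iter, h]; rfl) ho (ih.2 y a s2 hy h2)⟩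

lemma halts_iter_of {S : Type} [Finite S] {body : S → Prog Sig k X (S ⊕ α)} {x0 : S}
    {q : (Prog.iter body x0).Q} {s s' : Store k X g} {a : α}
    (h : Halts (Prog.iter body x0) g q s a s') :
    ∀ x q', q = ⟨x, q'⟩ → Halts (body x) g q' s (Sum.inr a) s' ∨
      ∃ y s1, Halts (body x) g q' s (Sum.inl y) s1 ∧ IterRun body g y s1 a s' := by
  induction h with
  | ret h =>
    rintro x q' rfl
    simp only [Prog.iter] at h
    generalize hx : (body x).δ q' = z at h
    cases z with
    | ret r => rcases r with r | r <;> cases h; exact Or.inl (.ret hx)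
    | _ => cases h
  | goto h _ ih =>
    rintro x q' rfl
    simp only [Prog.iter] at h
    generalize hx : (body x).δ q' = z at h
    cases z with
    | ret r =>
      rcases r with r | r <;> cases h
      refine Or.inr ⟨_, _, .ret hx, ?_⟩
      rcases ih _ _ rfl with h1 | ⟨y, s1, h1, h2⟩
      · exact .done h1
      · exact .more h1 h2
    | goto q =>
      cases h
      exact (ih _ _ rfl).imp (.goto hx) fun ⟨y, s1, h1, h2⟩ => ⟨y, s1, .goto hx h1, h2⟩
    | _ => cases h
  | op h ho _ ih =>
    rintro x q' rfl
    simp only [Prog.iter] at h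
    generalize hx : (body x).δ q' = z at h
    cases z with
    | ret r => rcases r with r | r <;> cases h
    | op o q =>
      cases h
      exact (ih _ _ rfl).imp (.op hx ho) fun ⟨y, s1, h1, h2⟩ => ⟨y, s1, .op hx ho h1, h2⟩
    | _ => cases h
  | brt h ho _ ih =>
    rintro x q' rfl
    simp only [Prog.iter] at h
    generalize hx : (body x).δ q' = z at h
    cases z with
    | ret r => rcases r with r | r <;> cases h
    | br τ q1 q2 =>
      cases h
      exact (ih _ _ rfl).imp (.brt hx ho) fun ⟨y, s1, h1, h2⟩ => ⟨y, s1, .brt hx ho h1, h2⟩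
    | _ => cases h
  | brf h ho _ ih =>
    rintro x q' rfl
    simp only [Prog.iter] at h
    generalize hx : (body x).δ q' = z at h
    cases z with
    | ret r => rcases r with r | r <;> cases h
    | br τ q1 q2 =>
      cases h
      exact (ih _ _ rfl).imp (.brf hx ho) fun ⟨y, s1, h1, h2⟩ => ⟨y, s1, .brf hx ho h1, h2⟩
    | _ => cases h

lemma run_iter {S : Type} [Finite S] {body : S → Prog Sig k X (S ⊕ α)} {x : S}
    {s s' : Store k X g} {a : α} : Run (Prog.iter body x) s a s' ↔ IterRun body g x s a s' := by
  constructor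
  · intro h
    rcases halts_iter_of h _ _ rfl with h1 | ⟨y, s1, h1, h2⟩
    · exact .done h1
    · exact .more h1 h2
  · intro h
    have : ∀ x0, Halts (Prog.iter body x0) g ⟨x, (body x).q0⟩ s a s' := by
      intro x0
      induction h with
      | done h1 => exact (halts_iter_done h1).1 _ rfl
      | more h1 _ ih => exact (halts_iter_done h1).2 _ _ _ rfl ih
    exact this x

end Machine

section Compile
variable {Sig : Type} {k : ℕ} {X : Type}

/-- The pebbles occurring in an action. -/
def Act.pebs {Q α : Type} : Act Sig k X Q α → Set X
  | .op (.drop _ x) _ => {x}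
  | .op (.retr x) _ => {x}
  | .br (.peb _ x) _ _ => {x}
  | _ => ∅

def Prog.pebs {α : Type} (P : Prog Sig k X α) : Set X := ⋃ q, (P.δ q).pebs

lemma Prog.pebs_finite {α : Type} (P : Prog Sig k X α) : P.pebs.Finite := by
  have := P.fin
  refine Set.finite_iUnion fun q => ?_
  cases P.δ q with
  | op o q => cases o <;> simp [Act.pebs]
  | br τ q1 q2 => cases τ <;> simp [Act.pebs]
  | _ => simp [Act.pebs]

open Classical in
noncomputable def Prog.enc {α : Type} (P : Prog Sig k X α) (x : X) : Option P.pebs :=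
  if h : x ∈ P.pebs then some ⟨x, h⟩ else none

lemma Prog.enc_inj {α : Type} (P : Prog Sig k X α) {x y : X} (hx : x ∈ P.pebs)
    (h : P.enc y = P.enc x) : y = x := by
  unfold Prog.enc at h
  rw [dif_pos hx] at h
  split_ifs at h with h1
  simpa using h

/-- The instructions for one action. -/
noncomputable def Prog.actInstr {α : Type} (P : Prog Sig k X α) (i0 : Fin k) (q : P.Q) :
    Set (P.Q × GInstr Sig k (Option P.pebs) × P.Q) :=
  match P.δ q with
  | .ret _ => ∅
  | .goto q' => {(q, .test false (.peb i0 none), q')}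
  | .op o q' => {(q, o.instr P.enc, q')}
  | .br τ q1 q2 => {(q, .test true (τ.ren P.enc), q1), (q, .test false (τ.ren P.enc), q2)}

lemma Prog.actInstr_fst {α : Type} (P : Prog Sig k X α) (i0 : Fin k) (q : P.Q) {t}
    (h : t ∈ P.actInstr i0 q) : t.1 = q := by
  unfold Prog.actInstr at h
  split at h
  · exact h.elim
  · rw [Set.mem_singleton_iff.1 h]
  · rw [Set.mem_singleton_iff.1 h]
  · rcases h with h | h
    · rw [h]
    · rw [Set.mem_singleton_iff.1 h]

/-- The automaton of a program. -/
noncomputable def Prog.toGWA (P : Prog Sig k X Bool) (i0 : Fin k) : GWA Sig k where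
  Q := P.Q
  finQ := by have := P.fin; exact Fintype.ofFinite _
  X := Option P.pebs
  finX := by have := P.pebs_finite.to_subtype; exact Fintype.ofFinite _
  q0 := P.q0
  acc := {q | P.δ q = .ret true}
  instr := ⋃ q, P.actInstr i0 q
  instrFin := by
    have := P.fin
    refine Set.finite_iUnion fun q => ?_
    unfold Prog.actInstr
    split <;> simp

lemma Prog.mem_instr (P : Prog Sig k X Bool) (i0 : Fin k) {q q' : P.Q}
    {ins : GInstr Sig k (Option P.pebs)} :
    (q, ins, q') ∈ (P.toGWA i0).instr ↔
      (P.δ q = .goto q' ∧ ins = .test false (.peb i0 none)) ∨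
      (∃ o, P.δ q = .op o q' ∧ ins = o.instr P.enc) ∨
      (∃ τ q2, P.δ q = .br τ q' q2 ∧ ins = .test true (τ.ren P.enc)) ∨
      (∃ τ q1, P.δ q = .br τ q1 q' ∧ ins = .test false (τ.ren P.enc)) := by
  have h0 : (q, ins, q') ∈ (P.toGWA i0).instr ↔ (q, ins, q') ∈ P.actInstr i0 q := by
    constructor
    · intro h
      obtain ⟨r, hr⟩ := Set.mem_iUnion.1 h
      have := P.actInstr_fst i0 r hr
      simp only at this
      subst this
      exact hr
    · intro h
      exact Set.mem_iUnion.2 ⟨_, h⟩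
  rw [h0]
  unfold Prog.actInstr
  split <;> rename_i h
  · simp [h]
  · simp only [h, Set.mem_singleton_iff, Prod.mk.injEq, true_and]
    constructor
    · rintro ⟨rfl, rfl⟩; exact Or.inl ⟨rfl, rfl⟩
    · rintro (⟨h1, rfl⟩ | ⟨_, h1, _⟩ | ⟨_, _, h1, _⟩ | ⟨_, _, h1, _⟩) <;> cases h1
      exact ⟨rfl, rfl⟩
  · simp only [h, Set.mem_singleton_iff, Prod.mk.injEq, true_and]
    constructor
    · rintro ⟨rfl, rfl⟩; exact Or.inr (Or.inl ⟨_, rfl, rfl⟩)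
    · rintro (⟨h1, rfl⟩ | ⟨_, h1, h2⟩ | ⟨_, _, h1, _⟩ | ⟨_, _, h1, _⟩) <;> cases h1
      exact ⟨h2, rfl⟩
  · simp only [h, Set.mem_insert_iff, Set.mem_singleton_iff, Prod.mk.injEq, true_and]
    constructor
    · rintro (⟨rfl, rfl⟩ | ⟨rfl, rfl⟩)
      · exact Or.inr (Or.inr (Or.inl ⟨_, _, rfl, rfl⟩))
      · exact Or.inr (Or.inr (Or.inr ⟨_, _, rfl, rfl⟩))
    · rintro (⟨h1, rfl⟩ | ⟨_, h1, h2⟩ | ⟨_, _, h1, h2⟩ | ⟨_, _, h1, h2⟩) <;> cases h1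
      · exact Or.inl ⟨h2, rfl⟩
      · exact Or.inr ⟨h2, rfl⟩

lemma Prog.toGWA_det (P : Prog Sig k X Bool) (i0 : Fin k) : GDeterministic (P.toGWA i0) := by
  intro p χ₁ q₁ χ₂ q₂ h1 h2 hne
  have h1 := (P.mem_instr i0).1 h1
  have h2 := (P.mem_instr i0).1 h2
  rcases h1 with ⟨h1, e1⟩ | ⟨_, h1, e1⟩ | ⟨_, _, h1, e1⟩ | ⟨_, _, h1, e1⟩ <;>
  rcases h2 with ⟨h2, e2⟩ | ⟨_, h2, e2⟩ | ⟨_, _, h2, e2⟩ | ⟨_, _, h2, e2⟩ <;>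
  rw [h1] at h2 <;> cases h2
  · exact absurd (by rw [e1, e2]) hne
  · exact absurd (by rw [e1, e2]) hne
  · exact absurd (by rw [e1, e2]) hne
  · exact Or.inl ⟨_, _, e1, e2⟩
  · exact Or.inr ⟨_, _, e2, e1⟩
  · exact absurd (by rw [e1, e2]) hne

lemma Prog.toGWA_noJump (P : Prog Sig k X Bool) (i0 : Fin k) : NoJump (P.toGWA i0) := by
  intro p χ q h i x hx
  have h1 := (P.mem_instr i0).1 h
  subst hx
  rcases h1 with ⟨h1, e1⟩ | ⟨o, h1, e1⟩ | ⟨_, _, h1, e1⟩ | ⟨_, _, h1, e1⟩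
  · cases e1
  · cases o <;> cases e1
  · cases e1
  · cases e1

variable {g : LGraph Sig}

/-- Encoding of the stack. -/
noncomputable def Prog.encs {α : Type} (P : Prog Sig k X α) (π : List (X × g.V)) :
    List (Option P.pebs × g.V) := π.map fun p => (P.enc p.1, p.2)

lemma Prog.mem_encs {α : Type} (P : Prog Sig k X α) {π : List (X × g.V)} {x : X} {v : g.V}
    (hx : x ∈ P.pebs) : (P.enc x, v) ∈ P.encs π ↔ (x, v) ∈ π := by
  simp only [Prog.encs, List.mem_map, Prod.mk.injEq]
  constructor
  · rintro ⟨⟨y, w⟩, h1, h2, rfl⟩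
    rw [← P.enc_inj hx h2]; exact h1
  · intro h; exact ⟨_, h, rfl, rfl⟩

/-- Only pebbles of the program occur. -/
def Prog.Own {α : Type} (P : Prog Sig k X α) (π : List (X × g.V)) : Prop :=
  ∀ p ∈ π, p.1 ∈ P.pebs

lemma Prog.none_encs {α : Type} (P : Prog Sig k X α) {π : List (X × g.V)} {v : g.V}
    (hπ : P.Own π) : (none, v) ∉ P.encs π := by
  simp only [Prog.encs, List.mem_map, Prod.mk.injEq]
  rintro ⟨⟨y, w⟩, h1, h2, rfl⟩
  unfold Prog.enc at h2
  rw [dif_pos (hπ _ h1)] at h2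
  cases h2

lemma Prog.mem_pebs {α : Type} (P : Prog Sig k X α) {q : P.Q} {x : X} (h : x ∈ (P.δ q).pebs) :
    x ∈ P.pebs := Set.mem_iUnion.2 ⟨q, h⟩

lemma Prog.test_enc {α : Type} (P : Prog Sig k X α) {q q1 q2 : P.Q} {τ} (h : P.δ q = .br τ q1 q2)
    {hs : Fin k → g.V} {π : List (X × g.V)} :
    gTestHolds g (τ.ren P.enc) hs (P.encs π) ↔ gTestHolds g τ hs π := by
  cases τ with
  | peb i x =>
    exact P.mem_encs (P.mem_pebs (q := q) (by rw [h]; exact rfl))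
  | _ => exact Iff.rfl

lemma Prog.opStep_own {α : Type} (P : Prog Sig k X α) {q q1 : P.Q} {o} (h : P.δ q = .op o q1)
    {s s' : Store k X g} (hs : P.Own s.2) (ho : OpStep g o s s') : P.Own s'.2 := by
  cases o with
  | inm i a => rw [ho.1]; exact hs
  | outm i a => rw [ho.1]; exact hs
  | drop i x =>
    have := ho.2.1
    rw [this]
    intro p hp
    rcases List.mem_cons.1 hp with rfl | hp
    · exact P.mem_pebs (q := q) (by rw [h]; exact rfl)
    · exact hs p hp
  | retr x =>
    obtain ⟨w, hw⟩ := ho.2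
    intro p hp
    exact hs p (by rw [hw]; exact List.mem_cons_of_mem _ hp)

lemma Prog.opStep_enc {α : Type} (P : Prog Sig k X α) {q q1 : P.Q} {o} (h : P.δ q = .op o q1)
    {s s' : Store k X g} (ho : OpStep g o s s') :
    gInstrStep g (o.instr P.enc) s.1 (P.encs s.2) s'.1 (P.encs s'.2) := by
  cases o with
  | inm i a => exact ⟨by rw [ho.1], ho.2⟩
  | outm i a => exact ⟨by rw [ho.1], ho.2⟩
  | drop i x =>
    obtain ⟨h1, h2, h3⟩ := ho
    refine ⟨h1, by rw [h2]; rfl, fun w hw => h3 w ?_⟩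
    exact (P.mem_encs (P.mem_pebs (q := q) (by rw [h]; exact rfl))).1 hw
  | retr x =>
    obtain ⟨h1, w, hw⟩ := ho
    exact ⟨h1, w, by rw [hw]; rfl⟩

lemma Prog.opStep_dec {α : Type} (P : Prog Sig k X α) {q q1 : P.Q} {o} (h : P.δ q = .op o q1)
    {s : Store k X g} {hs' π'} (ho : gInstrStep g (o.instr P.enc) s.1 (P.encs s.2) hs' π') :
    ∃ π1, π' = P.encs π1 ∧ OpStep g o s (hs', π1) := by
  cases o with
  | inm i a => exact ⟨s.2, ho.1, rfl, ho.2⟩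
  | outm i a => exact ⟨s.2, ho.1, rfl, ho.2⟩
  | drop i x =>
    obtain ⟨h1, h2, h3⟩ := ho
    refine ⟨(x, s.1 i) :: s.2, h2, h1, rfl, fun w hw => h3 w ?_⟩
    exact (P.mem_encs (P.mem_pebs (q := q) (by rw [h]; exact rfl))).2 hw
  | retr x =>
    obtain ⟨h1, w, hw⟩ := ho
    obtain ⟨s1, s2⟩ := s
    cases s2 with
    | nil => simp [Prog.encs] at hw
    | cons p π1 =>
      simp only [Prog.encs, List.map_cons, List.cons.injEq, Prod.mk.injEq] at hw
      obtain ⟨⟨h2, h3⟩, rfl⟩ := hw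
      have : p.1 = x := P.enc_inj (P.mem_pebs (q := q) (by rw [h]; exact rfl)) h2
      exact ⟨π1, rfl, h1, p.2, by simp [← this]⟩

lemma Prog.sim {P : Prog Sig k X Bool} (i0 : Fin k) {q : P.Q} {s s' : Store k X g} {a : Bool}
    (h : Halts P g q s a s') (hs : P.Own s.2) :
    ∃ qf : P.Q, P.δ qf = .ret a ∧ ReflTransGen (GStep (P.toGWA i0) g) (q, s.1, P.encs s.2)
      (qf, s'.1, P.encs s'.2) := by
  induction h with
  | ret h => exact ⟨_, h, .refl⟩
  | @goto q q' a s s' h _ ih =>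
    obtain ⟨qf, h1, h2⟩ := ih hs
    have st : GStep (P.toGWA i0) g (q, s.1, P.encs s.2) (q', s.1, P.encs s.2) :=
      ⟨.test false (.peb i0 none), (P.mem_instr i0).2 (Or.inl ⟨h, rfl⟩), rfl, rfl,
        iff_of_false (P.none_encs hs) (by simp)⟩
    exact ⟨qf, h1, .head st h2⟩
  | @op q q' o a s s1 s' h ho _ ih =>
    obtain ⟨qf, h1, h2⟩ := ih (P.opStep_own h hs ho)
    have st : GStep (P.toGWA i0) g (q, s.1, P.encs s.2) (q', s1.1, P.encs s1.2) :=
      ⟨o.instr P.enc, (P.mem_instr i0).2 (Or.inr (Or.inl ⟨_, h, rfl⟩)), P.opStep_enc h ho⟩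
    exact ⟨qf, h1, .head st h2⟩
  | @brt q q1 q2 τ a s s' h ho _ ih =>
    obtain ⟨qf, h1, h2⟩ := ih hs
    have st : GStep (P.toGWA i0) g (q, s.1, P.encs s.2) (q1, s.1, P.encs s.2) :=
      ⟨.test true (τ.ren P.enc), (P.mem_instr i0).2 (Or.inr (Or.inr (Or.inl ⟨_, _, h, rfl⟩))),
        rfl, rfl, iff_of_true ((P.test_enc h).2 ho) rfl⟩
    exact ⟨qf, h1, .head st h2⟩
  | @brf q q1 q2 τ a s s' h ho _ ih =>
    obtain ⟨qf, h1, h2⟩ := ih hs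
    have st : GStep (P.toGWA i0) g (q, s.1, P.encs s.2) (q2, s.1, P.encs s.2) :=
      ⟨.test false (τ.ren P.enc), (P.mem_instr i0).2 (Or.inr (Or.inr (Or.inr ⟨_, _, h, rfl⟩))),
        rfl, rfl, iff_of_false (fun h' => ho ((P.test_enc h).1 h')) (by simp)⟩
    exact ⟨qf, h1, .head st h2⟩

lemma Prog.sim_conv {P : Prog Sig k X Bool} (i0 : Fin k) {c d : GConf (P.toGWA i0) g} {a : Bool}
    (h : ReflTransGen (GStep (P.toGWA i0) g) c d) (hd : d.2.2 = []) (ha : P.δ d.1 = .ret a) :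
    ∀ (q : P.Q) (s : Store k X g), c = (q, s.1, P.encs s.2) → P.Own s.2 →
      Halts P g q s a (d.2.1, []) := by
  induction h using ReflTransGen.head_induction_on with
  | refl =>
    rintro q ⟨hs, π⟩ rfl hown
    have : π = [] := List.map_eq_nil_iff.1 hd
    subst this
    exact .ret ha
  | @head c c' hst _ ih =>
    rintro q ⟨hs, π⟩ rfl hown
    obtain ⟨ins, hm, hins⟩ := hst
    obtain ⟨q', hs', π'⟩ := c'
    dsimp only at hins
    have hm := (P.mem_instr i0).1 hm
    rcases hm with ⟨h1, rfl⟩ | ⟨o, h1, rfl⟩ | ⟨_, _, h1, rfl⟩ | ⟨_, _, h1, rfl⟩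
    · obtain ⟨rfl, rfl, _⟩ := hins
      exact .goto h1 (ih q' (hs', π) rfl hown)
    · obtain ⟨π1, rfl, h2⟩ := P.opStep_dec h1 (s := (hs, π)) hins
      exact .op h1 h2 (ih q' (hs', π1) rfl (P.opStep_own h1 hown h2))
    · obtain ⟨rfl, rfl, h3⟩ := hins
      have h2 := P.test_enc h1 (hs := hs') (π := π)
      exact .brt h1 (h2.1 (h3.2 rfl)) (ih q' (hs', π) rfl hown)
    · obtain ⟨rfl, rfl, h3⟩ := hins
      have h2 := P.test_enc h1 (hs := hs') (π := π)
      exact .brf h1 (fun h4 => by simpa using h3.1 (h2.2 h4)) (ih q' (hs', π) rfl hown)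

lemma Prog.accFrom_iff (P : Prog Sig k X Bool) (i0 : Fin k) (u : g.V) :
    AccFrom (P.toGWA i0) g u ↔ ∃ hs' : Fin k → g.V, Run P (fun _ => u, []) true (hs', []) := by
  constructor
  · rintro ⟨q, hs, hq, h1, -⟩
    exact ⟨hs, Prog.sim_conv i0 h1 rfl hq P.q0 (fun _ => u, []) rfl (by simp [Prog.Own])⟩
  · rintro ⟨hs', h⟩
    obtain ⟨qf, h1, h2⟩ := Prog.sim i0 h (by simp [Prog.Own])
    refine ⟨qf, hs', h1, h2, ?_⟩
    rintro c ⟨ins, hm, _⟩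
    have hm := (P.mem_instr i0).1 hm
    rcases hm with ⟨h2, _⟩ | ⟨o, h2, _⟩ | ⟨_, _, h2, _⟩ | ⟨_, _, h2, _⟩ <;>
    · change P.δ qf = _ at h2
      rw [h1] at h2
      cases h2

end Compile
end NestedPebblesGraphs

namespace NestedPebblesGraphs
open Relation

/-- Pebble names used by the programs. -/
inductive PB (Y : Type) : Type
  | org
  | tmp (r : ℕ)
  | gd (r : ℕ) (x : Y)
  | var (n : ℕ)

def PB.rk {Y : Type} : PB Y → ℕ
  | .org => 100
  | .tmp r => r
  | .gd r _ => r
  | .var _ => 100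

/-- No pebble is dropped twice, and all have rank at least `r`. -/
def OK {Y V : Type} (r : ℕ) (π : List (PB Y × V)) : Prop :=
  (π.map Prod.fst).Nodup ∧ ∀ p ∈ π, r ≤ p.1.rk

lemma OK.mono {Y V : Type} {r r' : ℕ} {π : List (PB Y × V)} (h : OK r π) (hr : r' ≤ r) :
    OK r' π := ⟨h.1, fun p hp => hr.trans (h.2 p hp)⟩

lemma OK.cons {Y V : Type} {r r' : ℕ} {π : List (PB Y × V)} (h : OK r π) (x : PB Y) (v : V)
    (hx : x.rk < r) (hr : r' ≤ x.rk) : OK r' ((x, v) :: π) := by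
  refine ⟨?_, ?_⟩
  · simp only [List.map_cons, List.nodup_cons]
    refine ⟨fun hm => ?_, h.1⟩
    obtain ⟨p, hp, h2⟩ := List.mem_map.1 hm
    have := h.2 p hp
    rw [h2] at this; omega
  · intro p hp
    rcases List.mem_cons.1 hp with rfl | hp
    · exact hr
    · have := h.2 p hp; omega

lemma OK.not_mem {Y V : Type} {r : ℕ} {π : List (PB Y × V)} (h : OK r π) {x : PB Y}
    (hx : x.rk < r) (v : V) : (x, v) ∉ π := by
  intro hm
  have := h.2 _ hm
  simp only at this
  omega

lemma OK.uniq {Y V : Type} {r : ℕ} {π : List (PB Y × V)} (h : OK r π) {x : PB Y} {v w : V}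
    (h1 : (x, v) ∈ π) (h2 : (x, w) ∈ π) : v = w := by
  have := List.inj_on_of_nodup_map h.1 h1 h2 rfl
  exact congrArg Prod.snd this

lemma OK.append {Y V : Type} {r ℓ : ℕ} {π : List (PB Y × V)} (h : OK r π) (hr : ℓ < r)
    (st : List (Y × V)) (hst : (st.map Prod.fst).Nodup) :
    OK ℓ (st.map (fun p => (PB.gd ℓ p.1, p.2)) ++ π) := by
  refine ⟨?_, ?_⟩
  · rw [List.map_append, List.nodup_append]
    refine ⟨?_, h.1, ?_⟩
    · have : (st.map (fun p => (PB.gd ℓ p.1, p.2))).map Prod.fst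
          = (st.map Prod.fst).map (PB.gd ℓ) := by simp [Function.comp_def]
      rw [this]
      exact hst.map (fun a b hab => by simpa using hab)
    · intro a ha b hb hab
      subst hab
      obtain ⟨p, hp, h2⟩ := List.mem_map.1 hb
      obtain ⟨p', hp', h3⟩ := List.mem_map.1 ha
      obtain ⟨p'', hp'', h4⟩ := List.mem_map.1 hp'
      have := h.2 p hp
      rw [h2, ← h3, ← h4] at this
      simp only [PB.rk] at this
      omega
  · intro p hp
    rcases List.mem_append.1 hp with hp | hp
    · obtain ⟨p'', hp'', h4⟩ := List.mem_map.1 hp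
      rw [← h4]; exact le_rfl
    · have := h.2 p hp; omega

section Ops
variable {Sig : Type} {k : ℕ} {X : Type} {g : LGraph Sig}

lemma run_drop {i : Fin k} {x : X} {hs : Fin k → g.V} {π : List (X × g.V)}
    (h : ∀ w, (x, w) ∉ π) : Run (Prog.op (.drop i x)) (hs, π) () (hs, (x, hs i) :: π) :=
  run_op.2 ⟨rfl, rfl, h⟩

lemma run_retr {x : X} {hs : Fin k → g.V} {w : g.V} {π : List (X × g.V)} :
    Run (Prog.op (.retr x)) (hs, (x, w) :: π) () (hs, π) :=
  run_op.2 ⟨rfl, w, rfl⟩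

lemma run_inm {i : Fin k} {a : Sig} {hs : Fin k → g.V} {π : List (X × g.V)} {u : g.V}
    (h : g.edge a u (hs i)) :
    Run (Prog.op (.inm i a)) (hs, π) () (Function.update hs i u, π) :=
  run_op.2 ⟨rfl, by simpa using h, fun j hj => by simp [hj]⟩

lemma run_outm {i : Fin k} {a : Sig} {hs : Fin k → g.V} {π : List (X × g.V)} {u : g.V}
    (h : g.edge a (hs i) u) :
    Run (Prog.op (.outm i a)) (hs, π) () (Function.update hs i u, π) :=
  run_op.2 ⟨rfl, by simpa using h, fun j hj => by simp [hj]⟩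

open Classical in
lemma run_test_dec (τ : GTest Sig k X) (s : Store k X g) :
    Run (Prog.test τ) s (decide (gTestHolds g τ s.1 s.2)) s :=
  run_test.2 ⟨by simp, rfl⟩

lemma run_test_t {τ : GTest Sig k X} {s : Store k X g} (h : gTestHolds g τ s.1 s.2) :
    Run (Prog.test τ) s true s := run_test.2 ⟨by simp [h], rfl⟩

lemma run_test_f {τ : GTest Sig k X} {s : Store k X g} (h : ¬ gTestHolds g τ s.1 s.2) :
    Run (Prog.test τ) s false s := run_test.2 ⟨by simp [h], rfl⟩

lemma run_pure' {α : Type} {a : α} {s : Store k X g} : Run (Prog.pure a) s a s :=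
  run_pure.2 ⟨rfl, rfl⟩

end Ops

section Guide
variable {Sig : Type} {k : ℕ} (A0 : GWA Sig 1)

/-- Finite part of the guide configurations: state and pebble names. -/
abbrev GS : Type := A0.Q × {l : List A0.X // l.Nodup}

instance : Finite (GS A0) := by
  classical
  have := A0.finQ
  have := A0.finX
  infer_instance

variable {A0}

abbrev PG (A0 : GWA Sig 1) (k : ℕ) (α : Type) : Type 1 := Prog Sig k (PB A0.X) α

def trTest (i : Fin k) (ℓ : ℕ) : GTest Sig 1 A0.X → GTest Sig k (PB A0.X)
  | .lab _ a => .lab i a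
  | .inedge _ a => .inedge i a
  | .outedge _ a => .outedge i a
  | .peb _ x => .peb i (.gd ℓ x)

open Classical in
noncomputable def gexec (i : Fin k) (ℓ : ℕ) (s : GS A0) (ins : GInstr Sig 1 A0.X) (q' : A0.Q) :
    PG A0 k (Option (GS A0)) :=
  match ins with
  | .inmove _ a => (Prog.test (.inedge i a)).bind fun b =>
      if b then (Prog.op (.inm i a)).bind fun _ => .pure (some (q', s.2)) else .pure none
  | .outmove _ a => (Prog.test (.outedge i a)).bind fun b =>
      if b then (Prog.op (.outm i a)).bind fun _ => .pure (some (q', s.2)) else .pure none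
  | .dropPeb _ x => if h : x ∈ s.2.1 then .pure none else
      (Prog.op (.drop i (.gd ℓ x))).bind fun _ =>
        .pure (some (q', ⟨x :: s.2.1, List.nodup_cons.2 ⟨h, s.2.2⟩⟩))
  | .retrieve x => if s.2.1.head? = some x then
      (Prog.op (.retr (.gd ℓ x))).bind fun _ =>
        .pure (some (q', ⟨s.2.1.tail, s.2.2.tail⟩)) else .pure none
  | .jump _ _ => .pure none
  | .test _ τ => (Prog.test (trTest i ℓ τ)).bind fun b =>
      .pure (if h : ∃ q'', (s.1, GInstr.test b τ, q'') ∈ A0.instr then some (h.choose, s.2)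
        else none)

open Classical in
noncomputable def gstep (i : Fin k) (ℓ : ℕ) (s : GS A0) : PG A0 k (Option (GS A0)) :=
  if h : ∃ p : GInstr Sig 1 A0.X × A0.Q, (s.1, p.1, p.2) ∈ A0.instr then
    gexec i ℓ s h.choose.1 h.choose.2 else .pure none

variable {g : LGraph Sig}

def Rep (s : GS A0) (c : GConf A0 g) : Prop := c.1 = s.1 ∧ c.2.2.map Prod.fst = s.2.1

/-- Guide stack at level `ℓ`. -/
def gmap (ℓ : ℕ) (st : List (A0.X × g.V)) : List (PB A0.X × g.V) :=
  st.map (fun p => (PB.gd ℓ p.1, p.2))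

def emb (i : Fin k) (ℓ : ℕ) (hs : Fin k → g.V) (π : List (PB A0.X × g.V)) (c : GConf A0 g) :
    Store k (PB A0.X) g :=
  (Function.update hs i (c.2.1 0), gmap ℓ c.2.2 ++ π)

lemma mem_gmap {ℓ : ℕ} {st : List (A0.X × g.V)} {π : List (PB A0.X × g.V)} (hπ : OK (ℓ + 1) π)
    {x : A0.X} {v : g.V} : (PB.gd ℓ x, v) ∈ gmap ℓ st ++ π ↔ (x, v) ∈ st := by
  rw [List.mem_append]
  constructor
  · rintro (h | h)
    · obtain ⟨⟨y, w⟩, hp, h2⟩ := List.mem_map.1 h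
      simp only [Prod.mk.injEq, PB.gd.injEq, true_and] at h2
      rw [← h2.1, ← h2.2]; exact hp
    · exact absurd h (hπ.not_mem (by simp [PB.rk]) v)
  · intro h
    exact Or.inl (List.mem_map.2 ⟨_, h, rfl⟩)

lemma trTest_iff {i : Fin k} {ℓ : ℕ} {hs : Fin k → g.V} {π : List (PB A0.X × g.V)}
    (hπ : OK (ℓ + 1) π) {c : GConf A0 g} {τ : GTest Sig 1 A0.X} :
    gTestHolds g (trTest i ℓ τ) (emb i ℓ hs π c).1 (emb i ℓ hs π c).2 ↔
      gTestHolds g τ c.2.1 c.2.2 := by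
  cases τ with
  | lab j a =>
    obtain rfl : j = 0 := Subsingleton.elim _ _
    simp [gTestHolds, trTest, emb]
  | inedge j a =>
    obtain rfl : j = 0 := Subsingleton.elim _ _
    simp [gTestHolds, trTest, emb]
  | outedge j a =>
    obtain rfl : j = 0 := Subsingleton.elim _ _
    simp [gTestHolds, trTest, emb]
  | peb j x =>
    obtain rfl : j = 0 := Subsingleton.elim _ _
    simp only [gTestHolds, trTest, emb, Function.update_self]
    exact mem_gmap hπ

lemma gInstr_det (hJ : NoJump A0) {q q' : A0.Q} {ins : GInstr Sig 1 A0.X}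
    (hm : (q, ins, q') ∈ A0.instr) {a b b' : Fin 1 → g.V} {π π1 π2 : List (A0.X × g.V)}
    (h1 : gInstrStep g ins a π b π1) (h2 : gInstrStep g ins a π b' π2) : (b, π1) = (b', π2) := by
  cases ins with
  | inmove i c =>
    have := instr_det g (.inmove i c) trivial h1 h2
    rw [this, h1.1, h2.1]
  | outmove i c =>
    have := instr_det g (.outmove i c) trivial h1 h2
    rw [this, h1.1, h2.1]
  | dropPeb i x =>
    rw [h1.1, h2.1, h1.2.1, h2.2.1]
  | retrieve x =>
    obtain ⟨e1, w, e2⟩ := h1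
    obtain ⟨e3, w', e4⟩ := h2
    simp_all
  | jump i x => exact absurd rfl (hJ _ _ _ hm i x)
  | test b τ => rw [h1.1, h2.1, h1.2.1, h2.2.1]

lemma GStep_det (hA : GDeterministic A0) (hJ : NoJump A0) {c d d' : GConf A0 g}
    (h1 : GStep A0 g c d) (h2 : GStep A0 g c d') : d = d' := by
  obtain ⟨q, a, π⟩ := c
  obtain ⟨q1, a1, π1⟩ := d
  obtain ⟨q2, a2, π2⟩ := d'
  obtain ⟨i1, m1, s1⟩ := h1
  obtain ⟨i2, m2, s2⟩ := h2
  dsimp only at m1 s1 m2 s2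
  by_cases hc : (i1, q1) = (i2, q2)
  · obtain ⟨rfl, rfl⟩ := Prod.mk.injEq .. ▸ hc
    rw [gInstr_det hJ m1 s1 s2]
  · exfalso
    rcases hA _ _ _ _ _ m1 m2 hc with ⟨b, τ, rfl, rfl⟩ | ⟨b, τ, rfl, rfl⟩
    · have h3 := s1.2.2
      rw [s2.2.2] at h3
      cases b <;> simp at h3
    · have h3 := s1.2.2
      rw [s2.2.2] at h3
      cases b <;> simp at h3

lemma gexec_spec (hA : GDeterministic A0) (hJ : NoJump A0) {i : Fin k} {ℓ : ℕ} {hs : Fin k → g.V}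
    {π : List (PB A0.X × g.V)} (hπ : OK (ℓ + 1) π) {s : GS A0} {c : GConf A0 g} (hr : Rep s c)
    {ins : GInstr Sig 1 A0.X} {q' : A0.Q} (hm : (s.1, ins, q') ∈ A0.instr) :
    (∃ c' s', GStep A0 g c c' ∧ Rep s' c' ∧
      Run (gexec i ℓ s ins q') (emb i ℓ hs π c) (some s') (emb i ℓ hs π c')) ∨
    (GHaltingConf A0 g c ∧ Run (gexec i ℓ s ins q') (emb i ℓ hs π c) none (emb i ℓ hs π c)) := by
  obtain ⟨q, a, st⟩ := c
  obtain ⟨q1, l, hl⟩ := s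
  obtain ⟨h1, h2⟩ := hr
  dsimp only at h1 h2 hm
  subst h1
  -- a non-test instruction which is not executable
  have halt : (∀ b τ, ins ≠ GInstr.test b τ) → (∀ a' st', ¬ gInstrStep g ins a st a' st') →
      GHaltingConf A0 g (q, a, st) := by
    rintro h3 h4 ⟨q2, a2, st2⟩ ⟨ins2, hm2, h5⟩
    obtain ⟨rfl, _⟩ := gdet_unique hA hm hm2 h3
    exact h4 _ _ h5
  have fin1 : ∀ u : g.V, (fun _ : Fin 1 => u) 0 = u := fun u => rfl
  cases ins with
  | inmove j b =>
    obtain rfl : j = 0 := Subsingleton.elim _ _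
    by_cases h : ∃ u, g.edge b u (a 0)
    · obtain ⟨u, hu⟩ := h
      refine Or.inl ⟨(q', fun _ => u, st), (q', ⟨l, hl⟩), ⟨_, hm, rfl, hu, ?_⟩, ⟨rfl, h2⟩, ?_⟩
      · intro h hh; exact absurd (Subsingleton.elim _ _) hh
      · have t : gTestHolds g (.inedge i b) (emb i ℓ hs π (q, a, st)).1
            (emb i ℓ hs π (q, a, st)).2 := ⟨u, by simpa [emb] using hu⟩
        have m : Run (Prog.op (.inm i b)) (emb i ℓ hs π (q, a, st)) ()
            (emb i ℓ hs π ((q', fun _ => u, st) : GConf A0 g)) := by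
          have := run_inm (X := PB A0.X) (i := i) (a := b) (hs := Function.update hs i (a 0))
            (π := gmap ℓ st ++ π) (u := u) (by simpa using hu)
          simpa [emb] using this
        exact (run_test_t t).bind (m.bind run_pure')
    · refine Or.inr ⟨halt (by simp) (fun a' st' h' => h ⟨_, h'.2.1⟩), ?_⟩
      have t : ¬ gTestHolds g (.inedge i b) (emb i ℓ hs π (q, a, st)).1
            (emb i ℓ hs π (q, a, st)).2 := fun ⟨u, hu⟩ => h ⟨u, by simpa [emb] using hu⟩
      exact (run_test_f t).bind run_pure'
  | outmove j b =>
    obtain rfl : j = 0 := Subsingleton.elim _ _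
    by_cases h : ∃ u, g.edge b (a 0) u
    · obtain ⟨u, hu⟩ := h
      refine Or.inl ⟨(q', fun _ => u, st), (q', ⟨l, hl⟩), ⟨_, hm, rfl, hu, ?_⟩, ⟨rfl, h2⟩, ?_⟩
      · intro h hh; exact absurd (Subsingleton.elim _ _) hh
      · have t : gTestHolds g (.outedge i b) (emb i ℓ hs π (q, a, st)).1
            (emb i ℓ hs π (q, a, st)).2 := ⟨u, by simpa [emb] using hu⟩
        have m : Run (Prog.op (.outm i b)) (emb i ℓ hs π (q, a, st)) ()
            (emb i ℓ hs π ((q', fun _ => u, st) : GConf A0 g)) := by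
          have := run_outm (X := PB A0.X) (i := i) (a := b) (hs := Function.update hs i (a 0))
            (π := gmap ℓ st ++ π) (u := u) (by simpa using hu)
          simpa [emb] using this
        exact (run_test_t t).bind (m.bind run_pure')
    · refine Or.inr ⟨halt (by simp) (fun a' st' h' => h ⟨_, h'.2.1⟩), ?_⟩
      have t : ¬ gTestHolds g (.outedge i b) (emb i ℓ hs π (q, a, st)).1
            (emb i ℓ hs π (q, a, st)).2 := fun ⟨u, hu⟩ => h ⟨u, by simpa [emb] using hu⟩
      exact (run_test_f t).bind run_pure'
  | dropPeb j x =>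
    obtain rfl : j = 0 := Subsingleton.elim _ _
    have hx : x ∈ l ↔ ∃ w, (x, w) ∈ st := by
      rw [← h2]; simp
    by_cases h : x ∈ l
    · right
      refine ⟨halt (by simp) (fun a' st' h' => ?_), ?_⟩
      · obtain ⟨w, hw⟩ := hx.1 h
        exact h'.2.2 w hw
      · simp only [gexec]; rw [dif_pos h]; exact run_pure'
    · left
      have h' : ∀ w, (x, w) ∉ st := fun w hw => h (hx.2 ⟨w, hw⟩)
      refine ⟨(q', a, (x, a 0) :: st), (q', ⟨x :: l, List.nodup_cons.2 ⟨h, hl⟩⟩),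
        ⟨_, hm, rfl, rfl, h'⟩, ⟨rfl, by simp [h2]⟩, ?_⟩
      simp only [gexec]; rw [dif_neg h]
      have m := run_drop (g := g) (i := i) (x := PB.gd ℓ x) (hs := Function.update hs i (a 0))
        (π := gmap ℓ st ++ π) (fun w hw => h' w ((mem_gmap hπ).1 hw))
      refine Run.bind m ?_
      rw [run_pure]
      exact ⟨rfl, by simp [emb, gmap]⟩
  | retrieve x =>
    by_cases h : l.head? = some x
    · left
      cases st with
      | nil => simp only [List.map_nil] at h2; subst h2; simp at h
      | cons p st' =>
        simp only [List.map_cons] at h2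
        subst h2
        simp only [List.head?_cons, Option.some.injEq] at h
        subst h
        refine ⟨(q', a, st'), (q', ⟨_, hl.tail⟩), ⟨_, hm, rfl, p.2, rfl⟩, ⟨rfl, rfl⟩, ?_⟩
        simp only [gexec]
        rw [if_pos (by simp)]
        have m := run_retr (g := g) (x := PB.gd ℓ p.1) (hs := Function.update hs i (a 0))
          (π := gmap ℓ st' ++ π) (w := p.2)
        exact Run.bind m run_pure'
    · right
      refine ⟨halt (by simp) (fun a' st' h' => ?_), ?_⟩
      · obtain ⟨_, w, rfl⟩ := h'
        simp only [List.map_cons] at h2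
        subst h2; simp at h
      · simp only [gexec]; rw [if_neg h]; exact run_pure'
  | jump j x => exact absurd rfl (hJ _ _ _ hm j x)
  | test b τ =>
    classical
    have ht := run_test_dec (trTest i ℓ τ) (emb i ℓ hs π (q, a, st))
    rw [decide_eq_decide.2 (trTest_iff hπ)] at ht
    dsimp only at ht
    set b' := decide (gTestHolds g τ a st) with hb'
    have ht' : gTestHolds g τ a st ↔ b' = true := by simp [hb']
    have hall : ∀ ins2 q2, (q, ins2, q2) ∈ A0.instr → ∃ b2, ins2 = GInstr.test b2 τ := by
      intro ins2 q2 hm2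
      by_cases hc : (GInstr.test b τ, q') = (ins2, q2)
      · exact ⟨b, (congrArg Prod.fst hc).symm⟩
      · rcases hA _ _ _ _ _ hm hm2 hc with ⟨b1, τ1, h3, h4⟩ | ⟨b1, τ1, h3, h4⟩
        · cases h3; exact ⟨_, h4⟩
        · cases h4; exact ⟨_, h3⟩
    by_cases h : ∃ q'', (q, GInstr.test b' τ, q'') ∈ A0.instr
    · left
      refine ⟨(h.choose, a, st), (h.choose, ⟨l, hl⟩), ⟨_, h.choose_spec, rfl, rfl, ht'⟩,
        ⟨rfl, h2⟩, ?_⟩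
      simp only [gexec]
      refine Run.bind ht ?_
      rw [dif_pos h]
      exact run_pure'
    · right
      refine ⟨?_, ?_⟩
      · rintro ⟨q2, a2, st2⟩ ⟨ins2, hm2, h5⟩
        dsimp only at hm2 h5
        obtain ⟨b2, rfl⟩ := hall _ _ hm2
        have h6 := h5.2.2
        have : b2 = b' := by
          rw [ht'] at h6
          exact (Bool.eq_iff_iff.2 h6).symm
        subst this
        exact h ⟨_, hm2⟩
      · simp only [gexec]
        refine Run.bind ht ?_
        rw [dif_neg h]
        exact run_pure'

lemma gstep_spec (hA : GDeterministic A0) (hJ : NoJump A0) {i : Fin k} {ℓ : ℕ} {hs : Fin k → g.V}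
    {π : List (PB A0.X × g.V)} (hπ : OK (ℓ + 1) π) {s : GS A0} {c : GConf A0 g} (hr : Rep s c) :
    (∃ c' s', GStep A0 g c c' ∧ Rep s' c' ∧
      Run (gstep i ℓ s) (emb i ℓ hs π c) (some s') (emb i ℓ hs π c')) ∨
    (GHaltingConf A0 g c ∧ Run (gstep i ℓ s) (emb i ℓ hs π c) none (emb i ℓ hs π c)) := by
  unfold gstep
  split_ifs with h
  · exact gexec_spec hA hJ hπ hr h.choose_spec
  · right
    refine ⟨?_, run_pure'⟩
    rintro c' ⟨ins, hm, _⟩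
    rw [hr.1] at hm
    exact h ⟨(ins, c'.1), hm⟩

/-- Retrieve all guide pebbles. -/
def cleanup (ℓ : ℕ) : List A0.X → PG A0 k Unit
  | [] => .pure ()
  | x :: l => (Prog.op (.retr (.gd ℓ x))).bind fun _ => cleanup ℓ l

lemma run_cleanup {ℓ : ℕ} {hs : Fin k → g.V} {π : List (PB A0.X × g.V)} (l : List A0.X)
    (st : List (A0.X × g.V)) (h : st.map Prod.fst = l) :
    Run (cleanup ℓ l) (hs, gmap ℓ st ++ π) () (hs, π) := by
  induction l generalizing st with
  | nil =>
    have : st = [] := List.map_eq_nil_iff.1 h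
    subst this; exact run_pure'
  | cons x l ih =>
    cases st with
    | nil => simp at h
    | cons p st =>
      simp only [List.map_cons, List.cons.injEq] at h
      obtain ⟨rfl, h⟩ := h
      exact Run.bind run_retr (ih st h)

/-- Simulate the guide at level `ℓ` with head `i`, running `body` on every configuration. -/
noncomputable def gloop {T β : Type} [Finite T] [Finite β] (i : Fin k) (ℓ : ℕ)
    (body : T → PG A0 k (T ⊕ β)) (fin : T → β) (t0 : T) : PG A0 k β :=
  Prog.iter (S := GS A0 × T) (fun st => (body st.2).bind fun r => match r with
    | .inr b => (cleanup ℓ st.1.2.1).bind fun _ => .pure (.inr b)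
    | .inl t' => (gstep i ℓ st.1).bind fun o => match o with
      | some s' => .pure (.inl (s', t'))
      | none => (cleanup ℓ st.1.2.1).bind fun _ => .pure (.inr (fin t')))
    ((A0.q0, ⟨[], List.nodup_nil⟩), t0)

inductive GLRun {T β : Type} (B : T → g.V → (T ⊕ β) → Prop) (fin : T → β) :
    GConf A0 g → T → β → g.V → Prop
  | ending {c t b} : B t (c.2.1 0) (.inr b) → GLRun B fin c t b (c.2.1 0)
  | halt {c t t'} : B t (c.2.1 0) (.inl t') → GHaltingConf A0 g c →
      GLRun B fin c t (fin t') (c.2.1 0)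
  | step {c c' t t' b v} : B t (c.2.1 0) (.inl t') → GStep A0 g c c' → GLRun B fin c' t' b v →
      GLRun B fin c t b v

def gstart (A0 : GWA Sig 1) {g : LGraph Sig} (u : g.V) : GConf A0 g := (A0.q0, fun _ => u, [])

def Vis (A0 : GWA Sig 1) {g : LGraph Sig} (u v : g.V) : Prop :=
  ∃ c : GConf A0 g, ReflTransGen (GStep A0 g) (gstart A0 u) c ∧ c.2.1 0 = v

def GHalts (A0 : GWA Sig 1) {g : LGraph Sig} (u : g.V) : Prop :=
  ∃ c : GConf A0 g, ReflTransGen (GStep A0 g) (gstart A0 u) c ∧ GHaltingConf A0 g c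

lemma gloop_spec (hA : GDeterministic A0) (hJ : NoJump A0) {T β : Type} [Finite T] [Finite β]
    {i : Fin k} {ℓ : ℕ}
    {body : T → PG A0 k (T ⊕ β)} {fin : T → β} {t0 : T} {hs : Fin k → g.V}
    {π : List (PB A0.X × g.V)} (hπ : OK (ℓ + 1) π) (B : T → g.V → (T ⊕ β) → Prop)
    (hbody : ∀ t v π' r s', OK ℓ π' → π <:+ π' → Vis A0 (hs i) v →
      (Run (body t) (Function.update hs i v, π') r s' ↔
        B t v r ∧ s' = (Function.update hs i v, π')))
    {b : β} {s' : Store k (PB A0.X) g} :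
    Run (gloop i ℓ body fin t0) (hs, π) b s' ↔
      ∃ v, GLRun (A0 := A0) B fin (gstart A0 (hs i)) t0 b v ∧ s' = (Function.update hs i v, π) := by
  have h0 : (hs, π) = emb i ℓ hs π (gstart A0 (hs i)) := by simp [emb, gstart, gmap]
  unfold gloop
  rw [run_iter, h0]
  have hb : ∀ (s : GS A0) (c : GConf A0 g) t r s', Rep s c →
      ReflTransGen (GStep A0 g) (gstart A0 (hs i)) c →
      (Run (body t) (emb i ℓ hs π c) r s' ↔ B t (c.2.1 0) r ∧ s' = emb i ℓ hs π c) := by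
    intro s c t r s' h1 h2
    refine hbody t (c.2.1 0) _ r s' (OK.append hπ (by omega) _ ?_) (List.suffix_append _ _)
      ⟨c, h2, rfl⟩
    rw [h1.2]; exact s.2.2
  have hclean : ∀ (s : GS A0) (c : GConf A0 g), Rep s c →
      Run (cleanup (k := k) ℓ s.2.1) (emb i ℓ hs π c) () (Function.update hs i (c.2.1 0), π) := by
    intro s c h1
    exact run_cleanup _ _ h1.2
  constructor
  · intro h
    have key : ∀ (c : GConf A0 g) (s : GS A0) (t : T) (st : GS A0 × T) (S0 : Store k (PB A0.X) g),
        IterRun (fun st : GS A0 × T => (body st.2).bind fun r => match r with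
          | .inr b => (cleanup ℓ st.1.2.1).bind fun _ => .pure (.inr b)
          | .inl t' => (gstep i ℓ st.1).bind fun o => match o with
            | some s' => .pure (.inl (s', t'))
            | none => (cleanup ℓ st.1.2.1).bind fun _ => .pure (.inr (fin t'))) g st S0 b s' →
        st = (s, t) → S0 = emb i ℓ hs π c → Rep s c →
        ReflTransGen (GStep A0 g) (gstart A0 (hs i)) c →
        ∃ v, GLRun (A0 := A0) B fin c t b v ∧ s' = (Function.update hs i v, π) := by
      intro c s t st S0 hI
      clear h
      induction hI generalizing c s t with
      | done hrun =>
        rintro rfl rfl hrep hreach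
        obtain ⟨r, s1, h1, h2⟩ := run_bind.1 hrun
        obtain ⟨hB, rfl⟩ := (hb s c t r s1 hrep hreach).1 h1
        rcases r with t' | b'
        · dsimp only at h2
          rcases gstep_spec (i := i) (hs := hs) hA hJ hπ hrep with
            ⟨c', s2, h3, h4, h5⟩ | ⟨h3, h5⟩
          · rw [h5.bind_iff] at h2
            obtain ⟨h6, _⟩ := run_pure.1 h2
            cases h6
          · rw [h5.bind_iff] at h2
            dsimp only at h2
            rw [(hclean s c hrep).bind_iff] at h2
            obtain ⟨h6, rfl⟩ := run_pure.1 h2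
            cases h6
            exact ⟨_, .halt hB h3, rfl⟩
        · dsimp only at h2
          rw [(hclean s c hrep).bind_iff] at h2
          obtain ⟨h6, rfl⟩ := run_pure.1 h2
          cases h6
          exact ⟨_, .ending hB, rfl⟩
      | more hrun _ ih =>
        rintro rfl rfl hrep hreach
        obtain ⟨r, s1, h1, h2⟩ := run_bind.1 hrun
        obtain ⟨hB, rfl⟩ := (hb s c t r s1 hrep hreach).1 h1
        rcases r with t' | b'
        · dsimp only at h2
          rcases gstep_spec (i := i) (hs := hs) hA hJ hπ hrep with
            ⟨c', s2, h3, h4, h5⟩ | ⟨h3, h5⟩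
          · rw [h5.bind_iff] at h2
            obtain ⟨h6, rfl⟩ := run_pure.1 h2
            cases h6
            obtain ⟨v, h7, h8⟩ := ih c' s2 t' rfl rfl h4 (hreach.tail h3)
            exact ⟨v, .step hB h3 h7, h8⟩
          · rw [h5.bind_iff] at h2
            dsimp only at h2
            rw [(hclean s c hrep).bind_iff] at h2
            obtain ⟨h6, rfl⟩ := run_pure.1 h2
            cases h6
        · dsimp only at h2
          rw [(hclean s c hrep).bind_iff] at h2
          obtain ⟨h6, rfl⟩ := run_pure.1 h2
          cases h6
    exact key _ _ _ _ _ h rfl rfl ⟨rfl, rfl⟩ .refl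
  · rintro ⟨v, hG, rfl⟩
    have key : ∀ (c : GConf A0 g) (t : T), GLRun (A0 := A0) B fin c t b v → ∀ s : GS A0, Rep s c →
        ReflTransGen (GStep A0 g) (gstart A0 (hs i)) c →
        IterRun (fun st : GS A0 × T => (body st.2).bind fun r => match r with
          | .inr b => (cleanup ℓ st.1.2.1).bind fun _ => .pure (.inr b)
          | .inl t' => (gstep i ℓ st.1).bind fun o => match o with
            | some s' => .pure (.inl (s', t'))
            | none => (cleanup ℓ st.1.2.1).bind fun _ => .pure (.inr (fin t'))) g (s, t)
          (emb i ℓ hs π c) b (Function.update hs i v, π) := by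
      intro c t h
      clear hG
      induction h with
      | ending hB =>
        intro s hrep hreach
        exact .done (Run.bind ((hb s _ _ _ _ hrep hreach).2 ⟨hB, rfl⟩)
          (Run.bind (hclean s _ hrep) run_pure'))
      | halt hB hH =>
        intro s hrep hreach
        refine .done (Run.bind ((hb s _ _ _ _ hrep hreach).2 ⟨hB, rfl⟩) ?_)
        rcases gstep_spec (i := i) (hs := hs) hA hJ hπ hrep with
            ⟨c', s2, h3, h4, h5⟩ | ⟨h3, h5⟩
        · exact absurd h3 (hH _)
        · exact Run.bind h5 (Run.bind (hclean s _ hrep) run_pure')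
      | step hB hS _ ih =>
        intro s hrep hreach
        rcases gstep_spec (i := i) (hs := hs) hA hJ hπ hrep with
            ⟨c', s2, h3, h4, h5⟩ | ⟨h3, h5⟩
        · obtain rfl := GStep_det hA hJ hS h3
          refine .more (Run.bind ((hb s _ _ _ _ hrep hreach).2 ⟨hB, rfl⟩) (Run.bind h5 run_pure'))
            (ih s2 h4 (hreach.tail hS))
        · exact absurd hS (h3 _)
    exact key _ _ hG _ ⟨rfl, rfl⟩ .refl

end Guide
end NestedPebblesGraphs

namespace NestedPebblesGraphs
open Relation

section Search
variable {Sig : Type} {k : ℕ} {A0 : GWA Sig 1} {g : LGraph Sig}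

/-! ### The sequence of guide configurations -/

open Classical in
noncomputable def nconf (c : GConf A0 g) : GConf A0 g :=
  if h : ∃ d, GStep A0 g c d then h.choose else c

lemma nconf_step {c d : GConf A0 g} (hA : GDeterministic A0) (hJ : NoJump A0)
    (h : GStep A0 g c d) : nconf c = d := by
  have h' : ∃ d, GStep A0 g c d := ⟨d, h⟩
  unfold nconf
  rw [dif_pos h']
  exact GStep_det hA hJ h'.choose_spec h

lemma nconf_halt {c : GConf A0 g} (h : ¬ ∃ d, GStep A0 g c d) : nconf c = c := by
  unfold nconf
  rw [dif_neg h]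

lemma iter_of_rtg (hA : GDeterministic A0) (hJ : NoJump A0) {c d : GConf A0 g}
    (h : ReflTransGen (GStep A0 g) c d) : ∃ j, nconf^[j] c = d := by
  induction h with
  | refl => exact ⟨0, rfl⟩
  | tail _ h2 ih =>
    obtain ⟨j, rfl⟩ := ih
    exact ⟨j + 1, by rw [Function.iterate_succ_apply', nconf_step hA hJ h2]⟩

/-- Body relation of a loop which stops according to `p`. -/
def BP {β : Type} (p : g.V → Option β) (_ : Unit) (v : g.V) (r : Unit ⊕ β) : Prop :=
  r = match p v with
    | some b => .inr b
    | none => .inl ()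

lemma glrun_some {β : Type} {p : g.V → Option β} {fin : Unit → β} {b : β} (j : ℕ)
    (c : GConf A0 g) (hj : p ((nconf^[j] c).2.1 0) = some b)
    (hmin : ∀ i < j, p ((nconf^[i] c).2.1 0) = none) :
    GLRun (A0 := A0) (BP p) fin c () b ((nconf^[j] c).2.1 0) := by
  induction j generalizing c with
  | zero =>
    refine .ending ?_
    simp only [Function.iterate_zero, id_eq] at hj
    simp [BP, hj]
  | succ j ih =>
    have h0 := hmin 0 (by omega)
    simp only [Function.iterate_zero, id_eq] at h0
    by_cases h : ∃ d, GStep A0 g c d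
    · have hs : GStep A0 g c (nconf c) := by
        unfold nconf; rw [dif_pos h]; exact h.choose_spec
      rw [Function.iterate_succ_apply] at hj ⊢
      refine .step (t' := ()) (by simp [BP, h0]) hs (ih _ hj ?_)
      intro i hi
      have := hmin (i + 1) (by omega)
      rwa [Function.iterate_succ_apply] at this
    · exfalso
      have := nconf_halt h
      rw [Function.iterate_fixed this, h0] at hj
      cases hj

lemma glrun_none {β : Type} {p : g.V → Option β} {fin : Unit → β}
    {c d : GConf A0 g} (h : ReflTransGen (GStep A0 g) c d) (hd : GHaltingConf A0 g d)
    (hp : ∀ e, ReflTransGen (GStep A0 g) c e → p (e.2.1 0) = none) :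
    ∃ v, GLRun (A0 := A0) (BP p) fin c () (fin ()) v := by
  induction h using ReflTransGen.head_induction_on with
  | refl => exact ⟨_, .halt (t' := ()) (by simp [BP, hp _ .refl]) hd⟩
  | head h1 _ ih =>
    obtain ⟨v, hv⟩ := ih (fun e he => hp e (.head h1 he))
    exact ⟨v, .step (t' := ()) (by simp [BP, hp _ .refl]) h1 hv⟩

lemma glrun_inv {β : Type} {p : g.V → Option β} {fin : Unit → β} {b : β} {v : g.V} {t : Unit}
    {c : GConf A0 g} (h : GLRun (A0 := A0) (BP p) fin c t b v) (hb : b ≠ fin ()) :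
    p v = some b ∧ ∃ d, ReflTransGen (GStep A0 g) c d ∧ d.2.1 0 = v := by
  induction h with
  | @ending c t b hB =>
    refine ⟨?_, c, .refl, rfl⟩
    unfold BP at hB
    cases hp : p (c.2.1 0) <;> simp_all
  | halt => exact absurd rfl hb
  | step _ h2 _ ih =>
    obtain ⟨h3, d, h4, h5⟩ := ih hb
    exact ⟨h3, d, .head h2 h4, h5⟩

/-! ### Finding a pebble -/

open Classical in
noncomputable def findP (i : Fin k) (x : PB A0.X) : PG A0 k Bool :=
  gloop i 0 (fun _ : Unit => (Prog.test (.peb i x)).bind fun b =>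
    .pure (if b then .inr true else .inl ())) (fun _ => false) ()

noncomputable def jump (i : Fin k) (x : PB A0.X) : PG A0 k Unit :=
  (findP i x).bind fun b => if b then .pure () else .abort

open Classical in
lemma run_findP (hA : GDeterministic A0) (hJ : NoJump A0) {i : Fin k} {x : PB A0.X}
    {hs : Fin k → g.V} {π : List (PB A0.X × g.V)} (hπ : OK 1 π) {w : g.V} (hw : (x, w) ∈ π)
    {b : Bool} {s' : Store k (PB A0.X) g} :
    Run (findP i x) (hs, π) b s' ↔
    ∃ v, GLRun (A0 := A0) (BP (fun v => if v = w then some true else none)) (fun _ => false)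
      (gstart A0 (hs i)) () b v ∧ s' = (Function.update hs i v, π) := by
  unfold findP
  refine gloop_spec hA hJ hπ _ ?_
  intro t v π' r s' hπ' hsuf _
  have hm : (x, v) ∈ π' ↔ v = w :=
    ⟨fun h => hπ'.uniq h (hsuf.subset hw), fun h => h ▸ hsuf.subset hw⟩
  by_cases h : v = w
  · have t : gTestHolds g (.peb i x) (Function.update hs i v) π' := by
      simp only [gTestHolds, Function.update_self]; exact hm.2 h
    have := run_test_t (s := (Function.update hs i v, π')) t
    rw [this.bind_iff, run_pure]
    simp [BP, h]
  · have t : ¬ gTestHolds g (.peb i x) (Function.update hs i v) π' := by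
      simp only [gTestHolds, Function.update_self]; exact fun h' => h (hm.1 h')
    have := run_test_f (s := (Function.update hs i v, π')) t
    rw [this.bind_iff, run_pure]
    simp [BP, h]

lemma run_jump_iff (hA : GDeterministic A0) (hJ : NoJump A0) {i : Fin k} {x : PB A0.X}
    {hs : Fin k → g.V} {π : List (PB A0.X × g.V)} (hπ : OK 1 π) {w : g.V} (hw : (x, w) ∈ π)
    {b : Unit} {s' : Store k (PB A0.X) g} :
    Run (jump i x) (hs, π) b s' ↔ Vis A0 (hs i) w ∧ s' = (Function.update hs i w, π) := by
  classical
  unfold jump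
  constructor
  · intro h
    obtain ⟨r, s1, h1, h2⟩ := run_bind.1 h
    cases r with
    | false => exact absurd h2 run_abort
    | true =>
      obtain ⟨v, h3, rfl⟩ := (run_findP hA hJ hπ hw).1 h1
      obtain ⟨_, rfl⟩ := run_pure.1 h2
      obtain ⟨h4, d, h5, h6⟩ := glrun_inv h3 (by simp)
      have : v = w := by by_contra hne; simp [hne] at h4
      subst this
      exact ⟨⟨d, h5, h6⟩, rfl⟩
  · rintro ⟨⟨d, h1, h2⟩, rfl⟩
    have hex : ∃ j, ((nconf^[j] (gstart A0 (hs i))).2.1 0) = w := by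
      obtain ⟨j, rfl⟩ := iter_of_rtg hA hJ h1
      exact ⟨j, h2⟩
    have h3 : Run (findP i x) (hs, π) true (Function.update hs i w, π) := by
      refine (run_findP hA hJ hπ hw).2 ⟨w, ?_, rfl⟩
      have := glrun_some (p := fun v => if v = w then some true else none)
        (fin := fun _ => false) (b := true) (Nat.find hex) (gstart A0 (hs i))
        (by simp [Nat.find_spec hex]) (fun i hi => by simp [Nat.find_min hex hi])
      rwa [Nat.find_spec hex] at this
    exact Run.bind h3 run_pure'

/-! ### Running a check everywhere -/

noncomputable def walk (i : Fin k) (ℓ : ℕ) (body : PG A0 k Unit) : PG A0 k Unit :=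
  gloop i ℓ (fun _ : Unit => body.bind fun _ => .pure (.inl ())) (fun _ => ()) ()

lemma glrun_walk (hA : GDeterministic A0) (hJ : NoJump A0) {C : g.V → Prop} {c : GConf A0 g} :
    (∃ v, GLRun (A0 := A0) (fun (_ : Unit) v (r : Unit ⊕ Unit) => C v ∧ r = .inl ())
      (fun _ => ()) c () () v) ↔
    (∃ d, ReflTransGen (GStep A0 g) c d ∧ GHaltingConf A0 g d) ∧
      ∀ d, ReflTransGen (GStep A0 g) c d → C (d.2.1 0) := by
  constructor
  · rintro ⟨v, h⟩
    have key : ∀ (t b : Unit), GLRun (A0 := A0) (fun (_ : Unit) v (r : Unit ⊕ Unit) =>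
        C v ∧ r = .inl ()) (fun _ => ()) c t b v →
        (∃ d, ReflTransGen (GStep A0 g) c d ∧ GHaltingConf A0 g d) ∧
        ∀ d, ReflTransGen (GStep A0 g) c d → C (d.2.1 0) := ?_
    · exact key _ _ h
    clear h
    intro t b h
    induction h with
    | ending hB => exact absurd hB.2 (by simp)
    | @halt c _ _ hB hH =>
      refine ⟨⟨c, .refl, hH⟩, fun d hd => ?_⟩
      rcases ReflTransGen.cases_head hd with rfl | ⟨e, he, _⟩
      · exact hB.1
      · exact absurd he (hH _)
    | step hB hS _ ih =>
      obtain ⟨⟨d, h1, h2⟩, h3⟩ := ih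
      refine ⟨⟨d, .head hS h1, h2⟩, fun d hd => ?_⟩
      rcases ReflTransGen.cases_head hd with rfl | ⟨e, he, h4⟩
      · exact hB.1
      · obtain rfl := GStep_det hA hJ hS he
        exact h3 _ h4
  · rintro ⟨⟨d, h1, h2⟩, h3⟩
    induction h1 using ReflTransGen.head_induction_on with
    | refl => exact ⟨_, .halt (t' := ()) ⟨h3 _ .refl, rfl⟩ h2⟩
    | head hS _ ih =>
      obtain ⟨v, hv⟩ := ih (fun e he => h3 e (.head hS he))
      exact ⟨v, .step (t' := ()) ⟨h3 _ .refl, rfl⟩ hS hv⟩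

lemma glrun_vis {T β : Type} {B : T → g.V → (T ⊕ β) → Prop} {fin : T → β} {c : GConf A0 g} {t : T}
    {b : β} {v : g.V} (h : GLRun (A0 := A0) B fin c t b v) :
    ∃ d, ReflTransGen (GStep A0 g) c d ∧ d.2.1 0 = v := by
  induction h with
  | ending => exact ⟨_, .refl, rfl⟩
  | halt => exact ⟨_, .refl, rfl⟩
  | step _ h2 _ ih =>
    obtain ⟨d, h4, h5⟩ := ih
    exact ⟨d, .head h2 h4, h5⟩

/-- The walk visits, and halts, and satisfies `C` everywhere. -/
def WC (A0 : GWA Sig 1) {g : LGraph Sig} (C : g.V → Prop) (u : g.V) : Prop :=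
  GHalts A0 u ∧ ∀ v, Vis A0 u v → C v

lemma run_walk (hA : GDeterministic A0) (hJ : NoJump A0) {i : Fin k} {ℓ : ℕ}
    {body : PG A0 k Unit} {C : g.V → Prop} {hs : Fin k → g.V} {π : List (PB A0.X × g.V)}
    (hπ : OK (ℓ + 1) π)
    (hbody : ∀ v π' r s', OK ℓ π' → π <:+ π' → Vis A0 (hs i) v →
      (Run body (Function.update hs i v, π') r s' ↔ C v ∧ s' = (Function.update hs i v, π'))) :
    (∀ r s', Run (walk i ℓ body) (hs, π) r s' →
      WC A0 C (hs i) ∧ ∃ v, Vis A0 (hs i) v ∧ s' = (Function.update hs i v, π)) ∧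
    (WC A0 C (hs i) →
      ∃ v, Vis A0 (hs i) v ∧ Run (walk i ℓ body) (hs, π) () (Function.update hs i v, π)) := by
  have key : ∀ r s', Run (walk i ℓ body) (hs, π) r s' ↔
      ∃ v, GLRun (A0 := A0) (fun (_ : Unit) v (r : Unit ⊕ Unit) => C v ∧ r = .inl ())
        (fun _ => ()) (gstart A0 (hs i)) () () v ∧ s' = (Function.update hs i v, π) := by
    intro r s'
    unfold walk
    refine gloop_spec hA hJ hπ _ ?_
    intro t v π' r s' h1 h2 h3
    rw [run_bind]
    constructor
    · rintro ⟨a, s1, h4, h5⟩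
      obtain ⟨h6, rfl⟩ := (hbody v π' a s1 h1 h2 h3).1 h4
      obtain ⟨rfl, rfl⟩ := run_pure.1 h5
      exact ⟨⟨h6, rfl⟩, rfl⟩
    · rintro ⟨⟨h4, rfl⟩, rfl⟩
      exact ⟨(), _, (hbody v π' () _ h1 h2 h3).2 ⟨h4, rfl⟩, run_pure'⟩
  have hwc : WC A0 C (hs i) ↔ ∃ v, GLRun (A0 := A0) (fun (_ : Unit) v (r : Unit ⊕ Unit) =>
      C v ∧ r = .inl ()) (fun _ => ()) (gstart A0 (hs i)) () () v := by
    rw [glrun_walk hA hJ]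
    refine and_congr Iff.rfl ⟨?_, ?_⟩
    · intro h d hd; exact h _ ⟨d, hd, rfl⟩
    · rintro h v ⟨d, hd, rfl⟩; exact h _ hd
  refine ⟨fun r s' h => ?_, fun h => ?_⟩
  · obtain ⟨v, h1, h2⟩ := (key r s').1 h
    exact ⟨hwc.2 ⟨v, h1⟩, v, glrun_vis h1, h2⟩
  · obtain ⟨v, hv⟩ := hwc.1 h
    exact ⟨v, glrun_vis hv, (key _ _).2 ⟨v, hv, rfl⟩⟩

/-- The guide works from everywhere. -/
def Good (A0 : GWA Sig 1) (g : LGraph Sig) : Prop :=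
  ∀ u : g.V, GHalts A0 u ∧ ∀ v, Vis A0 u v

lemma run_jump (hA : GDeterministic A0) (hJ : NoJump A0) (hg : Good A0 g) {i : Fin k} {x : PB A0.X}
    {hs : Fin k → g.V} {π : List (PB A0.X × g.V)} (hπ : OK 1 π) {w : g.V} (hw : (x, w) ∈ π) :
    Run (jump i x) (hs, π) () (Function.update hs i w, π) :=
  (run_jump_iff hA hJ hπ hw).2 ⟨(hg _).2 _, rfl⟩

def allP {α : Type} (f : α → PG A0 k Unit) : List α → PG A0 k Unit
  | [] => .pure ()
  | a :: l => (f a).bind fun _ => allP f l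

lemma run_allP {α : Type} {f : α → PG A0 k Unit} {C : α → Prop} {s : Store k (PB A0.X) g}
    (hf : ∀ a r s', Run (f a) s r s' ↔ C a ∧ s' = s) (l : List α) (r : Unit)
    (s' : Store k (PB A0.X) g) : Run (allP f l) s r s' ↔ (∀ a ∈ l, C a) ∧ s' = s := by
  induction l with
  | nil => simp [allP, run_pure]
  | cons a l ih =>
    simp only [allP, run_bind, List.mem_cons, forall_eq_or_imp]
    constructor
    · rintro ⟨_, s1, h1, h2⟩
      obtain ⟨h3, rfl⟩ := (hf _ _ _).1 h1
      obtain ⟨h4, rfl⟩ := ih.1 h2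
      exact ⟨⟨h3, h4⟩, rfl⟩
    · rintro ⟨⟨h1, h2⟩, rfl⟩
      exact ⟨(), _, (hf _ _ _).2 ⟨h1, rfl⟩, ih.2 ⟨h2, rfl⟩⟩

/-- Check that the current node and the node of pebble `tmp 6` can be reached from one another. -/
noncomputable def mutV (i : Fin k) : PG A0 k Unit :=
  (Prog.op (.drop i (.tmp 4))).bind fun _ => (jump i (.tmp 6)).bind fun _ =>
  (jump i (.tmp 4)).bind fun _ => Prog.op (.retr (.tmp 4))

lemma run_mutV (hA : GDeterministic A0) (hJ : NoJump A0) {i : Fin k}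
    {hs : Fin k → g.V} {π : List (PB A0.X × g.V)} (hπ : OK 5 π) {w : g.V} (hw : (.tmp 6, w) ∈ π)
    {r : Unit} {s' : Store k (PB A0.X) g} :
    Run (mutV i) (hs, π) r s' ↔ (Vis A0 (hs i) w ∧ Vis A0 w (hs i)) ∧ s' = (hs, π) := by
  unfold mutV
  have h1 := run_drop (i := i) (x := PB.tmp 4) (hs := hs) (π := π)
    (fun w => hπ.not_mem (by simp [PB.rk]) w)
  have hπ1 : OK 1 ((PB.tmp 4, hs i) :: π) := hπ.cons _ _ (by simp [PB.rk]) (by simp [PB.rk])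
  rw [h1.bind_iff]
  constructor
  · intro h
    obtain ⟨_, s1, h2, h3⟩ := run_bind.1 h
    obtain ⟨h4, rfl⟩ := (run_jump_iff hA hJ hπ1 (List.mem_cons_of_mem _ hw)).1 h2
    obtain ⟨_, s2, h5, h6⟩ := run_bind.1 h3
    obtain ⟨h7, rfl⟩ := (run_jump_iff hA hJ hπ1 List.mem_cons_self).1 h5
    obtain ⟨_, rfl⟩ := run_retr.iff.1 h6
    simp only [Function.update_self] at h7
    exact ⟨⟨h4, h7⟩, by simp⟩
  · rintro ⟨⟨h2, h3⟩, rfl⟩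
    refine Run.bind ((run_jump_iff hA hJ hπ1 (List.mem_cons_of_mem _ hw) (b := ())).2 ⟨h2, rfl⟩) ?_
    refine Run.bind ((run_jump_iff hA hJ hπ1 List.mem_cons_self (b := ())).2
      ⟨by simpa using h3, rfl⟩) ?_
    have := run_retr (x := PB.tmp 4) (w := hs i) (π := π) (hs := hs)
    simpa using this

noncomputable def nbOut (i : Fin k) (a : Sig) : PG A0 k Unit :=
  (Prog.test (.outedge i a)).bind fun b => if b then
    (Prog.op (.outm i a)).bind fun _ => (mutV i).bind fun _ => Prog.op (.inm i a)
  else .pure ()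

noncomputable def nbIn (i : Fin k) (a : Sig) : PG A0 k Unit :=
  (Prog.test (.inedge i a)).bind fun b => if b then
    (Prog.op (.inm i a)).bind fun _ => (mutV i).bind fun _ => Prog.op (.outm i a)
  else .pure ()

lemma run_nbOut (hA : GDeterministic A0) (hJ : NoJump A0) {i : Fin k} {a : Sig}
    {hs : Fin k → g.V} {π : List (PB A0.X × g.V)} (hπ : OK 5 π) {w : g.V} (hw : (.tmp 6, w) ∈ π)
    {r : Unit} {s' : Store k (PB A0.X) g} :
    Run (nbOut i a) (hs, π) r s' ↔
      (∀ z, g.edge a (hs i) z → Vis A0 z w ∧ Vis A0 w z) ∧ s' = (hs, π) := by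
  unfold nbOut
  by_cases h : ∃ z, g.edge a (hs i) z
  · have t := run_test_t (X := PB A0.X) (τ := .outedge i a) (s := (hs, π)) h
    rw [t.bind_iff]
    obtain ⟨z, hz⟩ := h
    simp only [if_true]
    rw [(run_outm hz).bind_iff, run_bind]
    have hall : (∀ z, g.edge a (hs i) z → Vis A0 z w ∧ Vis A0 w z) ↔ Vis A0 z w ∧ Vis A0 w z :=
      ⟨fun h => h z hz, fun h z' hz' => g.out_unique _ _ _ _ hz hz' ▸ h⟩
    rw [hall]
    have back : Run (Prog.op (.inm i a)) (Function.update hs i z, π) () (hs, π) := by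
      have := run_inm (X := PB A0.X) (i := i) (a := a) (hs := Function.update hs i z) (π := π)
        (u := hs i) (by simpa using hz)
      simpa using this
    constructor
    · rintro ⟨_, s1, h1, h2⟩
      obtain ⟨h3, rfl⟩ := (run_mutV hA hJ hπ hw).1 h1
      obtain ⟨_, rfl⟩ := back.iff.1 h2
      exact ⟨by simpa using h3, rfl⟩
    · rintro ⟨h1, rfl⟩
      exact ⟨(), _, (run_mutV hA hJ hπ hw).2 ⟨by simpa using h1, rfl⟩, back⟩
  · have t := run_test_f (X := PB A0.X) (τ := .outedge i a) (s := (hs, π)) h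
    rw [t.bind_iff]
    simp only [Bool.false_eq_true, if_false, run_pure]
    exact ⟨fun h' => ⟨fun z hz => absurd ⟨z, hz⟩ h, h'.2⟩, fun h' => ⟨trivial, h'.2⟩⟩

lemma run_nbIn (hA : GDeterministic A0) (hJ : NoJump A0) {i : Fin k} {a : Sig}
    {hs : Fin k → g.V} {π : List (PB A0.X × g.V)} (hπ : OK 5 π) {w : g.V} (hw : (.tmp 6, w) ∈ π)
    {r : Unit} {s' : Store k (PB A0.X) g} :
    Run (nbIn i a) (hs, π) r s' ↔
      (∀ z, g.edge a z (hs i) → Vis A0 z w ∧ Vis A0 w z) ∧ s' = (hs, π) := by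
  unfold nbIn
  by_cases h : ∃ z, g.edge a z (hs i)
  · have t := run_test_t (X := PB A0.X) (τ := .inedge i a) (s := (hs, π)) h
    rw [t.bind_iff]
    obtain ⟨z, hz⟩ := h
    simp only [if_true]
    rw [(run_inm hz).bind_iff, run_bind]
    have hall : (∀ z, g.edge a z (hs i) → Vis A0 z w ∧ Vis A0 w z) ↔ Vis A0 z w ∧ Vis A0 w z :=
      ⟨fun h => h z hz, fun h z' hz' => g.in_unique _ _ _ _ hz hz' ▸ h⟩
    rw [hall]
    have back : Run (Prog.op (.outm i a)) (Function.update hs i z, π) () (hs, π) := by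
      have := run_outm (X := PB A0.X) (i := i) (a := a) (hs := Function.update hs i z) (π := π)
        (u := hs i) (by simpa using hz)
      simpa using this
    constructor
    · rintro ⟨_, s1, h1, h2⟩
      obtain ⟨h3, rfl⟩ := (run_mutV hA hJ hπ hw).1 h1
      obtain ⟨_, rfl⟩ := back.iff.1 h2
      exact ⟨by simpa using h3, rfl⟩
    · rintro ⟨h1, rfl⟩
      exact ⟨(), _, (run_mutV hA hJ hπ hw).2 ⟨by simpa using h1, rfl⟩, back⟩
  · have t := run_test_f (X := PB A0.X) (τ := .inedge i a) (s := (hs, π)) h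
    rw [t.bind_iff]
    simp only [Bool.false_eq_true, if_false, run_pure]
    exact ⟨fun h' => ⟨fun z hz => absurd ⟨z, hz⟩ h, h'.2⟩, fun h' => ⟨trivial, h'.2⟩⟩

noncomputable def nbAll [Fintype Sig] (i : Fin k) : PG A0 k Unit :=
  allP (fun a : Sig => (nbOut i a).bind fun _ => nbIn i a) Finset.univ.toList

/-- All neighbours of `w` are mutually reachable with `v`. -/
def NbC (A0 : GWA Sig 1) {g : LGraph Sig} (v w : g.V) : Prop :=
  ∀ a : Sig, (∀ z, g.edge a w z → Vis A0 z v ∧ Vis A0 v z) ∧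
    (∀ z, g.edge a z w → Vis A0 z v ∧ Vis A0 v z)

lemma run_nbAll [Fintype Sig] (hA : GDeterministic A0) (hJ : NoJump A0) {i : Fin k}
    {hs : Fin k → g.V} {π : List (PB A0.X × g.V)} (hπ : OK 5 π) {w : g.V} (hw : (.tmp 6, w) ∈ π)
    {r : Unit} {s' : Store k (PB A0.X) g} :
    Run (nbAll i) (hs, π) r s' ↔ NbC A0 w (hs i) ∧ s' = (hs, π) := by
  unfold nbAll
  rw [run_allP (C := fun a => (∀ z, g.edge a (hs i) z → Vis A0 z w ∧ Vis A0 w z) ∧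
    (∀ z, g.edge a z (hs i) → Vis A0 z w ∧ Vis A0 w z))]
  · simp [NbC]
  · intro a r s'
    rw [run_bind]
    constructor
    · rintro ⟨_, s1, h1, h2⟩
      obtain ⟨h3, rfl⟩ := (run_nbOut hA hJ hπ hw).1 h1
      obtain ⟨h4, rfl⟩ := (run_nbIn hA hJ hπ hw).1 h2
      exact ⟨⟨h3, h4⟩, rfl⟩
    · rintro ⟨⟨h1, h2⟩, rfl⟩
      exact ⟨(), _, (run_nbOut hA hJ hπ hw).2 ⟨h1, rfl⟩, (run_nbIn hA hJ hπ hw).2 ⟨h2, rfl⟩⟩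

lemma Vis.rfl' {u : g.V} : Vis A0 u u := ⟨_, .refl, rfl⟩

lemma wc_all {v : g.V} (h : WC A0 (NbC A0 v) v) : ∀ w, Vis A0 v w ∧ Vis A0 w v := by
  intro w
  induction g.conn v w with
  | refl => exact ⟨Vis.rfl', Vis.rfl'⟩
  | tail _ h2 ih =>
    rcases h2 with ⟨a, h2⟩ | ⟨a, h2⟩
    · exact ((h.2 _ ih.1 a).1 _ h2).symm
    · exact ((h.2 _ ih.1 a).2 _ h2).symm

noncomputable def checkOne [Fintype Sig] (i : Fin k) : PG A0 k Unit :=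
  (Prog.op (.drop i (.tmp 6))).bind fun _ => (walk i 5 (nbAll i)).bind fun _ =>
  (jump i (.tmp 6)).bind fun _ => Prog.op (.retr (.tmp 6))

lemma run_checkOne [Fintype Sig] (hA : GDeterministic A0) (hJ : NoJump A0) {i : Fin k}
    {hs : Fin k → g.V} {π : List (PB A0.X × g.V)} (hπ : OK 7 π)
    {r : Unit} {s' : Store k (PB A0.X) g} :
    Run (checkOne i) (hs, π) r s' ↔ WC A0 (NbC A0 (hs i)) (hs i) ∧ s' = (hs, π) := by
  unfold checkOne
  have h1 := run_drop (i := i) (x := PB.tmp 6) (hs := hs) (π := π)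
    (fun w => hπ.not_mem (by simp [PB.rk]) w)
  have hπ1 : OK 6 ((PB.tmp 6, hs i) :: π) := hπ.cons _ _ (by simp [PB.rk]) (by simp [PB.rk])
  rw [h1.bind_iff]
  have hW := run_walk (i := i) (ℓ := 5) (body := nbAll i) (C := NbC A0 (hs i)) (hs := hs)
    (π := (PB.tmp 6, hs i) :: π) hA hJ hπ1 (fun v π' r s' h2 h3 _ => by
      rw [run_nbAll hA hJ h2 (h3.subset List.mem_cons_self)]
      simp)
  constructor
  · intro h
    obtain ⟨_, s1, h2, h3⟩ := run_bind.1 h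
    obtain ⟨h4, v, _, rfl⟩ := hW.1 _ _ h2
    obtain ⟨_, s2, h5, h6⟩ := run_bind.1 h3
    obtain ⟨h7, rfl⟩ := (run_jump_iff hA hJ (hπ1.mono (by omega)) List.mem_cons_self).1 h5
    obtain ⟨_, rfl⟩ := run_retr.iff.1 h6
    exact ⟨h4, by simp⟩
  · rintro ⟨h2, rfl⟩
    obtain ⟨v, hv, h3⟩ := hW.2 h2
    refine Run.bind h3 ?_
    refine Run.bind ((run_jump_iff hA hJ (hπ1.mono (by omega)) List.mem_cons_self (b := ())).2
      ⟨by simpa using (wc_all h2 v).2, rfl⟩) ?_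
    have := run_retr (x := PB.tmp 6) (w := hs i) (π := π) (hs := hs)
    simpa using this

noncomputable def check [Fintype Sig] (i : Fin k) : PG A0 k Unit := walk i 7 (checkOne i)

lemma run_check [Fintype Sig] (hA : GDeterministic A0) (hJ : NoJump A0) {i : Fin k}
    {hs : Fin k → g.V} {π : List (PB A0.X × g.V)} (hπ : OK 8 π) :
    (∀ r s', Run (check i) (hs, π) r s' → Good A0 g ∧ ∃ v, s' = (Function.update hs i v, π)) ∧
    (Good A0 g → ∃ v, Run (check i) (hs, π) () (Function.update hs i v, π)) := by
  have hW := run_walk (i := i) (ℓ := 7) (body := checkOne i)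
    (C := fun v : g.V => WC A0 (NbC A0 v) v) (hs := hs) (π := π) hA hJ hπ
    (fun v π' r s' h2 h3 _ => by rw [run_checkOne hA hJ h2]; simp)
  refine ⟨fun r s' h => ?_, fun h => ?_⟩
  · obtain ⟨h1, v, _, h2⟩ := hW.1 r s' h
    refine ⟨fun u => ?_, v, h2⟩
    have h3 := wc_all (h1.2 _ Vis.rfl')
    have h4 := h1.2 u (h3 u).1
    exact ⟨h4.1, fun v => (wc_all h4 v).1⟩
  · obtain ⟨v, _, h1⟩ := hW.2 ⟨(h _).1, fun v _ => ⟨(h _).1, fun w _ a =>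
      ⟨fun z _ => ⟨(h _).2 _, (h _).2 _⟩, fun z _ => ⟨(h _).2 _, (h _).2 _⟩⟩⟩⟩
    exact ⟨v, h1⟩

end Search
end NestedPebblesGraphs

namespace NestedPebblesGraphs
open Relation

section Next
variable {Sig : Type} {k : ℕ} {A0 : GWA Sig 1} {g : LGraph Sig}

/-- Node visited at time `j`. -/
noncomputable def posAt (A0 : GWA Sig 1) {g : LGraph Sig} (o : g.V) (j : ℕ) : g.V :=
  (nconf^[j] (gstart A0 o)).2.1 0

lemma exists_posAt (hA : GDeterministic A0) (hJ : NoJump A0) (hg : Good A0 g) (o v : g.V) :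
    ∃ j, posAt A0 o j = v := by
  obtain ⟨d, h1, h2⟩ := (hg o).2 v
  obtain ⟨j, rfl⟩ := iter_of_rtg hA hJ h1
  exact ⟨j, h2⟩

open Classical in
/-- Time of the first visit. -/
noncomputable def idx (A0 : GWA Sig 1) {g : LGraph Sig} (o v : g.V) : ℕ :=
  if h : ∃ j, posAt A0 o j = v then Nat.find h else 0

lemma idx_spec (hA : GDeterministic A0) (hJ : NoJump A0) (hg : Good A0 g) (o v : g.V) :
    posAt A0 o (idx A0 o v) = v := by
  classical
  have h := exists_posAt hA hJ hg o v
  unfold idx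
  rw [dif_pos h]
  exact Nat.find_spec h

lemma idx_le {o : g.V} (j : ℕ) : idx A0 o (posAt A0 o j) ≤ j := by
  classical
  have h : ∃ j', posAt A0 o j' = posAt A0 o j := ⟨j, rfl⟩
  unfold idx
  rw [dif_pos h]
  exact Nat.find_min' h rfl

lemma idx_min {o v : g.V} {j : ℕ} (h : j < idx A0 o v) : posAt A0 o j ≠ v := by
  rintro rfl
  have := idx_le (A0 := A0) (o := o) j
  omega

lemma idx_inj (hA : GDeterministic A0) (hJ : NoJump A0) (hg : Good A0 g) (o : g.V) :
    Function.Injective (idx A0 o) := by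
  intro v w h
  rw [← idx_spec hA hJ hg o v, h, idx_spec hA hJ hg]

open Classical in
/-- Which of the pebbles `x` and `y` is visited first (`true` for `x`)? -/
noncomputable def find2 (i : Fin k) (x y : PB A0.X) : PG A0 k Bool :=
  gloop i 0 (fun _ : Unit => (Prog.test (.peb i y)).bind fun b =>
    if b then .pure (.inr false) else (Prog.test (.peb i x)).bind fun b =>
    .pure (if b then .inr true else .inl ())) (fun _ => false) ()

open Classical in
lemma run_find2 (hA : GDeterministic A0) (hJ : NoJump A0) (hg : Good A0 g)
    {i : Fin k} {x y : PB A0.X}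
    {hs : Fin k → g.V} {π : List (PB A0.X × g.V)} (hπ : OK 1 π) {v w : g.V} (hv : (x, v) ∈ π)
    (hw : (y, w) ∈ π) :
    ∃ z, Run (find2 i x y) (hs, π) (decide (idx A0 (hs i) v < idx A0 (hs i) w))
      (Function.update hs i z, π) := by
  set p : g.V → Option Bool := fun z => if z = w then some false else if z = v then some true
    else none with hp
  have key : ∀ b s', Run (find2 i x y) (hs, π) b s' ↔
      ∃ z, GLRun (A0 := A0) (BP p) (fun _ => false)
      (gstart A0 (hs i)) () b z ∧ s' = (Function.update hs i z, π) := by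
    intro b s'
    unfold find2
    refine gloop_spec hA hJ hπ _ ?_
    intro t z π' r s' hπ' hsuf _
    have hm1 : gTestHolds g (.peb i x) (Function.update hs i z) π' ↔ z = v := by
      simp only [gTestHolds, Function.update_self]
      exact ⟨fun h => hπ'.uniq h (hsuf.subset hv), fun h => h ▸ hsuf.subset hv⟩
    have hm2 : gTestHolds g (.peb i y) (Function.update hs i z) π' ↔ z = w := by
      simp only [gTestHolds, Function.update_self]
      exact ⟨fun h => hπ'.uniq h (hsuf.subset hw), fun h => h ▸ hsuf.subset hw⟩
    by_cases h : z = w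
    · rw [(run_test_t (s := (Function.update hs i z, π')) (hm2.2 h)).bind_iff]
      simp [run_pure, BP, hp, h]
    · rw [(run_test_f (s := (Function.update hs i z, π')) (fun h' => h (hm2.1 h'))).bind_iff]
      simp only [Bool.false_eq_true, if_false]
      by_cases h2 : z = v
      · rw [(run_test_t (s := (Function.update hs i z, π')) (hm1.2 h2)).bind_iff]
        have h3 : ¬ v = w := h2 ▸ h
        simp [run_pure, BP, hp, h2, h3]
      · rw [(run_test_f (s := (Function.update hs i z, π')) (fun h' => h2 (hm1.1 h'))).bind_iff]
        simp [run_pure, BP, hp, h2, h]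
  by_cases hlt : idx A0 (hs i) v < idx A0 (hs i) w
  · simp only [hlt, decide_true]
    have hvw : v ≠ w := by rintro rfl; omega
    refine ⟨_, (key _ _).2 ⟨_, glrun_some (idx A0 (hs i) v) _ ?_ ?_, rfl⟩⟩
    · have := idx_spec hA hJ hg (hs i) v
      unfold posAt at this
      rw [this]; simp [hp, hvw]
    · intro j hj
      have h1 := idx_min hj
      have h2 := idx_min (hj.trans hlt)
      unfold posAt at h1 h2
      simp [hp, h1, h2]
  · simp only [hlt, decide_false]
    refine ⟨_, (key _ _).2 ⟨_, glrun_some (idx A0 (hs i) w) _ ?_ ?_, rfl⟩⟩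
    · have := idx_spec hA hJ hg (hs i) w
      unfold posAt at this
      rw [this]; simp [hp]
    · intro j hj
      have h1 := idx_min hj
      have h2 := idx_min (v := v) (lt_of_lt_of_le hj (not_lt.1 hlt))
      unfold posAt at h1 h2
      simp [hp, h1, h2]

noncomputable def nextBody (i : Fin k) : PG A0 k (Unit ⊕ Bool) :=
  (Prog.op (.drop i (.tmp 1))).bind fun _ => (jump i .org).bind fun _ =>
  (find2 i (.tmp 3) (.tmp 1)).bind fun f => (jump i (.tmp 1)).bind fun _ =>
  (Prog.op (.retr (.tmp 1))).bind fun _ => .pure (if f then .inr true else .inl ())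

/-- Move head `i` to the next node in the order of first visits from the origin; return `false`
(and move to the origin) if there is none. -/
noncomputable def nextN (i : Fin k) : PG A0 k Bool :=
  (Prog.op (.drop i (.tmp 3))).bind fun _ => (jump i .org).bind fun _ =>
  (gloop i 2 (fun _ : Unit => nextBody i) (fun _ => false) ()).bind fun b =>
  (Prog.op (.retr (.tmp 3))).bind fun _ =>
  if b then .pure true else (jump i .org).bind fun _ => .pure false

open Classical in
lemma run_nextBody (hA : GDeterministic A0) (hJ : NoJump A0) (hg : Good A0 g)
    {i : Fin k} {hs : Fin k → g.V} {π : List (PB A0.X × g.V)} (hπ : OK 2 π) {o v : g.V}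
    (ho : (.org, o) ∈ π) (hv : (.tmp 3, v) ∈ π) :
    Run (nextBody i) (hs, π) (if idx A0 o v < idx A0 o (hs i) then .inr true else .inl ())
      (hs, π) := by
  unfold nextBody
  have h1 := run_drop (i := i) (x := PB.tmp 1) (hs := hs) (π := π)
    (fun w => hπ.not_mem (by simp [PB.rk]) w)
  have hπ1 : OK 1 ((PB.tmp 1, hs i) :: π) := hπ.cons _ _ (by simp [PB.rk]) (by simp [PB.rk])
  refine Run.bind h1 ?_
  refine Run.bind (run_jump hA hJ hg hπ1 (List.mem_cons_of_mem _ ho)) ?_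
  obtain ⟨z, hz⟩ := run_find2 (i := i) (hs := Function.update hs i o) hA hJ hg hπ1
    (List.mem_cons_of_mem _ hv) List.mem_cons_self
  refine Run.bind hz ?_
  refine Run.bind (run_jump hA hJ hg hπ1 List.mem_cons_self) ?_
  refine Run.bind run_retr ?_
  rw [run_pure]
  simp

lemma run_nextN (hA : GDeterministic A0) (hJ : NoJump A0) (hg : Good A0 g)
    {i : Fin k} {hs : Fin k → g.V} {π : List (PB A0.X × g.V)} (hπ : OK 4 π) {o : g.V}
    (ho : (.org, o) ∈ π) :
    (∀ w, idx A0 o (hs i) < idx A0 o w →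
      (∀ w', idx A0 o (hs i) < idx A0 o w' → idx A0 o w ≤ idx A0 o w') →
      Run (nextN i) (hs, π) true (Function.update hs i w, π)) ∧
    ((∀ w, ¬ idx A0 o (hs i) < idx A0 o w) →
      Run (nextN i) (hs, π) false (Function.update hs i o, π)) := by
  classical
  set v := hs i with hvdef
  have h1 := run_drop (i := i) (x := PB.tmp 3) (hs := hs) (π := π)
    (fun w => hπ.not_mem (by simp [PB.rk]) w)
  have hπ1 : OK 3 ((PB.tmp 3, hs i) :: π) := hπ.cons _ _ (by simp [PB.rk]) (by simp [PB.rk])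
  have h2 := run_jump (i := i) (hs := hs) hA hJ hg (hπ1.mono (by omega))
    (List.mem_cons_of_mem _ ho)
  set p : g.V → Option Bool := fun z => if idx A0 o v < idx A0 o z then some true else none with hp
  have key : ∀ b s', Run (gloop i 2 (fun _ : Unit => nextBody i) (fun _ => false) ())
      (Function.update hs i o, (PB.tmp 3, hs i) :: π) b s' ↔
      ∃ z, GLRun (A0 := A0) (BP p) (fun _ => false) (gstart A0 (Function.update hs i o i)) () b z ∧
        s' = (Function.update (Function.update hs i o) i z, (PB.tmp 3, hs i) :: π) := by
    intro b s'
    refine gloop_spec hA hJ hπ1 _ ?_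
    intro t z π' r s' hπ' hsuf _
    have := run_nextBody (i := i) (hs := Function.update (Function.update hs i o) i z) hA hJ hg hπ'
      (hsuf.subset (List.mem_cons_of_mem _ ho)) (hsuf.subset List.mem_cons_self)
    rw [this.iff]
    have hB : BP p t z r ↔ r = if idx A0 o (hs i) < idx A0 o
        (Function.update (Function.update hs i o) i z i) then Sum.inr true else Sum.inl () := by
      unfold BP
      simp only [hp, Function.update_self, ← hvdef]
      split_ifs <;> rfl
    rw [hB]
  refine ⟨fun w h3 h4 => ?_, fun h3 => ?_⟩
  · refine Run.bind h1 (Run.bind h2 (Run.bind (a := true)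
      ((key _ _).2 ⟨w, ?_, rfl⟩) (Run.bind run_retr ?_)))
    · have hsp := idx_spec hA hJ hg o w
      have := glrun_some (p := p) (fin := fun _ => false) (b := true) (idx A0 o w)
        (gstart A0 (Function.update hs i o i)) ?_ ?_
      · rw [Function.update_self] at this ⊢
        unfold posAt at hsp
        rwa [hsp] at this
      · rw [Function.update_self]
        unfold posAt at hsp
        rw [hsp]; simp [hp, h3]
      · intro j hj
        rw [Function.update_self]
        simp only [hp]
        rw [if_neg]
        intro h5
        have h6 := h4 _ h5
        have h7 := idx_le (A0 := A0) (o := o) j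
        unfold posAt at h7
        omega
    · simp only [if_true]
      rw [run_pure]
      simp
  · obtain ⟨d, hd1, hd2⟩ := (hg o).1
    obtain ⟨z, hz⟩ := glrun_none (p := p) (fin := fun _ => false) hd1 hd2
      (fun e _ => by simp [hp, h3])
    refine Run.bind h1 (Run.bind h2 (Run.bind (a := false)
      ((key _ _).2 ⟨z, by rw [Function.update_self]; exact hz, rfl⟩) (Run.bind run_retr ?_)))
    simp only [Bool.false_eq_true, if_false]
    have := run_jump (i := i) (hs := Function.update (Function.update hs i o) i z) hA hJ hg
      (hπ.mono (by omega)) ho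
    refine Run.bind this ?_
    rw [run_pure]; simp

lemma idx_o {o : g.V} : idx A0 o o = 0 := Nat.le_zero.1 (idx_le (A0 := A0) (o := o) 0)

/-- An enumeration of the nodes starting at `o`, followed by `nextN`. -/
lemma exists_enum (hA : GDeterministic A0) (hJ : NoJump A0) (hg : Good A0 g) (k : ℕ) (o : g.V) :
    ∃ (n : ℕ) (e : g.V ≃ Fin (n + 1)), e o = 0 ∧
      ∀ (i : Fin k) (hs : Fin k → g.V) (π : List (PB A0.X × g.V)), OK 4 π → (.org, o) ∈ π →
        (∀ w, (e w).val = (e (hs i)).val + 1 →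
          Run (nextN i) (hs, π) true (Function.update hs i w, π)) ∧
        ((e (hs i)).val = n → Run (nextN i) (hs, π) false (Function.update hs i o, π)) := by
  classical
  have := g.finV
  have hne := g.neV
  let _ : LinearOrder g.V := LinearOrder.lift' (idx A0 o) (idx_inj hA hJ hg o)
  have hlt : ∀ v w : g.V, v < w ↔ idx A0 o v < idx A0 o w := fun v w => Iff.rfl
  obtain ⟨n, hn⟩ : ∃ n, Fintype.card g.V = n + 1 :=
    ⟨Fintype.card g.V - 1, by have := Fintype.card_pos (α := g.V); omega⟩
  have e0 := (Fintype.orderIsoFinOfCardEq g.V hn).symm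
  refine ⟨n, e0.toEquiv, ?_, ?_⟩
  · have : ∀ v, e0 o ≤ e0 v := fun v => by
      rw [e0.le_iff_le, ← not_lt, hlt, idx_o]; omega
    have h := this (e0.symm 0)
    rw [e0.apply_symm_apply] at h
    exact le_antisymm h (Fin.zero_le _)
  · intro i hs π hπ ho
    obtain ⟨h1, h2⟩ := run_nextN (i := i) (hs := hs) hA hJ hg hπ ho
    refine ⟨fun w hw => h1 w ?_ ?_, fun h => h2 ?_⟩
    · rw [← hlt, ← e0.lt_iff_lt, Fin.lt_def]
      change (e0 w).val = (e0 (hs i)).val + 1 at hw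
      omega
    · intro w' hw'
      change (e0 w).val = (e0 (hs i)).val + 1 at hw
      rw [← hlt, ← e0.lt_iff_lt, Fin.lt_def] at hw'
      rw [← not_lt, ← hlt, ← e0.lt_iff_lt, Fin.lt_def]
      omega
    · intro w hw
      change (e0 (hs i)).val = n at h
      rw [← hlt, ← e0.lt_iff_lt, Fin.lt_def] at hw
      have := (e0 w).isLt
      omega

end Next
end NestedPebblesGraphs

namespace NestedPebblesGraphs
open Relation

section Tour
variable {W : Type} {R : W → W → Prop} {v u : W}

/-- Backward tree of the root `v`. -/
def Chd (R : W → W → Prop) (v : W) (c x : W) : Prop := R c x ∧ c ≠ v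

lemma chd_irrefl (hR : ∀ a b b', R a b → R a b' → b = b') {x : W}
    (h : ReflTransGen (Chd R v) x v) : ¬ TransGen (Chd R v) x x := by
  induction h using ReflTransGen.head_induction_on with
  | refl =>
    intro h
    obtain ⟨y, h1, _⟩ := TransGen.head'_iff.1 h
    exact h1.2 rfl
  | head h1 _ ih =>
    intro h
    obtain ⟨y, h2, h3⟩ := TransGen.head'_iff.1 h
    obtain rfl := hR _ _ _ h1.1 h2.1
    exact ih (TransGen.tail' h3 h1)

lemma rtg_chd_iff : ReflTransGen (Chd R v) u v ↔ ReflTransGen R u v := by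
  constructor
  · intro h; exact ReflTransGen.mono (fun _ _ h => h.1) _ _ h
  · intro h
    induction h using ReflTransGen.head_induction_on with
    | refl => exact .refl
    | @head a _ h1 _ ih =>
      by_cases ha : a = v
      · rw [ha]
      · exact .head ⟨h1, ha⟩ ih

/-- The Euler tour of the backward tree finds `u` if and only if it is there. -/
lemma tour [Finite W] (rank : W → ℕ) (hrank : Function.Injective rank)
    (hR : ∀ a b b', R a b → R a b' → b = b') (Dn Up : W → Bool → Prop)
    (hD1 : Dn u true)
    (hD2 : ∀ x, x ≠ u →
      (∃ c, Chd R v c x ∧ (∀ c', Chd R v c' x → rank c ≤ rank c') ∧ ∀ b, Dn c b → Dn x b) ∨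
      ((∀ c, ¬ Chd R v c x) ∧ ∀ b, Up x b → Dn x b))
    (hU1 : Up v false)
    (hU2 : ∀ x y, x ≠ v → R x y →
      (∃ c, Chd R v c y ∧ rank x < rank c ∧
        (∀ c', Chd R v c' y → rank x < rank c' → rank c ≤ rank c') ∧ ∀ b, Dn c b → Up x b) ∨
      ((∀ c, Chd R v c y → ¬ rank x < rank c) ∧ ∀ b, Up y b → Up x b)) :
    (ReflTransGen R u v → Dn v true) ∧ (¬ ReflTransGen R u v → Dn v false) := by
  classical
  obtain ⟨M, hM⟩ : ∃ M, ∀ c, rank c ≤ M := by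
    obtain ⟨M, hM⟩ := (Set.finite_range rank).bddAbove
    exact ⟨M, fun c => hM ⟨c, rfl⟩⟩
  let r : W → W → Prop := fun a b => TransGen (Chd R v) a b ∧ ReflTransGen (Chd R v) b v
  have htr : IsTrans W r := ⟨fun a b c h1 h2 => ⟨h1.1.trans h2.1, h2.2⟩⟩
  have hirr : Std.Irrefl r := ⟨fun a h => chd_irrefl hR h.2 h.1⟩
  have hwf : WellFounded r := Finite.wellFounded_of_trans_of_irrefl r
  have main : ∀ x, ReflTransGen (Chd R v) x v →
      (ReflTransGen (Chd R v) u x → Dn x true) ∧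
      (¬ ReflTransGen (Chd R v) u x → ∀ b, Up x b → Dn x b) := by
    intro x
    induction x using hwf.induction with
    | _ x ih =>
      intro hx
      by_cases hxu : x = u
      · subst hxu
        exact ⟨fun _ => hD1, fun h => absurd .refl h⟩
      have hdesc : ReflTransGen (Chd R v) u x ↔
          ∃ c, Chd R v c x ∧ ReflTransGen (Chd R v) u c := by
        constructor
        · intro h
          rcases ReflTransGen.cases_tail h with h | ⟨c, h1, h2⟩
          · exact absurd h hxu
          · exact ⟨c, h2, h1⟩
        · rintro ⟨c, h1, h2⟩; exact h2.tail h1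
      have sib : ∀ N c, M - rank c = N → Chd R v c x →
          ((∃ c', Chd R v c' x ∧ rank c ≤ rank c' ∧ ReflTransGen (Chd R v) u c') → Dn c true) ∧
          ((¬ ∃ c', Chd R v c' x ∧ rank c ≤ rank c' ∧ ReflTransGen (Chd R v) u c') →
            ∀ b, Up x b → Dn c b) := by
        intro N
        induction N using Nat.strong_induction_on with
        | _ N ihN =>
          intro c hN hc
          have hcx := ih c ⟨.single hc, hx⟩ (.head hc hx)
          by_cases hd : ReflTransGen (Chd R v) u c
          · exact ⟨fun _ => hcx.1 hd, fun h => absurd ⟨c, hc, le_rfl, hd⟩ h⟩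
          · have hup := hcx.2 hd
            have hgt : ∀ c', Chd R v c' x → rank c ≤ rank c' → ReflTransGen (Chd R v) u c' →
                rank c < rank c' := by
              intro c' _ h2 h3
              refine lt_of_le_of_ne h2 (fun h4 => ?_)
              exact hd (hrank h4 ▸ h3)
            rcases hU2 c x hc.2 hc.1 with ⟨c2, h1, h2, h3, h4⟩ | ⟨h1, h2⟩
            · have := hM c2
              have hs := ihN (M - rank c2) (by omega) c2 rfl h1
              have heq : (∃ c', Chd R v c' x ∧ rank c ≤ rank c' ∧ ReflTransGen (Chd R v) u c') ↔
                  ∃ c', Chd R v c' x ∧ rank c2 ≤ rank c' ∧ ReflTransGen (Chd R v) u c' := by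
                constructor
                · rintro ⟨c', e1, e2, e3⟩
                  exact ⟨c', e1, h3 c' e1 (hgt c' e1 e2 e3), e3⟩
                · rintro ⟨c', e1, e2, e3⟩
                  exact ⟨c', e1, by omega, e3⟩
              rw [heq]
              exact ⟨fun h => hup _ (h4 _ (hs.1 h)), fun h b hb => hup _ (h4 _ (hs.2 h b hb))⟩
            · refine ⟨?_, fun _ b hb => hup _ (h2 _ hb)⟩
              rintro ⟨c', e1, e2, e3⟩
              exact absurd (hgt c' e1 e2 e3) (h1 c' e1)
      rcases hD2 x hxu with ⟨c, h1, h2, h3⟩ | ⟨h1, h2⟩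
      · have hs := sib _ c rfl h1
        have heq : (∃ c', Chd R v c' x ∧ rank c ≤ rank c' ∧ ReflTransGen (Chd R v) u c') ↔
            ReflTransGen (Chd R v) u x := by
          rw [hdesc]
          exact ⟨fun ⟨c', e1, _, e3⟩ => ⟨c', e1, e3⟩, fun ⟨c', e1, e3⟩ => ⟨c', e1, h2 _ e1, e3⟩⟩
        rw [heq] at hs
        exact ⟨fun h => h3 _ (hs.1 h), fun h b hb => h3 _ (hs.2 h b hb)⟩
      · refine ⟨?_, fun _ b hb => h2 _ hb⟩
        rw [hdesc]
        rintro ⟨c, e1, _⟩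
        exact absurd e1 (h1 c)
  rw [← rtg_chd_iff]
  exact ⟨(main v .refl).1, fun h => (main v .refl).2 h _ hU1⟩

end Tour
end NestedPebblesGraphs

namespace NestedPebblesGraphs
open Relation

section Tuples
variable {Sig : Type} {k : ℕ} {A0 : GWA Sig 1} {g : LGraph Sig}

/-- Stack invariant at depth `d`. -/
def INV {Y V : Type} (o : V) (d : ℕ) (π : List (PB Y × V)) : Prop :=
  OK 100 π ∧ (.org, o) ∈ π ∧ ∀ j w, (PB.var j, w) ∈ π → j < d

lemma INV.mono {Y V : Type} {o : V} {d d' : ℕ} {π : List (PB Y × V)} (h : INV o d π)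
    (hd : d ≤ d') : INV o d' π :=
  ⟨h.1, h.2.1, fun j w hj => (h.2.2 j w hj).trans_le hd⟩

/-- Block of pebbles for a tuple. -/
def blkL {Y V : Type} (d : ℕ) (a : Fin k → V) (l : List (Fin k)) : List (PB Y × V) :=
  l.map (fun i => (PB.var (d + i.val), a i))

lemma mem_blkL {Y V : Type} {d : ℕ} {a : Fin k → V} {l : List (Fin k)} {x : PB Y} {w : V} :
    (x, w) ∈ blkL d a l ↔ ∃ i ∈ l, x = .var (d + i.val) ∧ w = a i := by
  simp only [blkL, List.mem_map, Prod.mk.injEq]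
  exact ⟨fun ⟨i, h1, h2, h3⟩ => ⟨i, h1, h2.symm, h3.symm⟩,
    fun ⟨i, h1, h2, h3⟩ => ⟨i, h1, h2.symm, h3.symm⟩⟩

abbrev blk {Y V : Type} (d : ℕ) (a : Fin k → V) : List (PB Y × V) := blkL d a (List.finRange k)

lemma INV.blk {Y V : Type} {o : V} {d : ℕ} {π : List (PB Y × V)} (h : INV o d π)
    (a : Fin k → V) : INV o (d + k) (blk d a ++ π) := by
  refine ⟨⟨?_, ?_⟩, List.mem_append_right _ h.2.1, ?_⟩
  · rw [List.map_append, List.nodup_append]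
    refine ⟨?_, h.1.1, ?_⟩
    · simp only [blkL, List.map_map, Function.comp_def]
      refine (List.nodup_finRange k).map (fun i j hij => ?_)
      simp only [PB.var.injEq] at hij
      exact Fin.ext (by omega)
    · intro x hx y hy hxy
      subst hxy
      obtain ⟨⟨x1, w1⟩, h1, rfl⟩ := List.mem_map.1 hx
      obtain ⟨⟨x2, w2⟩, h2, h3⟩ := List.mem_map.1 hy
      obtain ⟨i, _, e1, _⟩ := mem_blkL.1 h1
      dsimp only at h3
      rw [h3, e1] at h2
      have := h.2.2 _ _ h2
      omega
  · rintro ⟨x, w⟩ hp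
    rcases List.mem_append.1 hp with hp | hp
    · obtain ⟨i, _, rfl, _⟩ := mem_blkL.1 hp
      simp [PB.rk]
    · exact h.1.2 _ hp
  · intro j w hj
    rcases List.mem_append.1 hj with hp | hp
    · obtain ⟨i, _, e1, _⟩ := mem_blkL.1 hp
      simp only [PB.var.injEq] at e1
      have := i.isLt
      omega
    · have := h.2.2 _ _ hp
      omega

lemma mem_blk {Y V : Type} {d : ℕ} {π : List (PB Y × V)} {a : Fin k → V} (i : Fin k) :
    (PB.var (d + i.val), a i) ∈ blk d a ++ π :=
  List.mem_append_left _ (mem_blkL.2 ⟨i, List.mem_finRange i, rfl, rfl⟩)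

def saveL (d : ℕ) : List (Fin k) → PG A0 k Unit
  | [] => .pure ()
  | i :: l => (saveL d l).bind fun _ => Prog.op (.drop i (.var (d + i.val)))

def retrL (d : ℕ) : List (Fin k) → PG A0 k Unit
  | [] => .pure ()
  | i :: l => (Prog.op (.retr (.var (d + i.val)))).bind fun _ => retrL d l

lemma run_saveL {d : ℕ} {o : g.V} {hs : Fin k → g.V} {π : List (PB A0.X × g.V)} (hπ : INV o d π)
    (l : List (Fin k)) (hl : l.Nodup) :
    Run (saveL d l) (hs, π) () (hs, blkL d hs l ++ π) := by
  induction l with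
  | nil => exact run_pure'
  | cons i l ih =>
    rw [List.nodup_cons] at hl
    refine Run.bind (ih hl.2) (run_drop ?_)
    intro w hw
    rcases List.mem_append.1 hw with hw | hw
    · obtain ⟨j, hj, e1, _⟩ := mem_blkL.1 hw
      simp only [PB.var.injEq] at e1
      obtain rfl : i = j := Fin.ext (by omega)
      exact hl.1 hj
    · have := hπ.2.2 _ _ hw
      omega

lemma run_retrL {d : ℕ} {a hs : Fin k → g.V} {π : List (PB A0.X × g.V)} (l : List (Fin k)) :
    Run (retrL d l) (hs, blkL d a l ++ π) () (hs, π) := by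
  induction l with
  | nil => exact run_pure'
  | cons i l ih => exact Run.bind run_retr ih

abbrev saveT (d : ℕ) : PG A0 k Unit := saveL d (List.finRange k)
abbrev retrT (d : ℕ) : PG A0 k Unit := retrL d (List.finRange k)

lemma run_saveT {d : ℕ} {o : g.V} {hs : Fin k → g.V} {π : List (PB A0.X × g.V)} (hπ : INV o d π) :
    Run (saveT d) (hs, π) () (hs, blk d hs ++ π) :=
  run_saveL hπ _ (List.nodup_finRange k)

lemma run_retrT {d : ℕ} {a hs : Fin k → g.V} {π : List (PB A0.X × g.V)} :
    Run (retrT d) (hs, blk d a ++ π) () (hs, π) := run_retrL _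

noncomputable def loadL (f : Fin k → PB A0.X) : List (Fin k) → PG A0 k Unit
  | [] => .pure ()
  | i :: l => (loadL f l).bind fun _ => jump i (f i)

lemma run_loadL (hA : GDeterministic A0) (hJ : NoJump A0) (hg : Good A0 g) {f : Fin k → PB A0.X}
    {a hs : Fin k → g.V} {π : List (PB A0.X × g.V)} (hπ : OK 1 π) (hf : ∀ i, (f i, a i) ∈ π)
    (l : List (Fin k)) :
    Run (loadL f l) (hs, π) () (fun i => if i ∈ l then a i else hs i, π) := by
  induction l with
  | nil => simp only [List.not_mem_nil, if_false]; exact run_pure'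
  | cons i l ih =>
    have := Run.bind (f := fun _ => jump i (f i)) ih (run_jump hA hJ hg hπ (hf i))
    unfold loadL
    convert this using 2
    funext j
    by_cases hj : j = i
    · subst hj; simp
    · simp [hj]

noncomputable def loadT (f : Fin k → PB A0.X) : PG A0 k Unit := loadL f (List.finRange k)

lemma run_loadT (hA : GDeterministic A0) (hJ : NoJump A0) (hg : Good A0 g) {f : Fin k → PB A0.X}
    {a hs : Fin k → g.V} {π : List (PB A0.X × g.V)} (hπ : OK 1 π) (hf : ∀ i, (f i, a i) ∈ π) :
    Run (loadT f) (hs, π) () (a, π) := by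
  have := run_loadL (hs := hs) hA hJ hg hπ hf (List.finRange k)
  unfold loadT
  convert this using 3
  simp

def atL (f : Fin k → PB A0.X) : List (Fin k) → PG A0 k Bool
  | [] => .pure true
  | i :: l => (Prog.test (.peb i (f i))).bind fun b => if b then atL f l else .pure false

open Classical in
lemma run_atL {f : Fin k → PB A0.X}
    {a hs : Fin k → g.V} {π : List (PB A0.X × g.V)} (hπ : OK 1 π) (hf : ∀ i, (f i, a i) ∈ π)
    (l : List (Fin k)) :
    Run (atL f l) (hs, π) (decide (∀ i ∈ l, hs i = a i)) (hs, π) := by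
  induction l with
  | nil =>
    have : Run (atL f []) (hs, π) true (hs, π) := run_pure'
    convert this using 2
    simp
  | cons i l ih =>
    have hm : gTestHolds g (.peb i (f i)) hs π ↔ hs i = a i := by
      simp only [gTestHolds]
      exact ⟨fun h => hπ.uniq h (hf i), fun h => h ▸ hf i⟩
    by_cases h : hs i = a i
    · have : Run (atL f (i :: l)) (hs, π) (decide (∀ i ∈ l, hs i = a i)) (hs, π) :=
        Run.bind (run_test_t (s := (hs, π)) (hm.2 h)) ih
      convert this using 2
      simp [h]
    · have : Run (atL f (i :: l)) (hs, π) false (hs, π) :=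
        Run.bind (run_test_f (s := (hs, π)) (fun h' => h (hm.1 h'))) run_pure'
      convert this using 2
      simp [h]

def atT (f : Fin k → PB A0.X) : PG A0 k Bool := atL f (List.finRange k)

open Classical in
lemma run_atT {f : Fin k → PB A0.X}
    {a hs : Fin k → g.V} {π : List (PB A0.X × g.V)} (hπ : OK 1 π) (hf : ∀ i, (f i, a i) ∈ π) :
    Run (atT f) (hs, π) (decide (hs = a)) (hs, π) := by
  have := run_atL (hs := hs) hπ hf (List.finRange k)
  unfold atT
  convert this using 2
  simp [funext_iff]

noncomputable def nextL : List (Fin k) → PG A0 k Bool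
  | [] => .pure false
  | i :: l => (nextN i).bind fun b => if b then .pure true else nextL l

noncomputable def nextT : PG A0 k Bool := nextL (List.finRange k)

def valL {V : Type} (n : ℕ) (e : V → ℕ) (hs : Fin k → V) : List (Fin k) → ℕ
  | [] => 0
  | i :: l => e (hs i) + (n + 1) * valL n e hs l

lemma valL_congr {V : Type} {n : ℕ} {e : V → ℕ} {hs hs' : Fin k → V} (l : List (Fin k))
    (h : ∀ i ∈ l, hs i = hs' i) : valL n e hs l = valL n e hs' l := by
  induction l with
  | nil => rfl
  | cons i l ih =>
    simp only [valL]
    rw [h i List.mem_cons_self, ih (fun j hj => h j (List.mem_cons_of_mem _ hj))]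

lemma valL_lt {V : Type} {n : ℕ} {e : V → ℕ} (he : ∀ v, e v ≤ n) (hs : Fin k → V)
    (l : List (Fin k)) : valL n e hs l < (n + 1) ^ l.length := by
  induction l with
  | nil => simp [valL]
  | cons i l ih =>
    simp only [valL, List.length_cons, pow_succ]
    have := he (hs i)
    nlinarith

lemma valL_inj {V : Type} {n : ℕ} {e : V → ℕ} (he : ∀ v, e v ≤ n) (hi : Function.Injective e)
    {hs hs' : Fin k → V} (l : List (Fin k)) (h : valL n e hs l = valL n e hs' l) :
    ∀ i ∈ l, hs i = hs' i := by
  induction l with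
  | nil => simp
  | cons i l ih =>
    simp only [valL] at h
    have h1 := he (hs i)
    have h2 := he (hs' i)
    have h3 : e (hs i) = e (hs' i) := by
      have := congrArg (· % (n + 1)) h
      simp only [Nat.add_mul_mod_self_left] at this
      rwa [Nat.mod_eq_of_lt (by omega), Nat.mod_eq_of_lt (by omega)] at this
    rw [h3] at h
    have h4 : valL n e hs l = valL n e hs' l :=
      Nat.eq_of_mul_eq_mul_left (Nat.succ_pos n) (Nat.add_left_cancel h)
    intro j hj
    rcases List.mem_cons.1 hj with rfl | hj
    · exact hi h3
    · exact ih h4 j hj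

/-- Specification of the enumeration of the tuples. -/
def EnumT (A0 : GWA Sig 1) {g : LGraph Sig} (k : ℕ) (o : g.V) (rank : (Fin k → g.V) → ℕ) : Prop :=
  Function.Injective rank ∧ rank (fun _ => o) = 0 ∧
  ∀ (hs : Fin k → g.V) (π : List (PB A0.X × g.V)), OK 4 π → (.org, o) ∈ π →
    (∃ hs', rank hs' = rank hs + 1 ∧ Run nextT (hs, π) true (hs', π)) ∨
    ((∀ hs', rank hs' ≤ rank hs) ∧ ∃ hs', Run nextT (hs, π) false (hs', π))

lemma exists_enumT (hA : GDeterministic A0) (hJ : NoJump A0) (hg : Good A0 g) (k : ℕ) (o : g.V) :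
    ∃ rank, EnumT A0 k o rank := by
  obtain ⟨n, e, h0, hN⟩ := exists_enum hA hJ hg k o
  have he : ∀ v, (fun v => (e v).val) v ≤ n := fun v => Nat.le_of_lt_succ (e v).isLt
  have hinj : Function.Injective (fun v => (e v).val) := fun a b h => e.injective (Fin.ext h)
  refine ⟨fun hs => valL n (fun v => (e v).val) hs (List.finRange k), ?_, ?_, ?_⟩
  · intro a b h
    funext i
    exact valL_inj he hinj _ h i (List.mem_finRange i)
  · dsimp only
    induction List.finRange k with
    | nil => rfl
    | cons i l ih => simp [valL, ih, h0]
  · intro hs π hπ ho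
    have key : ∀ (l : List (Fin k)) (hs : Fin k → g.V), l.Nodup →
        (∃ hs', valL n (fun v => (e v).val) hs' l = valL n (fun v => (e v).val) hs l + 1 ∧
          (∀ i, i ∉ l → hs' i = hs i) ∧ Run (nextL l) (hs, π) true (hs', π)) ∨
        (valL n (fun v => (e v).val) hs l + 1 = (n + 1) ^ l.length ∧
          ∃ hs', Run (nextL l) (hs, π) false (hs', π)) := by
      intro l
      induction l with
      | nil => intro hs _; right; exact ⟨by simp [valL], hs, run_pure'⟩
      | cons i l ih =>
        intro hs hl
        rw [List.nodup_cons] at hl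
        obtain ⟨h1, h2⟩ := hN i hs π hπ ho
        by_cases hlast : (e (hs i)).val = n
        · have hr := h2 hlast
          have hcong : valL n (fun v => (e v).val) (Function.update hs i o) l
              = valL n (fun v => (e v).val) hs l := by
            refine valL_congr l (fun j hj => ?_)
            rw [Function.update_of_ne]
            rintro rfl; exact hl.1 hj
          rcases ih (Function.update hs i o) hl.2 with ⟨hs', e1, e2, e3⟩ | ⟨e1, hs', e3⟩
          · left
            refine ⟨hs', ?_, ?_, Run.bind hr e3⟩
            · simp only [valL]
              rw [e1, hcong, e2 i hl.1, Function.update_self, h0, hlast]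
              simp only [Fin.val_zero]
              ring
            · intro j hj
              rw [List.mem_cons, not_or] at hj
              rw [e2 j hj.2, Function.update_of_ne hj.1]
          · right
            refine ⟨?_, hs', Run.bind hr e3⟩
            simp only [valL, List.length_cons, pow_succ]
            rw [← e1, hcong, hlast]
            ring
        · left
          have hlt : (e (hs i)).val + 1 < n + 1 := by have := (e (hs i)).isLt; omega
          have hr := h1 (e.symm ⟨_, hlt⟩) (by simp)
          refine ⟨Function.update hs i (e.symm ⟨_, hlt⟩), ?_, ?_, Run.bind hr run_pure'⟩
          · simp only [valL, Function.update_self, Equiv.apply_symm_apply]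
            rw [valL_congr (hs := Function.update hs i (e.symm ⟨_, hlt⟩)) (hs' := hs) l]
            · ring
            · intro j hj
              rw [Function.update_of_ne]
              rintro rfl; exact hl.1 hj
          · intro j hj
            rw [List.mem_cons, not_or] at hj
            rw [Function.update_of_ne hj.1]
    rcases key (List.finRange k) hs (List.nodup_finRange k) with ⟨hs', e1, _, e3⟩ | ⟨e1, hs', e3⟩
    · exact Or.inl ⟨hs', e1, e3⟩
    · refine Or.inr ⟨fun hs2 => ?_, hs', e3⟩
      have := valL_lt he hs2 (List.finRange k)
      dsimp only
      omega

/-- Search for a tuple satisfying the test, from the current one. -/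
noncomputable def scan (T : PG A0 k Bool) : PG A0 k Bool :=
  Prog.iter (S := Unit) (fun _ => T.bind fun b => if b then .pure (.inr true) else
    nextT.bind fun b' => if b' then .pure (.inl ()) else .pure (.inr false)) ()

noncomputable def scanNext (T : PG A0 k Bool) : PG A0 k Bool :=
  nextT.bind fun b => if b then scan T else .pure false

open Classical in
lemma run_scan {T : PG A0 k Bool} {P : (Fin k → g.V) → Prop} {o : g.V} {rank : (Fin k → g.V) → ℕ}
    (hE : EnumT A0 k o rank) {π : List (PB A0.X × g.V)} (hπ : OK 4 π) (ho : (.org, o) ∈ π)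
    (hT : ∀ hs, Run T (hs, π) (decide (P hs)) (hs, π)) (hs : Fin k → g.V) :
    (∃ b, P b ∧ rank hs ≤ rank b ∧ (∀ b', P b' → rank hs ≤ rank b' → rank b ≤ rank b') ∧
      Run (scan T) (hs, π) true (b, π)) ∨
    ((∀ b', P b' → ¬ rank hs ≤ rank b') ∧ ∃ hs', Run (scan T) (hs, π) false (hs', π)) := by
  obtain ⟨M, hM⟩ : ∃ M, ∀ c, rank c ≤ M := by
    have := g.finV
    obtain ⟨M, hM⟩ := (Set.finite_range rank).bddAbove
    exact ⟨M, fun c => hM ⟨c, rfl⟩⟩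
  unfold scan
  simp only [run_iter]
  induction hN : M - rank hs using Nat.strong_induction_on generalizing hs with
  | _ N ih =>
    have hT' := hT hs
    by_cases hp : P hs
    · left
      simp only [hp, decide_true] at hT'
      exact ⟨hs, hp, le_rfl, fun _ _ h => h, .done (Run.bind hT' run_pure')⟩
    · simp only [hp, decide_false] at hT'
      have hstep : ∀ b', P b' → rank hs ≤ rank b' → rank hs + 1 ≤ rank b' := by
        intro b' h1 h2
        rcases Nat.lt_or_ge (rank hs) (rank b') with h | h
        · exact h
        · exact absurd (hE.1 (le_antisymm h2 h) ▸ h1) hp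
      rcases hE.2.2 hs π hπ ho with ⟨hs', e1, e2⟩ | ⟨e1, hs', e2⟩
      · have hm : Run (T.bind fun b => if b then Prog.pure (Sum.inr true) else
            nextT.bind fun b' => if b' then Prog.pure (Sum.inl ()) else Prog.pure (Sum.inr false))
            (hs, π) (Sum.inl ()) (hs', π) :=
          Run.bind hT' (Run.bind e2 run_pure')
        have := hM hs'
        rcases ih (M - rank hs') (by omega) hs' rfl with ⟨b, b1, b2, b3, b4⟩ | ⟨b1, hs2, b2⟩
        · refine Or.inl ⟨b, b1, by omega, fun b' p1 p2 => ?_, .more hm b4⟩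
          exact b3 b' p1 (by have := hstep b' p1 p2; omega)
        · refine Or.inr ⟨fun b' p1 p2 => b1 b' p1 ?_, hs2, .more hm b2⟩
          have := hstep b' p1 p2; omega
      · right
        refine ⟨fun b' p1 p2 => ?_, hs', .done (Run.bind hT' (Run.bind e2 run_pure'))⟩
        have h1 := hstep b' p1 p2
        have h2 := e1 b'
        omega

open Classical in
lemma run_scanNext {T : PG A0 k Bool} {P : (Fin k → g.V) → Prop} {o : g.V}
    {rank : (Fin k → g.V) → ℕ}
    (hE : EnumT A0 k o rank) {π : List (PB A0.X × g.V)} (hπ : OK 4 π) (ho : (.org, o) ∈ π)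
    (hT : ∀ hs, Run T (hs, π) (decide (P hs)) (hs, π)) (hs : Fin k → g.V) :
    (∃ b, P b ∧ rank hs < rank b ∧ (∀ b', P b' → rank hs < rank b' → rank b ≤ rank b') ∧
      Run (scanNext T) (hs, π) true (b, π)) ∨
    ((∀ b', P b' → ¬ rank hs < rank b') ∧ ∃ hs', Run (scanNext T) (hs, π) false (hs', π)) := by
  rcases hE.2.2 hs π hπ ho with ⟨hs', e1, e2⟩ | ⟨e1, hs', e2⟩
  · rcases run_scan hE hπ ho hT hs' with ⟨b, b1, b2, b3, b4⟩ | ⟨b1, hs2, b2⟩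
    · refine Or.inl ⟨b, b1, by omega, fun b' p1 p2 => b3 b' p1 (by omega), Run.bind e2 b4⟩
    · refine Or.inr ⟨fun b' p1 p2 => b1 b' p1 (by omega), hs2, Run.bind e2 b2⟩
  · refine Or.inr ⟨fun b' p1 p2 => ?_, hs', Run.bind e2 run_pure'⟩
    have := e1 b'
    omega

/-- Run `C` with the current tuple stored in block `d`, restoring the heads. -/
noncomputable def evalAt (d : ℕ) (C : PG A0 k Bool) : PG A0 k Bool :=
  (saveT d).bind fun _ => C.bind fun b => (loadT (fun i => .var (d + i.val))).bind fun _ =>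
  (retrT d).bind fun _ => .pure b

lemma run_evalAt (hA : GDeterministic A0) (hJ : NoJump A0) (hg : Good A0 g) {d : ℕ} {o : g.V}
    {hs hs' : Fin k → g.V} {π : List (PB A0.X × g.V)} (hπ : INV o d π) {C : PG A0 k Bool} {b : Bool}
    (hC : Run C (hs, blk d hs ++ π) b (hs', blk d hs ++ π)) :
    Run (evalAt d C) (hs, π) b (hs, π) :=
  Run.bind (run_saveT hπ) (Run.bind hC (Run.bind
    (run_loadT hA hJ hg ((hπ.blk hs).1.mono (by omega)) (fun i => mem_blk i))
    (Run.bind run_retrT run_pure')))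

end Tuples
end NestedPebblesGraphs

namespace NestedPebblesGraphs
open Relation

section TC
variable {Sig : Type} {k : ℕ} {A0 : GWA Sig 1} {g : LGraph Sig}

abbrev bvar (d : ℕ) : Fin k → PB A0.X := fun i => .var (d + i.val)

noncomputable def firstT : PG A0 k Unit := loadT (fun _ => .org)

/-- One step of the depth-first tour, going down. -/
noncomputable def dnBody (d : ℕ) (fu : Fin k → PB A0.X) (cT1 : PG A0 k Bool) :
    PG A0 k (Bool ⊕ Bool) :=
  (atT fu).bind fun b => if b then .pure (.inr true) else
  (saveT d).bind fun _ => firstT.bind fun _ => (scan cT1).bind fun r =>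
    if r then (retrT d).bind fun _ => .pure (.inl true)
    else (loadT (bvar d)).bind fun _ => (retrT d).bind fun _ => .pure (.inl false)

/-- One step of the depth-first tour, going up. -/
noncomputable def upBody (d : ℕ) (fv : Fin k → PB A0.X) (pT cT2 : PG A0 k Bool) :
    PG A0 k (Bool ⊕ Bool) :=
  (atT fv).bind fun b => if b then .pure (.inr false) else
  (saveT d).bind fun _ => firstT.bind fun _ => (scan pT).bind fun _ =>
  (saveT (d + k)).bind fun _ => (loadT (bvar d)).bind fun _ => (scanNext cT2).bind fun r =>
    if r then (retrT (d + k)).bind fun _ => (retrT d).bind fun _ => .pure (.inl true)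
    else (loadT (bvar (d + k))).bind fun _ => (retrT (d + k)).bind fun _ =>
      (retrT d).bind fun _ => .pure (.inl false)

noncomputable def tcBody (d : ℕ) (fu fv : Fin k → PB A0.X) (cT1 pT cT2 : PG A0 k Bool)
    (m : Bool) : PG A0 k (Bool ⊕ Bool) :=
  if m then dnBody d fu cT1 else upBody d fv pT cT2

noncomputable def tcProg (d : ℕ) (fu fv : Fin k → PB A0.X) (cT1 pT cT2 : PG A0 k Bool) :
    PG A0 k Bool :=
  (loadT fv).bind fun _ => Prog.iter (tcBody d fu fv cT1 pT cT2) true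

open Classical in
lemma run_tcProg (hA : GDeterministic A0) (hJ : NoJump A0) (hg : Good A0 g) {o : g.V} {d : ℕ}
    {π : List (PB A0.X × g.V)} (hπ : INV o d π) {fu fv : Fin k → PB A0.X} {u v : Fin k → g.V}
    (hu : ∀ i, (fu i, u i) ∈ π) (hv : ∀ i, (fv i, v i) ∈ π)
    {R : (Fin k → g.V) → (Fin k → g.V) → Prop} (hR : ∀ a b b', R a b → R a b' → b = b')
    {cT1 pT cT2 : PG A0 k Bool}
    (h1 : ∀ x hs, Run cT1 (hs, blk d x ++ π) (decide (Chd R v hs x)) (hs, blk d x ++ π))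
    (hp : ∀ x hs, Run pT (hs, blk d x ++ π) (decide (R x hs)) (hs, blk d x ++ π))
    (h2 : ∀ x y hs : Fin k → g.V, Run cT2 (hs, blk (d + k) y ++ (blk d x ++ π)) (decide (Chd R v hs y))
      (hs, blk (d + k) y ++ (blk d x ++ π)))
    (hs : Fin k → g.V) :
    ∃ hs', Run (tcProg d fu fv cT1 pT cT2) (hs, π) (decide (ReflTransGen R u v)) (hs', π) := by
  obtain ⟨rank, hE⟩ := exists_enumT hA hJ hg k o
  have hfin := g.finV
  have ok1 : OK 1 π := hπ.1.mono (by omega)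
  let body := tcBody d fu fv cT1 pT cT2
  let Dn : (Fin k → g.V) → Bool → Prop :=
    fun x b => ∃ hs', IterRun body g true (x, π) b (hs', π)
  let Up : (Fin k → g.V) → Bool → Prop :=
    fun x b => ∃ hs', IterRun body g false (x, π) b (hs', π)
  have hD1 : Dn u true := by
    have h := run_atT (hs := u) ok1 hu
    simp only [decide_true] at h
    have : Run (dnBody d fu cT1) (u, π) (.inr true) (u, π) := Run.bind h run_pure'
    exact ⟨u, .done this⟩
  have hU1 : Up v false := by
    have h := run_atT (hs := v) ok1 hv
    simp only [decide_true] at h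
    have : Run (upBody d fv pT cT2) (v, π) (.inr false) (v, π) := Run.bind h run_pure'
    exact ⟨v, .done this⟩
  have hD2 : ∀ x, x ≠ u →
      (∃ c, Chd R v c x ∧ (∀ c', Chd R v c' x → rank c ≤ rank c') ∧ ∀ b, Dn c b → Dn x b) ∨
      ((∀ c, ¬ Chd R v c x) ∧ ∀ b, Up x b → Dn x b) := by
    intro x hx
    have h := run_atT (hs := x) ok1 hu
    simp only [hx, decide_false] at h
    have hi := hπ.blk x
    have hs1 := run_saveT (hs := x) hπ
    have hf : Run firstT (x, blk d x ++ π) () ((fun _ => o), blk d x ++ π) :=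
      run_loadT hA hJ hg (hi.1.mono (by omega)) (fun _ => hi.2.1)
    rcases run_scan hE (hi.1.mono (by omega)) hi.2.1 (h1 x) (fun _ => o) with
      ⟨c, c1, _, c3, c4⟩ | ⟨c1, hs2, c2⟩
    · left
      refine ⟨c, c1, fun c' hc' => c3 c' hc' (by rw [hE.2.1]; omega), ?_⟩
      rintro b ⟨hs', hb⟩
      have : Run (dnBody d fu cT1) (x, π) (.inl true) (c, π) :=
        Run.bind h (Run.bind hs1 (Run.bind hf (Run.bind c4 (Run.bind run_retrT run_pure'))))
      exact ⟨hs', .more this hb⟩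
    · right
      refine ⟨fun c hc => c1 c hc (by rw [hE.2.1]; omega), ?_⟩
      rintro b ⟨hs', hb⟩
      have hl : Run (loadT (bvar d)) (hs2, blk d x ++ π) () (x, blk d x ++ π) :=
        run_loadT hA hJ hg (hi.1.mono (by omega)) (fun i => mem_blk i)
      have : Run (dnBody d fu cT1) (x, π) (.inl false) (x, π) :=
        Run.bind h (Run.bind hs1 (Run.bind hf (Run.bind c2 (Run.bind hl
          (Run.bind run_retrT run_pure')))))
      exact ⟨hs', .more this hb⟩
  have hU2 : ∀ x y, x ≠ v → R x y →
      (∃ c, Chd R v c y ∧ rank x < rank c ∧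
        (∀ c', Chd R v c' y → rank x < rank c' → rank c ≤ rank c') ∧ ∀ b, Dn c b → Up x b) ∨
      ((∀ c, Chd R v c y → ¬ rank x < rank c) ∧ ∀ b, Up y b → Up x b) := by
    intro x y hx hxy
    have h := run_atT (hs := x) ok1 hv
    simp only [hx, decide_false] at h
    have hi := hπ.blk x
    have hs1 := run_saveT (hs := x) hπ
    have hf : Run firstT (x, blk d x ++ π) () ((fun _ => o), blk d x ++ π) :=
      run_loadT hA hJ hg (hi.1.mono (by omega)) (fun _ => hi.2.1)
    have hpar : Run (scan pT) ((fun _ => o), blk d x ++ π) true (y, blk d x ++ π) := by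
      rcases run_scan hE (hi.1.mono (by omega)) hi.2.1 (hp x) (fun _ => o) with
        ⟨c, c1, _, c3, c4⟩ | ⟨c1, hs2, c2⟩
      · obtain rfl := hR _ _ _ c1 hxy
        exact c4
      · exact absurd (by rw [hE.2.1]; omega) (c1 y hxy)
    have hi2 := hi.blk y
    have hs2 := run_saveT (hs := y) hi
    have hl : Run (loadT (bvar d)) (y, blk (d + k) y ++ (blk d x ++ π)) ()
        (x, blk (d + k) y ++ (blk d x ++ π)) :=
      run_loadT hA hJ hg (hi2.1.mono (by omega)) (fun i => List.mem_append_right _ (mem_blk i))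
    rcases run_scanNext hE (hi2.1.mono (by omega)) hi2.2.1 (h2 x y) x with
      ⟨c, c1, c2, c3, c4⟩ | ⟨c1, hs3, c2⟩
    · left
      refine ⟨c, c1, c2, c3, ?_⟩
      rintro b ⟨hs', hb⟩
      have : Run (upBody d fv pT cT2) (x, π) (.inl true) (c, π) :=
        Run.bind h (Run.bind hs1 (Run.bind hf (Run.bind hpar (Run.bind hs2 (Run.bind hl
          (Run.bind c4 (Run.bind run_retrT (Run.bind run_retrT run_pure'))))))))
      exact ⟨hs', .more this hb⟩
    · right
      refine ⟨c1, ?_⟩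
      rintro b ⟨hs', hb⟩
      have hl2 : Run (loadT (bvar (d + k))) (hs3, blk (d + k) y ++ (blk d x ++ π)) ()
          (y, blk (d + k) y ++ (blk d x ++ π)) :=
        run_loadT hA hJ hg (hi2.1.mono (by omega)) (fun i => mem_blk i)
      have : Run (upBody d fv pT cT2) (x, π) (.inl false) (y, π) :=
        Run.bind h (Run.bind hs1 (Run.bind hf (Run.bind hpar (Run.bind hs2 (Run.bind hl
          (Run.bind c2 (Run.bind hl2 (Run.bind run_retrT (Run.bind run_retrT run_pure')))))))))
      exact ⟨hs', .more this hb⟩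
  obtain ⟨t1, t2⟩ := tour rank hE.1 hR Dn Up hD1 hD2 hU1 hU2
  have hload := run_loadT (hs := hs) hA hJ hg ok1 hv
  by_cases hr : ReflTransGen R u v
  · obtain ⟨hs', hb⟩ := t1 hr
    simp only [hr, decide_true]
    exact ⟨hs', Run.bind hload (run_iter.2 hb)⟩
  · obtain ⟨hs', hb⟩ := t2 hr
    simp only [hr, decide_false]
    exact ⟨hs', Run.bind hload (run_iter.2 hb)⟩

end TC
end NestedPebblesGraphs

namespace NestedPebblesGraphs
open Relation

section Compile
variable {Sig : Type} {k : ℕ} {A0 : GWA Sig 1} {g : LGraph Sig}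

noncomputable def notP (C : PG A0 k Bool) : PG A0 k Bool := C.bind fun b => .pure (!b)

noncomputable def exP (i0 : Fin k) (env : ℕ → ℕ) (d x : ℕ)
    (C : (ℕ → ℕ) → ℕ → PG A0 k Bool) : PG A0 k Bool :=
  firstT.bind fun _ => scan (evalAt d (C (Function.update env x (d + i0.val)) (d + k)))

noncomputable def childP (fv : Fin k → PB A0.X) (e : ℕ) (C : PG A0 k Bool) : PG A0 k Bool :=
  (atT fv).bind fun b => if b then .pure false else evalAt e C

/-- Compilation of a formula to a program; `env` assigns variables to pebbles, `d` is the
first free variable pebble. -/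
noncomputable def compile (A0 : GWA Sig 1) (i0 : Fin k) :
    GForm Sig k → (ℕ → ℕ) → ℕ → PG A0 k Bool
  | .lab a x, env, _ => (jump i0 (.var (env x))).bind fun _ => Prog.test (.lab i0 a)
  | .edg a x y, env, _ => (jump i0 (.var (env x))).bind fun _ =>
      (Prog.test (.outedge i0 a)).bind fun b => if b then
        (Prog.op (.outm i0 a)).bind fun _ => Prog.test (.peb i0 (.var (env y))) else .pure false
  | .eq x y, env, _ => (jump i0 (.var (env x))).bind fun _ => Prog.test (.peb i0 (.var (env y)))
  | .not φ, env, d => notP (compile A0 i0 φ env d)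
  | .and φ ψ, env, d => (compile A0 i0 φ env d).bind fun b =>
      if b then compile A0 i0 ψ env d else .pure false
  | .or φ ψ, env, d => (compile A0 i0 φ env d).bind fun b =>
      if b then .pure true else compile A0 i0 ψ env d
  | .ex x φ, env, d => exP i0 env d x (compile A0 i0 φ)
  | .all x φ, env, d => notP (exP i0 env d x (fun env d => notP (compile A0 i0 φ env d)))
  | .tc xs ys φ us vs, env, d =>
      tcProg d (fun i => .var (env (us i))) (fun i => .var (env (vs i)))
        (childP (fun i => .var (env (vs i))) (d + k + k)
          (compile A0 i0 φ (updVec (updVec env xs (fun i => d + k + k + i.val)) ys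
            (fun i => d + i.val)) (d + k + k + k)))
        (evalAt (d + k + k)
          (compile A0 i0 φ (updVec (updVec env xs (fun i => d + i.val)) ys
            (fun i => d + k + k + i.val)) (d + k + k + k)))
        (childP (fun i => .var (env (vs i))) (d + k + k)
          (compile A0 i0 φ (updVec (updVec env xs (fun i => d + k + k + i.val)) ys
            (fun i => d + k + i.val)) (d + k + k + k)))

lemma mem_updVec {V Y : Type} {π : List (PB Y × V)} {env : ℕ → ℕ} {ν : ℕ → V} {xs : Fin k → ℕ}
    {A : Fin k → ℕ} {a : Fin k → V} (h : ∀ i, (PB.var (A i), a i) ∈ π) (n : ℕ)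
    (hn : n ∉ Set.range xs → (PB.var (env n), ν n) ∈ π) :
    (PB.var (updVec env xs A n), updVec ν xs a n) ∈ π := by
  unfold updVec
  by_cases hx : ∃ i, xs i = n
  · simp only [hx, dif_pos]
    exact h _
  · simp only [hx, dif_neg, not_false_iff]
    exact hn (fun ⟨i, hi⟩ => hx ⟨i, hi⟩)

/-- Correctness of a program for a property, at given environments. -/
def Corr (g : LGraph Sig) (C : PG A0 k Bool) (π : List (PB A0.X × g.V)) (P : Prop) : Prop :=
  ∀ (b : Bool), (b = true ↔ P) → ∀ hs, ∃ hs', Run C (hs, π) b (hs', π)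

lemma Corr.not {C : PG A0 k Bool} {π : List (PB A0.X × g.V)} {P : Prop} (h : Corr g C π P) :
    Corr g (notP C) π (¬ P) := by
  intro b hb hs
  obtain ⟨hs', h1⟩ := h (!b) (by cases b <;> simp_all) hs
  refine ⟨hs', ?_⟩
  have : Run (notP C) (hs, π) (!!b) (hs', π) := Run.bind h1 run_pure'
  simpa using this

lemma Corr.ex (hA : GDeterministic A0) (hJ : NoJump A0) (hg : Good A0 g) {o : g.V} {i0 : Fin k}
    {env : ℕ → ℕ} {d x : ℕ} {C : (ℕ → ℕ) → ℕ → PG A0 k Bool} {π : List (PB A0.X × g.V)}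
    {P : g.V → Prop} (hπ : INV o d π)
    (h : ∀ a : Fin k → g.V,
      Corr g (C (Function.update env x (d + i0.val)) (d + k)) (blk d a ++ π) (P (a i0))) :
    Corr g (exP i0 env d x C) π (∃ w, P w) := by
  classical
  intro b hb hs
  obtain ⟨rank, hE⟩ := exists_enumT hA hJ hg k o
  have hf : Run firstT (hs, π) () ((fun _ => o), π) :=
    run_loadT hA hJ hg (hπ.1.mono (by omega)) (fun _ => hπ.2.1)
  have hT : ∀ a, Run (evalAt d (C (Function.update env x (d + i0.val)) (d + k))) (a, π)
      (decide (P (a i0))) (a, π) := by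
    intro a
    obtain ⟨hs', h1⟩ := h a (decide (P (a i0))) (by simp) a
    exact run_evalAt hA hJ hg hπ h1
  rcases run_scan (P := fun a => P (a i0)) hE (hπ.1.mono (by omega)) hπ.2.1
      hT (fun _ => o) with ⟨c, c1, _, _, c4⟩ | ⟨c1, hs2, c2⟩
  · obtain rfl : b = true := hb.2 ⟨_, c1⟩
    exact ⟨c, Run.bind hf c4⟩
  · have hb' : b = false := by
      cases b with
      | false => rfl
      | true =>
        obtain ⟨w, hw⟩ := hb.1 rfl
        exact absurd (by rw [hE.2.1]; omega) (c1 (fun _ => w) hw)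
    subst hb'
    exact ⟨hs2, Run.bind hf c2⟩

lemma run_childP (hA : GDeterministic A0) (hJ : NoJump A0) (hg : Good A0 g) {o : g.V}
    {fv : Fin k → PB A0.X} {e : ℕ} {C : PG A0 k Bool} {π : List (PB A0.X × g.V)}
    (hπ : INV o e π) {v a x : Fin k → g.V} {R : (Fin k → g.V) → (Fin k → g.V) → Prop}
    (hv : ∀ i, (fv i, v i) ∈ π) (h : Corr g C (blk e a ++ π) (R a x)) {b : Bool}
    (hb : b = true ↔ Chd R v a x) : Run (childP fv e C) (a, π) b (a, π) := by
  classical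
  have h1 := run_atT (hs := a) (hπ.1.mono (by omega)) hv
  by_cases hav : a = v
  · simp only [hav, decide_true] at h1 ⊢
    have : b = false := by
      cases b with
      | false => rfl
      | true => exact absurd hav (hb.1 rfl).2
    subst this
    exact Run.bind h1 run_pure'
  · simp only [hav, decide_false] at h1
    obtain ⟨hs', h2⟩ := h b (hb.trans ⟨fun h => h.1, fun h => ⟨h, hav⟩⟩) a
    exact Run.bind h1 (run_evalAt hA hJ hg hπ h2)

theorem compile_corr (hA : GDeterministic A0) (hJ : NoJump A0) (hg : Good A0 g) {o : g.V}
    {i0 : Fin k} (φ : GForm Sig k) : ∀ (env : ℕ → ℕ) (d : ℕ) (ν : ℕ → g.V)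
    (π : List (PB A0.X × g.V)), GDetTC φ → INV o d π →
    (∀ n ∈ gfree φ, (PB.var (env n), ν n) ∈ π) →
    Corr g (compile A0 i0 φ env d) π (GSat g φ ν) := by
  classical
  induction φ with
  | lab a x =>
    intro env d ν π _ hπ hn b hb hs
    have hj := run_jump (i := i0) (hs := hs) hA hJ hg (hπ.1.mono (by omega)) (hn x rfl)
    refine ⟨_, Run.bind hj (run_test.2 ⟨?_, rfl⟩)⟩
    simpa [gTestHolds, GSat] using hb
  | edg a x y =>
    intro env d ν π _ hπ hn b hb hs
    have hok : OK 1 π := hπ.1.mono (by omega)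
    have hj := run_jump (i := i0) (hs := hs) hA hJ hg hok (hn x (Or.inl rfl))
    have hy := hn y (Or.inr rfl)
    by_cases hw : ∃ w, g.edge a (ν x) w
    · obtain ⟨w, hw⟩ := hw
      have hw' : g.edge a ((Function.update hs i0 (ν x)) i0) w := by simpa using hw
      refine ⟨_, Run.bind hj (Run.bind (run_test_t ⟨w, hw'⟩)
        (Run.bind (run_outm hw') (run_test.2 ⟨?_, rfl⟩)))⟩
      simp only [gTestHolds, Function.update_self]
      rw [hb]
      constructor
      · intro h
        rw [g.out_unique _ _ _ _ hw h]; exact hy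
      · intro h
        rw [hok.uniq h hy] at hw; exact hw
    · have hbf : b = false := by
        cases b with
        | false => rfl
        | true => exact absurd ⟨_, hb.1 rfl⟩ hw
      subst hbf
      refine ⟨_, Run.bind hj (Run.bind (run_test_f ?_) run_pure')⟩
      simpa [gTestHolds] using hw
  | eq x y =>
    intro env d ν π _ hπ hn b hb hs
    have hok : OK 1 π := hπ.1.mono (by omega)
    have hj := run_jump (i := i0) (hs := hs) hA hJ hg hok (hn x (Or.inl rfl))
    have hy := hn y (Or.inr rfl)
    refine ⟨_, Run.bind hj (run_test.2 ⟨?_, rfl⟩)⟩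
    simp only [gTestHolds, Function.update_self]
    rw [hb]
    constructor
    · intro h
      have h' : ν x = ν y := h
      rw [h']; exact hy
    · intro h
      exact hok.uniq h hy
  | not φ ih =>
    intro env d ν π hD hπ hn
    exact (ih env d ν π hD hπ hn).not
  | and φ ψ ih1 ih2 =>
    intro env d ν π hD hπ hn b hb hs
    have c1 := ih1 env d ν π hD.1 hπ (fun n h => hn n (Or.inl h))
    have c2 := ih2 env d ν π hD.2 hπ (fun n h => hn n (Or.inr h))
    by_cases h : GSat g φ ν
    · obtain ⟨hs1, e1⟩ := c1 true (by simp [h]) hs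
      obtain ⟨hs2, e2⟩ := c2 b (hb.trans ⟨fun h => h.2, fun h' => ⟨h, h'⟩⟩) hs1
      exact ⟨hs2, Run.bind e1 e2⟩
    · obtain ⟨hs1, e1⟩ := c1 false (by simp [h]) hs
      have hbf : b = false := by
        cases b with
        | false => rfl
        | true => exact absurd (hb.1 rfl).1 h
      subst hbf
      exact ⟨hs1, Run.bind e1 run_pure'⟩
  | or φ ψ ih1 ih2 =>
    intro env d ν π hD hπ hn b hb hs
    have c1 := ih1 env d ν π hD.1 hπ (fun n h => hn n (Or.inl h))
    have c2 := ih2 env d ν π hD.2 hπ (fun n h => hn n (Or.inr h))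
    by_cases h : GSat g φ ν
    · obtain ⟨hs1, e1⟩ := c1 true (by simp [h]) hs
      obtain rfl : b = true := hb.2 (Or.inl h)
      exact ⟨hs1, Run.bind e1 run_pure'⟩
    · obtain ⟨hs1, e1⟩ := c1 false (by simp [h]) hs
      obtain ⟨hs2, e2⟩ := c2 b (hb.trans ⟨fun h' => h'.resolve_left h, fun h' => Or.inr h'⟩) hs1
      exact ⟨hs2, Run.bind e1 e2⟩
  | ex x φ ih =>
    intro env d ν π hD hπ hn
    refine Corr.ex (P := fun w => GSat g φ (Function.update ν x w)) hA hJ hg hπ (fun a => ?_)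
    refine ih _ _ _ _ hD (hπ.blk a) (fun n hf => ?_)
    by_cases hx : n = x
    · subst hx
      simp only [Function.update_self]
      exact mem_blk i0
    · rw [Function.update_of_ne hx, Function.update_of_ne hx]
      exact List.mem_append_right _ (hn n ⟨hf, hx⟩)
  | all x φ ih =>
    intro env d ν π hD hπ hn
    have : Corr g (compile A0 i0 (.all x φ) env d) π
        (¬ ∃ w, ¬ GSat g φ (Function.update ν x w)) := by
      refine Corr.not ?_
      refine Corr.ex (P := fun w => ¬ GSat g φ (Function.update ν x w)) hA hJ hg hπ (fun a => ?_)
      refine Corr.not (ih _ _ _ _ hD (hπ.blk a) (fun n hf => ?_))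
      by_cases hx : n = x
      · subst hx
        simp only [Function.update_self]
        exact mem_blk i0
      · rw [Function.update_of_ne hx, Function.update_of_ne hx]
        exact List.mem_append_right _ (hn n ⟨hf, hx⟩)
    intro b hb
    exact this b (by rw [hb]; simp [GSat])
  | tc xs ys φ us vs ih =>
    intro env d ν π hD hπ hn b hb hs
    have key : ∀ (π' : List (PB A0.X × g.V)) (a b : Fin k → g.V) (A B : Fin k → ℕ),
        INV o (d + k + k + k) π' → (∀ p ∈ π, p ∈ π') → (∀ i, (PB.var (A i), a i) ∈ π') →
        (∀ i, (PB.var (B i), b i) ∈ π') →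
        Corr g (compile A0 i0 φ (updVec (updVec env xs A) ys B) (d + k + k + k)) π'
          (GSat g φ (updVec (updVec ν xs a) ys b)) := by
      intro π' a b A B hI hsub hAa hBb
      refine ih _ _ _ _ hD.2 hI (fun n hf => ?_)
      refine mem_updVec hBb n (fun h1 => mem_updVec hAa n (fun h2 => hsub _ (hn n ?_)))
      exact Or.inl (Or.inl ⟨hf, fun h => h.elim h2 h1⟩)
    have hv : ∀ i, ((fun i => PB.var (env (vs i))) i, (fun i => ν (vs i)) i) ∈ π :=
      fun i => hn _ (Or.inr ⟨i, rfl⟩)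
    have := run_tcProg hA hJ hg hπ
      (fu := fun i => PB.var (env (us i))) (fv := fun i => PB.var (env (vs i)))
      (u := fun i => ν (us i)) (v := fun i => ν (vs i))
      (fun i => hn _ (Or.inl (Or.inr ⟨i, rfl⟩))) hv
      (R := fun a b => GSat g φ (updVec (updVec ν xs a) ys b)) (fun a b b' => hD.1 g ν a b b')
      (cT1 := childP (fun i => .var (env (vs i))) (d + k + k)
          (compile A0 i0 φ (updVec (updVec env xs (fun i => d + k + k + i.val)) ys
            (fun i => d + i.val)) (d + k + k + k)))
      (pT := evalAt (d + k + k)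
          (compile A0 i0 φ (updVec (updVec env xs (fun i => d + i.val)) ys
            (fun i => d + k + k + i.val)) (d + k + k + k)))
      (cT2 := childP (fun i => .var (env (vs i))) (d + k + k)
          (compile A0 i0 φ (updVec (updVec env xs (fun i => d + k + k + i.val)) ys
            (fun i => d + k + i.val)) (d + k + k + k)))
      ?_ ?_ ?_ hs
    · have hbd : b = decide (ReflTransGen
          (fun a b : Fin k → g.V => GSat g φ (updVec (updVec ν xs a) ys b))
          (fun i => ν (us i)) (fun i => ν (vs i))) := by
        rw [Bool.eq_iff_iff, decide_eq_true_iff]; exact hb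
      rw [hbd]
      exact this
    · intro x a
      have hI : INV o (d + k + k) (blk d x ++ π) := (hπ.blk x).mono (by omega)
      refine run_childP (x := x) (R := fun a b => GSat g φ (updVec (updVec ν xs a) ys b)) hA hJ hg hI
        (fun i => List.mem_append_right _ (hv i)) ?_ (by simp)
      exact key _ a x _ _ (hI.blk a)
        (fun p hp => List.mem_append_right _ (List.mem_append_right _ hp))
        (fun i => mem_blk i) (fun i => List.mem_append_right _ (mem_blk i))
    · intro x a
      have hI : INV o (d + k + k) (blk d x ++ π) := (hπ.blk x).mono (by omega)
      obtain ⟨hs', h1⟩ := key _ x a (fun i => d + i.val) (fun i => d + k + k + i.val) (hI.blk a)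
        (fun p hp => List.mem_append_right _ (List.mem_append_right _ hp))
        (fun i => List.mem_append_right _ (mem_blk i)) (fun i => mem_blk i)
        (decide (GSat g φ (updVec (updVec ν xs x) ys a))) (by simp) a
      exact run_evalAt hA hJ hg hI h1
    · intro x y a
      have hI : INV o (d + k + k) (blk (d + k) y ++ (blk d x ++ π)) := (hπ.blk x).blk y
      refine run_childP (x := y) (R := fun a b => GSat g φ (updVec (updVec ν xs a) ys b)) hA hJ hg hI
        (fun i => List.mem_append_right _ (List.mem_append_right _ (hv i))) ?_ (by simp)
      exact key _ a y _ _ (hI.blk a)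
        (fun p hp => List.mem_append_right _ (List.mem_append_right _
          (List.mem_append_right _ hp)))
        (fun i => mem_blk i) (fun i => List.mem_append_right _ (mem_blk i))

end Compile
end NestedPebblesGraphs

namespace NestedPebblesGraphs
open Relation

section Final
variable {Sig : Type} {k : ℕ} {A0 : GWA Sig 1} {g : LGraph Sig}

lemma good_of_searches (h : ∀ u : g.V, SearchesFrom A0 g u) : Good A0 g := by
  intro u
  obtain ⟨n, cs, h0, hst, hh, hv⟩ := h u
  have hr : ∀ i : Fin (n + 1), ReflTransGen (GStep A0 g) (gstart A0 u) (cs i) := by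
    intro i
    induction i using Fin.induction with
    | zero => rw [h0]; exact .refl
    | succ i ih => exact ih.tail (hst i)
  refine ⟨⟨_, hr _, hh⟩, fun v => ?_⟩
  obtain ⟨i, j, e⟩ := hv v
  exact ⟨cs i, hr i, by rw [← e, Subsingleton.elim j 0]⟩

noncomputable def mainP [Fintype Sig] (A0 : GWA Sig 1) (i0 : Fin k) (φ : GForm Sig k) :
    PG A0 k Bool :=
  (Prog.op (.drop i0 .org)).bind fun _ => (check i0).bind fun _ =>
  (compile A0 i0 φ id 0).bind fun b => (Prog.op (.retr .org)).bind fun _ => .pure b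

lemma ok_org {Y V : Type} (u : V) (r : ℕ) (hr : r ≤ 100) : OK r [((PB.org : PB Y), u)] := by
  refine ⟨by simp, ?_⟩
  rintro p hp
  rw [List.mem_singleton] at hp
  subst hp
  simpa [PB.rk] using hr

lemma run_mainP [Fintype Sig] (hA : GDeterministic A0) (hJ : NoJump A0) (hg : Good A0 g)
    (i0 : Fin k) {φ : GForm Sig k} (hD : GDetTC φ) (hfr : gfree φ = ∅) (ν : ℕ → g.V) (u : g.V)
    (b : Bool) (hb : b = true ↔ GSat g φ ν) :
    ∃ hs', Run (mainP A0 i0 φ) (fun _ => u, []) b (hs', []) := by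
  obtain ⟨w, hc⟩ := (run_check (i := i0) (hs := fun _ => u) hA hJ
    (ok_org (Y := A0.X) u 8 (by omega))).2 hg
  have hI : INV u 0 [((PB.org : PB A0.X), u)] :=
    ⟨ok_org u 100 le_rfl, by simp, by simp⟩
  obtain ⟨hs', h1⟩ := compile_corr (i0 := i0) hA hJ hg φ id 0 ν _ hD hI (by simp [hfr]) b hb
    (Function.update (fun _ => u) i0 w)
  exact ⟨hs', Run.bind (run_drop (by simp)) (Run.bind hc (Run.bind h1
    (Run.bind run_retr run_pure')))⟩

lemma good_of_run_mainP [Fintype Sig] (hA : GDeterministic A0) (hJ : NoJump A0)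
    (i0 : Fin k) {φ : GForm Sig k} {u : g.V} {b : Bool} {s : Store k (PB A0.X) g}
    (h : Run (mainP A0 i0 φ) (fun _ => u, []) b s) : Good A0 g := by
  obtain ⟨_, s1, h1, h2⟩ := run_bind.1 h
  obtain ⟨_, s2, h3, _⟩ := run_bind.1 h2
  obtain ⟨-, rfl⟩ := Run.det h1 (run_drop (by simp))
  exact ((run_check (i := i0) (hs := fun _ => u) hA hJ
    (ok_org (Y := A0.X) u 8 (by omega))).1 _ _ h3).1

lemma acc_mainP [Fintype Sig] (hA : GDeterministic A0) (hJ : NoJump A0)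
    (i0 : Fin k) {φ : GForm Sig k} (hD : GDetTC φ) (hfr : gfree φ = ∅) (ν : ℕ → g.V) (u : g.V) :
    AccFrom ((mainP A0 i0 φ).toGWA i0) g u ↔ Good A0 g ∧ GSat g φ ν := by
  classical
  rw [Prog.accFrom_iff]
  constructor
  · rintro ⟨hs', h⟩
    have hg := good_of_run_mainP hA hJ i0 h
    refine ⟨hg, ?_⟩
    obtain ⟨hs2, h2⟩ := run_mainP hA hJ hg i0 hD hfr ν u (decide (GSat g φ ν)) (by simp)
    have := (Run.det h h2).1
    simpa using this
  · rintro ⟨hg, hs⟩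
    exact run_mainP hA hJ hg i0 hD hfr ν u true (by simp [hs])

theorem FODTC_sub [Fintype Sig] (F : Set (LGraph Sig)) (hF : Searchable Sig F) (hk : 1 ≤ k) :
    FODTCg Sig F k ⊆ DPTWAg Sig F k := by
  obtain ⟨A0, hA, hJ, hS⟩ := hF
  rintro L ⟨φ, -, hD, hfr, rfl⟩
  let i0 : Fin k := ⟨0, hk⟩
  refine ⟨(mainP A0 i0 φ).toGWA i0, Prog.toGWA_det _ _, Prog.toGWA_noJump _ _, ?_, ?_⟩
  · intro g u1 u2 h
    exact (acc_mainP hA hJ i0 hD hfr (fun _ => u1) u2).2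
      ((acc_mainP hA hJ i0 hD hfr (fun _ => u1) u1).1 h)
  · ext g
    constructor
    · rintro ⟨hgF, h⟩
      exact ⟨hgF, fun u => (acc_mainP hA hJ i0 hD hfr (fun _ => u) u).2
        ⟨good_of_searches (hS g hgF), h _⟩⟩
    · rintro ⟨hgF, h⟩
      exact ⟨hgF, fun ν => ((acc_mainP hA hJ i0 hD hfr ν (ν 0)).1 (h (ν 0))).2⟩

end Final
end NestedPebblesGraphs


namespace NestedPebblesGraphs

/-- For every searchable family of graphs and every `k ≥ 1`,
`DPTWA^k = FO+DTC^k`. -/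
theorem DPTWAg_eq_FODTCg_of_searchable (Sig : Type) [Fintype Sig]
    (F : Set (LGraph Sig)) (hF : Searchable Sig F) (k : ℕ) (hk : 1 ≤ k) :
    DPTWAg Sig F k = FODTCg Sig F k := by
  exact Set.Subset.antisymm (DPTWA_sub F) (FODTC_sub F hF hk)

end NestedPebblesGraphs
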